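/- There exists β̄ ≥ 1 such that for every β ≥ β̄, every ε > 0, every L ≥ 2, every pair of sites x, y ∈ Λ, and every real m with 0 ≤ m ≤ β^{1/8}, the fluctuations of the field t are uniformly bounded: ⟨cosh^m(t_x − t_y)⟩ ≤ 2. -/

import Mathlib

open scoped BigOperators Classical
open MeasureTheory

noncomputable section

/-- The 3-dimensional discrete torus of side `L`. -/
abbrev Torus (L : ℕ) := Fin 3 → ZMod L

/-- The unit vector in direction `i`. -/
def unitVec (L : ℕ) (i : Fin 3) : Torus L := fun j => if j = i then 1 else 0

/-- Nearest-neighbor relation on the torus. -/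
def NN {L : ℕ} (x y : Torus L) : Prop :=
  x ≠ y ∧ ∃ i : Fin 3, y = x + unitVec L i ∨ y = x - unitVec L i

/-- Periodic (Euclidean) distance on the torus. -/
def torusDist {L : ℕ} (x y : Torus L) : ℝ :=
  Real.sqrt (∑ i : Fin 3, (min ((x i - y i).val) (L - (x i - y i).val) : ℝ) ^ 2)

variable {L : ℕ}

/-- Sum of a (symmetric) function over unordered nearest-neighbor pairs. -/
def nnSum [NeZero L] (f : Torus L → Torus L → ℝ) : ℝ :=
  (1 / 2) * ∑ x : Torus L, ∑ y : Torus L, if NN x y then f x y else 0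

/-- The matrix of the operator `D_{β,ε}(t)`, the symmetric operator on `ℝ^Λ` with
quadratic form `β ∑_{NN (ij)} e^{t_i+t_j}(v_i-v_j)² + ε ∑_k e^{t_k} v_k²`. -/
def Dmat [NeZero L] (β ε : ℝ) (t : Torus L → ℝ) : Matrix (Torus L) (Torus L) ℝ :=
  Matrix.of fun j k =>
    if j = k then
      β * (∑ i : Torus L, if NN i j then Real.exp (t i + t j) else 0) + ε * Real.exp (t j)
    else if NN j k then -(β * Real.exp (t j + t k)) else 0

/-- The free energy (effective action) `F_{β,ε}(t)`. -/
def freeEnergy [NeZero L] (β ε : ℝ) (t : Torus L → ℝ) : ℝ :=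
  β * nnSum (fun i j => Real.cosh (t i - t j) - 1)
    - (1 / 2) * Real.log (Dmat β ε t).det
    + ∑ k : Torus L, (t k - ε + ε * Real.cosh (t k))

/-- The expectation `⟨f⟩ = ∫ f(t) e^{-F_{β,ε}(t)} ∏ dt_k/√(2π)`. -/
def expect [NeZero L] (β ε : ℝ) (f : (Torus L → ℝ) → ℝ) : ℝ :=
  ∫ t : Torus L → ℝ,
    f t * Real.exp (-(freeEnergy β ε t)) *
      ((Real.sqrt (2 * Real.pi))⁻¹) ^ (Fintype.card (Torus L))


section PartA1
open scoped BigOperators Classical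
open MeasureTheory
noncomputable section

lemma oneD_zero : ∫⁻ s in Set.Ioi (0:ℝ), ENNReal.ofReal ((Real.sqrt s)⁻¹ * Real.exp (-s/2)) ≤
    ENNReal.ofReal (Real.sqrt (2*Real.pi)) := by
  have h := Real.integral_rpow_mul_exp_neg_mul_Ioi (a := 1/2) (r := 1/2) (by norm_num) (by norm_num)
  have e : ∀ s ∈ Set.Ioi (0:ℝ), (Real.sqrt s)⁻¹ * Real.exp (-s/2) = s ^ ((1:ℝ)/2 - 1) * Real.exp (-(1/2*s)) := by
    intro s hs
    have hs' : (0:ℝ) < s := hs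
    rw [show ((1:ℝ)/2 - 1) = -(1/2) by norm_num, Real.rpow_neg hs'.le, ← Real.sqrt_eq_rpow]
    congr 2; ring
  rw [setLIntegral_congr_fun measurableSet_Ioi (fun s hs => by rw [e s hs])]
  have hpos : 0 < ∫ t in Set.Ioi (0:ℝ), t ^ ((1:ℝ)/2 - 1) * Real.exp (-(1/2*t)) := by
    rw [h]
    have := Real.Gamma_pos_of_pos (s := 1/2) (by norm_num)
    positivity
  rw [← ofReal_integral_eq_lintegral_ofReal]
  · rw [h, Real.Gamma_one_half_eq, Real.sqrt_mul (by norm_num), Real.sqrt_eq_rpow 2]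
    norm_num
  · by_contra hc
    rw [integral_undef hc] at hpos
    exact lt_irrefl _ hpos
  · refine (ae_restrict_iff' measurableSet_Ioi).2 (Filter.Eventually.of_forall fun s hs => ?_)
    have hs' : (0:ℝ) < s := hs
    positivity

lemma oneD_pos (a : ℝ) (ha : 0 < a) :
    ∫⁻ s in Set.Ioi (0:ℝ), ENNReal.ofReal ((Real.sqrt s)⁻¹ * Real.exp (-s/2 - a^2/(2*s))) ≤
    ENNReal.ofReal (Real.sqrt (2*Real.pi) * Real.exp (-a)) := by
  set r : ℝ → ℝ := fun u => Real.sqrt (u^2+4*a) with hr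
  have hrpos : ∀ u, 0 < r u := fun u => Real.sqrt_pos.2 (by positivity)
  have hrsq : ∀ u, r u ^2 = u^2+4*a := fun u => Real.sq_sqrt (by positivity)
  have hypos : ∀ u, 0 < (u + r u)/2 := by
    intro u
    have h1 := hrpos u; have h2 := hrsq u
    by_contra hc
    push Not at hc
    nlinarith
  set h : ℝ → ℝ := fun u => ((u + r u)/2)^2 with hh
  have hr' : ∀ u, HasDerivAt r (u / r u) u := by
    intro u
    have := (((hasDerivAt_id u).pow 2).add_const (4*a)).sqrt (by simp; positivity)
    refine (this.congr_deriv ?_ : HasDerivAt r (u / r u) u)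
    have e : √((id ^ 2 : ℝ → ℝ) u + 4 * a) = r u := rfl
    rw [e]
    have := hrpos u
    simp only [id, Nat.cast_ofNat]
    field_simp
    norm_num
  have hd : ∀ u, HasDerivAt h (2*((u + r u)/2)^2 / r u) u := by
    intro u
    have := (((hasDerivAt_id u).add (hr' u)).div_const 2).pow 2
    refine (this.congr_deriv ?_ : HasDerivAt h _ u)
    have := hrpos u
    have e : (((id : ℝ → ℝ) + r) u : ℝ) = u + r u := rfl
    simp only [e, Nat.cast_ofNat]
    field_simp
    ring
  have hmono : StrictMono h := by
    apply strictMono_of_deriv_pos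
    intro u
    rw [(hd u).deriv]
    have := hrpos u; have := hypos u
    positivity
  have hsub : Set.Ioi (0:ℝ) ⊆ h '' Set.univ := by
    intro s hs
    have hs' : (0:ℝ) < s := hs
    have hq : 0 < Real.sqrt s := Real.sqrt_pos.2 hs'
    refine ⟨Real.sqrt s - a / Real.sqrt s, trivial, ?_⟩
    have : r (Real.sqrt s - a / Real.sqrt s) = Real.sqrt s + a / Real.sqrt s := by
      simp only [hr]
      rw [show (Real.sqrt s - a / Real.sqrt s)^2 + 4*a = (Real.sqrt s + a / Real.sqrt s)^2 by
        field_simp; ring]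
      exact Real.sqrt_sq (by positivity)
    simp only [hh, this]
    rw [show (Real.sqrt s - a / Real.sqrt s + (Real.sqrt s + a / Real.sqrt s))/2 = Real.sqrt s by ring,
      Real.sq_sqrt hs'.le]
  refine (lintegral_mono_set hsub).trans ?_
  rw [lintegral_image_eq_lintegral_abs_deriv_mul MeasurableSet.univ
    (fun u _ => (hd u).hasDerivWithinAt) (hmono.injective.injOn)]
  have hintg : ∀ u, ENNReal.ofReal |2*((u + r u)/2)^2 / r u| *
      ENNReal.ofReal ((Real.sqrt (h u))⁻¹ * Real.exp (-(h u)/2 - a^2/(2*(h u)))) =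
      ENNReal.ofReal (Real.exp (-a) * (Real.exp (-(1/2)*u^2) + u / r u * Real.exp (-(1/2)*u^2))) := by
    intro u
    have h1 := hrpos u; have h2 := hypos u; have h3 := hrsq u
    rw [← ENNReal.ofReal_mul (abs_nonneg _), abs_of_pos (by positivity)]
    congr 1
    have hy : Real.sqrt (h u) = (u + r u)/2 := Real.sqrt_sq h2.le
    rw [hy]
    have hquad : ((u + r u)/2)^2 = u * ((u + r u)/2) + a := by nlinarith
    have hex : -(h u)/2 - a^2/(2*(h u)) = -a + -(1/2)*u^2 := by
      have : h u = ((u + r u)/2)^2 := rfl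
      set y := (u + r u)/2
      rw [this]
      have hyu : a = y^2 - u*y := by linarith
      rw [hyu]; field_simp; ring
    rw [hex, Real.exp_add]
    field_simp
    ring
  simp_rw [hintg]
  rw [setLIntegral_univ]
  have hrc : Continuous r := by simp only [hr]; fun_prop
  have i1 : Integrable (fun u : ℝ => Real.exp (-(1/2)*u^2)) := integrable_exp_neg_mul_sq (by norm_num)
  have i2 : Integrable (fun u : ℝ => u / r u * Real.exp (-(1/2)*u^2)) := by
    refine i1.mono' ?_ (Filter.Eventually.of_forall fun u => ?_)
    · apply Continuous.aestronglyMeasurable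
      apply Continuous.mul _ (by fun_prop)
      exact continuous_id.div hrc (fun u => (hrpos u).ne')
    · rw [norm_mul, Real.norm_eq_abs, Real.norm_eq_abs, abs_of_pos (Real.exp_pos _)]
      apply mul_le_of_le_one_left (Real.exp_pos _).le
      rw [abs_div, abs_of_pos (hrpos u)]
      apply div_le_one_of_le₀ _ (hrpos u).le
      apply Real.abs_le_sqrt; linarith
  have i3 : Integrable (fun u : ℝ => Real.exp (-a) * (Real.exp (-(1/2)*u^2) + u / r u * Real.exp (-(1/2)*u^2))) := (i1.add i2).const_mul _
  rw [← ofReal_integral_eq_lintegral_ofReal i3]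
  · apply ENNReal.ofReal_le_ofReal
    rw [integral_const_mul]
    have : ∫ u, (Real.exp (-(1/2)*u^2) + u / r u * Real.exp (-(1/2)*u^2)) = Real.sqrt (2*Real.pi) := by
      rw [integral_add i1 i2, integral_gaussian]
      have : ∫ u, u / r u * Real.exp (-(1/2)*u^2) = 0 := by
        have h1 := integral_neg_eq_self (fun u => u / r u * Real.exp (-(1/2)*u^2)) volume
        have h2 : (fun u => (fun u => u / r u * Real.exp (-(1/2)*u^2)) (-u)) =
           fun u => -(u / r u * Real.exp (-(1/2)*u^2)) := by
          funext u; simp [hr, neg_div]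
        rw [h2, integral_neg] at h1
        linarith
      rw [this, add_zero]; congr 1; ring
    rw [this, mul_comm]
  · refine Filter.Eventually.of_forall fun u => ?_
    have h1 := hrpos u
    have : 0 ≤ 1 + u / r u := by
      rw [show 1 + u / r u = 2*((u + r u)/2) / r u by field_simp; ring]
      have := hypos u
      positivity
    have e : Real.exp (-a) * (Real.exp (-(1/2)*u^2) + u / r u * Real.exp (-(1/2)*u^2)) =
      Real.exp (-a) * ((1 + u / r u) * Real.exp (-(1/2)*u^2)) := by ring
    simp only [Pi.zero_apply]
    show 0 ≤ Real.exp (-a) * (Real.exp (-(1/2)*u^2) + u / r u * Real.exp (-(1/2)*u^2))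
    rw [e]; positivity

lemma oneD (c : ℝ) :
    ∫⁻ s in Set.Ioi (0:ℝ), ENNReal.ofReal ((Real.sqrt s)⁻¹ * Real.exp (-s/2 - c^2/(2*s))) ≤
    ENNReal.ofReal (Real.sqrt (2*Real.pi) * Real.exp (-c)) := by
  rcases eq_or_ne c 0 with rfl | hc
  · simpa using oneD_zero
  · have := oneD_pos |c| (abs_pos.2 hc)
    rw [sq_abs] at this
    refine this.trans (ENNReal.ofReal_le_ofReal ?_)
    gcongr
    exact le_abs_self c

end

end PartA1

section PartA2
open scoped BigOperators Classical
open MeasureTheory Matrix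
noncomputable section

/-- The integrand in `b` variables. -/
def gfun {V : Type} [Fintype V] (W : Matrix V V ℝ) (η : V → ℝ) (b : V → ℝ) : ENNReal :=
  if (Matrix.diagonal b - W).PosDef then
    ENNReal.ofReal ((Real.sqrt (Matrix.diagonal b - W).det)⁻¹ *
      Real.exp (-(1/2) * ((1 : V → ℝ) ⬝ᵥ ((Matrix.diagonal b - W) *ᵥ 1))
        - (1/2) * (η ⬝ᵥ ((Matrix.diagonal b - W)⁻¹ *ᵥ η))))
  else 0

lemma gfun_def {V : Type} [Fintype V] [inst : DecidableEq V] (W : Matrix V V ℝ) (η : V → ℝ) (b : V → ℝ) :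
  gfun W η b = if (Matrix.diagonal b - W).PosDef then
    ENNReal.ofReal ((Real.sqrt (Matrix.diagonal b - W).det)⁻¹ *
      Real.exp (-(1/2) * ((1 : V → ℝ) ⬝ᵥ ((Matrix.diagonal b - W) *ᵥ 1))
        - (1/2) * (η ⬝ᵥ ((Matrix.diagonal b - W)⁻¹ *ᵥ η))))
  else 0 := by
  have : inst = fun a b => Classical.propDecidable (a = b) := Subsingleton.elim _ _
  subst this
  rfl

def GI (V : Type) [Fintype V] : Prop := ∀ (W : Matrix V V ℝ) (_ : W.IsSymm) (η : V → ℝ),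
  ∫⁻ b, gfun W η b ≤ ENNReal.ofReal (Real.sqrt (2*Real.pi) ^ (Fintype.card V) * Real.exp (-∑ i, η i))

lemma measurableSet_posDef {V X : Type} [Fintype V] [TopologicalSpace X] [MeasurableSpace X] [BorelSpace X]
    (A : X → Matrix V V ℝ) (hA : Continuous A) : MeasurableSet {x | (A x).PosDef} := by
  have : {x | (A x).PosDef} = ({x | (A x).IsHermitian} ∩ ⋂ v : V → ℝ, {x | 0 ≤ v ⬝ᵥ (A x *ᵥ v)}) ∩
      {x | (A x).det ≠ 0} := by
    ext x
    simp only [Set.mem_ofPred_eq, Set.mem_inter_iff, Set.mem_iInter]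
    constructor
    · intro h
      exact ⟨⟨h.1, fun v => by simpa using h.posSemidef.dotProduct_mulVec_nonneg v⟩, h.det_pos.ne'⟩
    · rintro ⟨⟨h1, h2⟩, h3⟩
      have hp : (A x).PosSemidef := PosSemidef.of_dotProduct_mulVec_nonneg h1 (fun v => by simpa using h2 v)
      exact (hp.posDef_iff_isUnit).2 ((Matrix.isUnit_iff_isUnit_det _).2 (isUnit_iff_ne_zero.2 h3))
  rw [this]
  refine MeasurableSet.inter (MeasurableSet.inter ?_ ?_) ?_
  · apply IsClosed.measurableSet
    exact isClosed_eq hA.matrix_conjTranspose hA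
  · apply IsClosed.measurableSet
    refine isClosed_iInter fun v => isClosed_le continuous_const ?_
    exact Continuous.dotProduct continuous_const (hA.matrix_mulVec continuous_const)
  · exact (isOpen_ne_fun hA.matrix_det continuous_const).measurableSet

lemma gfun_measurable {V : Type} [Fintype V] (W : Matrix V V ℝ) (η : V → ℝ) : Measurable (gfun W η) := by
  have hc : Continuous (fun b : V → ℝ => Matrix.diagonal b - W) :=
    (continuous_id.matrix_diagonal).sub continuous_const
  have hinv : Measurable (fun b : V → ℝ => η ⬝ᵥ ((Matrix.diagonal b - W)⁻¹ *ᵥ η)) := by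
    have : (fun b : V → ℝ => η ⬝ᵥ ((Matrix.diagonal b - W)⁻¹ *ᵥ η)) =
      fun b => ((Matrix.diagonal b - W).det)⁻¹ * (η ⬝ᵥ ((Matrix.diagonal b - W).adjugate *ᵥ η)) := by
      funext b
      rw [Matrix.inv_def, Matrix.smul_mulVec, dotProduct_smul, Ring.inverse_eq_inv', smul_eq_mul]
    rw [this]
    refine Measurable.mul (hc.matrix_det.measurable.inv) (Continuous.measurable ?_)
    exact Continuous.dotProduct continuous_const (hc.matrix_adjugate.matrix_mulVec continuous_const)
  unfold gfun
  refine Measurable.ite (measurableSet_posDef _ hc) ?_ measurable_const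
  refine ENNReal.measurable_ofReal.comp ?_
  refine Measurable.mul (hc.matrix_det.measurable.sqrt.inv) (Real.measurable_exp.comp ?_)
  refine Measurable.sub (Continuous.measurable ?_) (hinv.const_mul _)
  exact continuous_const.mul (Continuous.dotProduct continuous_const (hc.matrix_mulVec continuous_const))

lemma GI_equiv {V U : Type} [Fintype V] [Fintype U] (e : V ≃ U) (h : GI V) : GI U := by
  intro W hW η
  have h1 := h (W.submatrix e e) (hW.submatrix e) (η ∘ e)
  have mp := volume_measurePreserving_piCongrLeft (fun _ : U => ℝ) e
  rw [← mp.lintegral_comp (gfun_measurable W η)]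
  have key : ∀ b : V → ℝ, gfun W η (MeasurableEquiv.piCongrLeft (fun _ : U => ℝ) e b) =
      gfun (W.submatrix e e) (η ∘ e) b := by
    intro b
    set b' := MeasurableEquiv.piCongrLeft (fun _ : U => ℝ) e b with hb'
    have hb : b = b' ∘ e := by
      funext i
      simp only [hb', Function.comp]
      exact (Equiv.piCongrLeft_apply_apply (fun _ : U => ℝ) e b i).symm
    have hM : Matrix.diagonal b - W.submatrix e e = (Matrix.diagonal b' - W).submatrix e e := by
      rw [hb, Matrix.submatrix_sub]
      congr 1
      exact (Matrix.submatrix_diagonal_equiv b' e).symm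
    unfold gfun
    rw [hM]
    have hpd : ((Matrix.diagonal b' - W).submatrix e e).PosDef ↔ (Matrix.diagonal b' - W).PosDef := by
      constructor
      · intro hh
        have := hh.submatrix e.symm.injective
        simpa using this
      · intro hh; exact hh.submatrix e.injective
    have hdot : ∀ (A : Matrix U U ℝ) (u : U → ℝ), (u ∘ e) ⬝ᵥ (A.submatrix e e *ᵥ (u ∘ e)) = u ⬝ᵥ (A *ᵥ u) := by
      intro A u
      rw [Matrix.submatrix_mulVec_equiv]
      simp only [Function.comp_assoc, Equiv.self_comp_symm, Function.comp_id]
      rw [comp_equiv_dotProduct_comp_equiv]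
    rw [Matrix.det_submatrix_equiv_self, Matrix.inv_submatrix_equiv, hdot,
      show (1 : V → ℝ) = (1 : U → ℝ) ∘ e from rfl, hdot]
    simp only [hpd]
  simp_rw [key]
  refine h1.trans (le_of_eq ?_)
  rw [Fintype.card_congr e]
  congr 3
  congr 1
  exact Equiv.sum_comp e η

lemma GI_empty : GI PEmpty := by
  intro W hW η
  have : ∀ b, gfun W η b ≤ 1 := by
    intro b
    unfold gfun
    split_ifs
    · simp [dotProduct]
    · simp
  refine (lintegral_mono this).trans ?_
  simp [volume_pi]

end

end PartA2

section PartA3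
open scoped BigOperators Classical
open MeasureTheory Matrix
noncomputable section

lemma gfun_step {V : Type} [Fintype V] (W : Matrix (V ⊕ Unit) (V ⊕ Unit) ℝ) (hW : W.IsSymm)
    (η : V ⊕ Unit → ℝ) (b' : V → ℝ) (b0 : ℝ) :
    let W' := W.submatrix Sum.inl Sum.inl
    let H' := Matrix.diagonal b' - W'
    let w : V → ℝ := fun i => W (Sum.inl i) (Sum.inr ())
    let η' : V → ℝ := η ∘ Sum.inl
    let s := b0 - (W (Sum.inr ()) (Sum.inr ()) + w ⬝ᵥ (H'⁻¹ *ᵥ w))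
    let c := η (Sum.inr ()) + w ⬝ᵥ (H'⁻¹ *ᵥ η')
    gfun W η (Sum.elim b' (fun _ => b0)) ≤
      (Set.Ioi (0:ℝ)).indicator (fun s => ENNReal.ofReal ((Real.sqrt s)⁻¹ * Real.exp (-s/2 - c^2/(2*s)))) s *
      (if H'.PosDef then ENNReal.ofReal ((Real.sqrt H'.det)⁻¹ * Real.exp
        (-(1/2) * ((1 : V → ℝ) ⬝ᵥ (H' *ᵥ 1)) + ∑ i, w i - (1/2) * (w ⬝ᵥ (H'⁻¹ *ᵥ w))
          - (1/2) * (η' ⬝ᵥ (H'⁻¹ *ᵥ η')))) else 0) := by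
  intro W' H' w η' s c
  rw [gfun_def]
  split_ifs with hP hP' hP'
  rotate_left
  · exfalso
    apply hP'
    have := hP.submatrix (e := Sum.inl) Sum.inl_injective
    convert this using 1
    ext i j
    simp [H', W', Matrix.diagonal_apply]
  · exact zero_le
  · exact zero_le
  set H := Matrix.diagonal (Sum.elim b' fun _ => b0) - W with hH
  have hdet' := hP'.det_pos
  have : Invertible H' := Matrix.invertibleOfIsUnitDet _ (isUnit_iff_ne_zero.2 hdet'.ne')
  have hinv : ⅟H' = H'⁻¹ := Matrix.invOf_eq_nonsing_inv H'
  have hwsymm : ∀ i, W (Sum.inr ()) (Sum.inl i) = w i := fun i => hW.apply _ _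
  have hblock : H = Matrix.fromBlocks H' (Matrix.of fun i _ => - w i) (Matrix.of fun _ i => - w i)
      (Matrix.of fun _ _ => b0 - W (Sum.inr ()) (Sum.inr ())) := by
    ext i j
    rcases i with i | i <;> rcases j with j | j
    · simp [hH, H', W', Matrix.diagonal_apply]
    · simp [hH, w]
    · simp [hH, hwsymm]
    · simp [hH]
  have hdet : H.det = H'.det * s := by
    rw [hblock, Matrix.det_fromBlocks₁₁]
    congr 1
    rw [Matrix.det_unique, hinv]
    simp only [Matrix.sub_apply, Matrix.of_apply, Matrix.mul_apply, s, dotProduct, Matrix.mulVec]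
    rw [sub_add_eq_sub_sub]
    congr 1
    simp only [Finset.mul_sum, Finset.sum_mul]
    rw [Finset.sum_comm]
    refine Finset.sum_congr rfl fun i _ => Finset.sum_congr rfl fun j _ => ?_
    ring
  have hs : 0 < s := by
    have := hP.det_pos
    rw [hdet] at this
    exact (pos_iff_pos_of_mul_pos this).1 hdet'
  -- solution of H x = η
  set x0 : ℝ := c / s with hx0
  have hsymH' : H'ᵀ = H' := by
    have := hP'.1
    simpa [Matrix.IsHermitian, Matrix.conjTranspose_eq_transpose_of_trivial] using this
  have hsyminv : ∀ u v : V → ℝ, u ⬝ᵥ (H'⁻¹ *ᵥ v) = v ⬝ᵥ (H'⁻¹ *ᵥ u) := by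
    intro u v
    rw [Matrix.dotProduct_mulVec, ← Matrix.mulVec_transpose, Matrix.transpose_nonsing_inv, hsymH',
      dotProduct_comm]
  have hcancel : ∀ u : V → ℝ, H' *ᵥ (H'⁻¹ *ᵥ u) = u := by
    intro u
    rw [Matrix.mulVec_mulVec, Matrix.mul_nonsing_inv _ (isUnit_iff_ne_zero.2 hdet'.ne'), Matrix.one_mulVec]
  set x : V ⊕ Unit → ℝ := Sum.elim (H'⁻¹ *ᵥ (η' + x0 • w)) (fun _ => x0) with hx
  have hHx : H *ᵥ x = η := by
    rw [hblock, Matrix.fromBlocks_mulVec]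
    have e1 : x ∘ Sum.inl = H'⁻¹ *ᵥ (η' + x0 • w) := rfl
    have e2 : x ∘ Sum.inr = fun _ => x0 := rfl
    rw [e1, e2, hcancel]
    ext i
    rcases i with i | i
    · simp [Matrix.mulVec, dotProduct, η']
      ring
    · have e3 : ((Matrix.of fun (_ : Unit) i => - w i) *ᵥ (H'⁻¹ *ᵥ (η' + x0 • w))) i =
        - (w ⬝ᵥ (H'⁻¹ *ᵥ η') + x0 * (w ⬝ᵥ (H'⁻¹ *ᵥ w))) := by
        have : ((Matrix.of fun (_ : Unit) i => - w i) *ᵥ (H'⁻¹ *ᵥ (η' + x0 • w))) i =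
          (-w) ⬝ᵥ (H'⁻¹ *ᵥ (η' + x0 • w)) := rfl
        rw [this, Matrix.mulVec_add, Matrix.mulVec_smul, dotProduct_add, neg_dotProduct, neg_dotProduct,
          dotProduct_smul, smul_eq_mul]
        ring
      have e4 : ((Matrix.of fun (_ _ : Unit) => b0 - W (Sum.inr ()) (Sum.inr ())) *ᵥ (fun _ => x0)) i =
        (b0 - W (Sum.inr ()) (Sum.inr ())) * x0 := by simp [Matrix.mulVec, dotProduct]
      simp only [Sum.elim_inr, Pi.add_apply]
      rw [e3, e4]
      have : x0 * s = c := by rw [hx0]; field_simp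
      have hc : η (Sum.inr i) = c - w ⬝ᵥ (H'⁻¹ *ᵥ η') := by simp [c]
      rw [hc, ← this]
      simp only [s]; ring
  have hquad : η ⬝ᵥ (H⁻¹ *ᵥ η) = η' ⬝ᵥ (H'⁻¹ *ᵥ η') + c^2/s := by
    have : H⁻¹ *ᵥ η = x := by
      rw [← hHx, Matrix.mulVec_mulVec, Matrix.nonsing_inv_mul _ (isUnit_iff_ne_zero.2 hP.det_pos.ne'),
        Matrix.one_mulVec]
    rw [this]
    have e : η = Sum.elim η' (fun _ => η (Sum.inr ())) := by
      ext i; rcases i with i | i <;> rfl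
    rw [e, hx, sumElim_dotProduct_sumElim, Matrix.mulVec_add, Matrix.mulVec_smul, dotProduct_add,
      dotProduct_smul, hsyminv η' w]
    simp only [dotProduct, Finset.univ_unique, Finset.sum_singleton, smul_eq_mul]
    have e2 : c = η (Sum.inr ()) + ∑ i, w i * (H'⁻¹ *ᵥ η') i := rfl
    have e3 : c^2/s = x0 * c := by rw [hx0]; ring
    rw [e3]
    conv_rhs => rw [e2]
    ring
  have hone : (1 : V ⊕ Unit → ℝ) ⬝ᵥ (H *ᵥ 1) = (1 : V → ℝ) ⬝ᵥ (H' *ᵥ 1) - 2 * ∑ i, w i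
      + s + w ⬝ᵥ (H'⁻¹ *ᵥ w) := by
    have e : (1 : V ⊕ Unit → ℝ) = Sum.elim (1 : V → ℝ) (1 : Unit → ℝ) := by
      ext i; rcases i with i | i <;> rfl
    rw [hblock, Matrix.fromBlocks_mulVec]
    conv_lhs => rw [e]
    rw [sumElim_dotProduct_sumElim, dotProduct_add, dotProduct_add]
    have e1 : (Sum.elim (1 : V → ℝ) (1 : Unit → ℝ)) ∘ Sum.inl = 1 := rfl
    have e2 : (Sum.elim (1 : V → ℝ) (1 : Unit → ℝ)) ∘ Sum.inr = 1 := rfl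
    rw [e1, e2]
    have e3 : (1 : V → ℝ) ⬝ᵥ ((Matrix.of fun i (_ : Unit) => - w i) *ᵥ 1) = - ∑ i, w i := by
      simp [Matrix.mulVec, dotProduct]
    have e4 : (1 : Unit → ℝ) ⬝ᵥ ((Matrix.of fun (_ : Unit) i => - w i) *ᵥ 1) = - ∑ i, w i := by
      simp [Matrix.mulVec, dotProduct]
    have e5 : (1 : Unit → ℝ) ⬝ᵥ ((Matrix.of fun (_ _ : Unit) => b0 - W (Sum.inr ()) (Sum.inr ())) *ᵥ 1) =
      b0 - W (Sum.inr ()) (Sum.inr ()) := by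
      simp [Matrix.mulVec, dotProduct]
    rw [e3, e4, e5]
    simp only [s]; ring
  rw [Set.indicator_of_mem (Set.mem_Ioi.2 hs), ← ENNReal.ofReal_mul (by positivity), hdet, hquad, hone,
    Real.sqrt_mul hdet'.le]
  apply le_of_eq
  congr 1
  rw [mul_inv]
  have e : ∀ a b c d : ℝ, a * b * (c * d) = (a * c) * (b * d) := by intros; ring
  rw [e, ← Real.exp_add, mul_comm (Real.sqrt s)⁻¹]
  congr 2
  field_simp
  ring

lemma GI_sum {V : Type} [Fintype V] (h : GI V) : GI (V ⊕ Unit) := by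
  intro W hW η
  set W' := W.submatrix (Sum.inl : V → V ⊕ Unit) (Sum.inl : V → V ⊕ Unit) with hW'
  set w : V → ℝ := fun i => W (Sum.inl i) (Sum.inr ()) with hw
  set η' : V → ℝ := η ∘ Sum.inl with hη'
  have mp := (volume_measurePreserving_sumPiEquivProdPi_symm (fun _ : V ⊕ Unit => ℝ))
  rw [← mp.lintegral_comp (gfun_measurable W η)]
  rw [Measure.volume_eq_prod, lintegral_prod]
  swap
  · exact ((gfun_measurable W η).comp (MeasurableEquiv.measurable _)).aemeasurable
  have key : ∀ b' : V → ℝ, ∫⁻ y : Unit → ℝ, gfun W η ((MeasurableEquiv.sumPiEquivProdPi fun _ : V ⊕ Unit => ℝ).symm (b', y)) ≤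
     ENNReal.ofReal (Real.sqrt (2*Real.pi) * Real.exp (∑ i, w i - η (Sum.inr ()))) * gfun W' (η' + w) b' := by
    intro b'
    have mp2 := (volume_preserving_funUnique Unit ℝ).symm
    rw [← mp2.lintegral_comp_emb (MeasurableEquiv.measurableEmbedding _)]
    have e1 : ∀ b0 : ℝ, (MeasurableEquiv.sumPiEquivProdPi fun _ : V ⊕ Unit => ℝ).symm
        (b', (MeasurableEquiv.funUnique Unit ℝ).symm b0) = Sum.elim b' (fun _ => b0) := by
      intro b0
      ext i; rcases i with i | i <;> rfl
    simp_rw [e1]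
    refine (lintegral_mono (fun b0 => gfun_step W hW η b' b0)).trans ?_
    simp only
    set H' := Matrix.diagonal b' - W' with hH'
    set κ := W (Sum.inr ()) (Sum.inr ()) + w ⬝ᵥ (H'⁻¹ *ᵥ w)
    set c := η (Sum.inr ()) + w ⬝ᵥ (H'⁻¹ *ᵥ η')
    rw [lintegral_mul_const']
    swap
    · split_ifs
      · exact ENNReal.ofReal_ne_top
      · exact ENNReal.zero_ne_top
    rw [lintegral_sub_right_eq_self (fun s => (Set.Ioi (0:ℝ)).indicator (fun s => ENNReal.ofReal ((Real.sqrt s)⁻¹ * Real.exp (-s/2 - c^2/(2*s)))) s) κ]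
    rw [lintegral_indicator measurableSet_Ioi]
    refine (mul_le_mul_left (oneD c) _).trans ?_
    unfold gfun
    by_cases hP : H'.PosDef
    · rw [if_pos hP, if_pos hP, ← ENNReal.ofReal_mul (by positivity), ← ENNReal.ofReal_mul (by positivity)]
      apply ENNReal.ofReal_le_ofReal
      apply le_of_eq
      have hsymH' : H'ᵀ = H' := by
        have := hP.1
        simpa [Matrix.IsHermitian, Matrix.conjTranspose_eq_transpose_of_trivial] using this
      have hsyminv : η' ⬝ᵥ (H'⁻¹ *ᵥ w) = w ⬝ᵥ (H'⁻¹ *ᵥ η') := by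
        rw [Matrix.dotProduct_mulVec, ← Matrix.mulVec_transpose, Matrix.transpose_nonsing_inv, hsymH',
          dotProduct_comm]
      rw [mul_mul_mul_comm, ← Real.exp_add, mul_mul_mul_comm, ← Real.exp_add]
      congr 2
      change _ = _ + (-(1/2) * (1 ⬝ᵥ H' *ᵥ 1) - 1 / 2 * (η' + w) ⬝ᵥ H'⁻¹ *ᵥ (η' + w))
      change -c + (-(1/2) * (1 ⬝ᵥ H' *ᵥ 1) + ∑ i, w i - 1 / 2 * w ⬝ᵥ H'⁻¹ *ᵥ w -
            1 / 2 * η' ⬝ᵥ H'⁻¹ *ᵥ η') = _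
      rw [Matrix.mulVec_add, dotProduct_add, add_dotProduct, add_dotProduct, hsyminv]
      simp only [c]
      ring
    · rw [if_neg hP, if_neg hP]; simp
  refine (lintegral_mono key).trans ?_
  rw [lintegral_const_mul _ (gfun_measurable _ _)]
  refine (mul_le_mul_right (h W' (hW.submatrix _) (η' + w)) _).trans ?_
  rw [← ENNReal.ofReal_mul (by positivity)]
  apply ENNReal.ofReal_le_ofReal
  apply le_of_eq
  have e : ∀ p a b c : ℝ, p * a * (b * c) = (b * p) * (a * c) := by intros; ring
  rw [e, ← Real.exp_add, ← pow_succ]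
  congr 2
  · simp
  · simp [Finset.sum_add_distrib, η']
    ring

lemma GI_all (V : Type) [Fintype V] : GI V := by
  refine Fintype.induction_empty_option (P := fun V _ => GI V) ?_ GI_empty ?_ V
  · intro α β _ e h
    let _ := Fintype.ofEquiv β e.symm
    exact GI_equiv e h
  · intro α _ h
    exact GI_equiv (Equiv.optionEquivSumPUnit α).symm (GI_sum h)

end

end PartA3

section PartA4
open scoped BigOperators Classical
open MeasureTheory Matrix
noncomputable section

section cov
variable {V : Type} [Fintype V]

def Bt (W : Matrix V V ℝ) (ε : ℝ) (t : V → ℝ) : V → ℝ :=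
  fun x => ∑ y, W x y * Real.exp (t y - t x) + ε * Real.exp (- t x)

def Ht (W : Matrix V V ℝ) (ε : ℝ) (t : V → ℝ) : Matrix V V ℝ := Matrix.diagonal (Bt W ε t) - W

lemma Bt_cont (W : Matrix V V ℝ) (ε : ℝ) : Continuous (Bt W ε) := by
  unfold Bt; fun_prop

lemma Ht_cont (W : Matrix V V ℝ) (ε : ℝ) : Continuous (Ht W ε) := by
  exact ((Bt_cont W ε).matrix_diagonal).sub continuous_const

lemma Ht_mulVec (W : Matrix V V ℝ) (ε : ℝ) (t : V → ℝ) :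
    Ht W ε t *ᵥ (fun x => Real.exp (t x)) = fun _ => ε := by
  funext x
  rw [Ht, Matrix.sub_mulVec, Pi.sub_apply, Matrix.mulVec_diagonal]
  simp only [Bt, Matrix.mulVec, dotProduct]
  rw [add_mul, Finset.sum_mul]
  have : ∀ y, W x y * Real.exp (t y - t x) * Real.exp (t x) = W x y * Real.exp (t y) := by
    intro y; rw [mul_assoc, ← Real.exp_add]; congr 2; ring
  simp_rw [this]
  rw [mul_assoc, ← Real.exp_add]; simp

def Mt (W : Matrix V V ℝ) (ε : ℝ) (t : V → ℝ) : Matrix V V ℝ :=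
  -(Matrix.diagonal (fun x => Real.exp (-t x)) * Ht W ε t * Matrix.diagonal (fun x => Real.exp (t x)))

lemma Mt_det (W : Matrix V V ℝ) (ε : ℝ) (t : V → ℝ) : |(Mt W ε t).det| = |(Ht W ε t).det| := by
  rw [Mt, Matrix.det_neg, Matrix.det_mul, Matrix.det_mul, Matrix.det_diagonal, Matrix.det_diagonal,
    abs_mul, abs_pow, abs_neg, abs_one, one_pow, one_mul, mul_right_comm, ← Finset.prod_mul_distrib]
  simp [← Real.exp_add]

lemma Bt_hasFDerivAt (W : Matrix V V ℝ) (ε : ℝ) (t : V → ℝ) :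
    HasFDerivAt (Bt W ε) (LinearMap.toContinuousLinearMap (Matrix.toLin' (Mt W ε t))) t := by
  rw [hasFDerivAt_pi']
  intro x
  have hp : ∀ y, HasFDerivAt (fun t : V → ℝ => t y) (ContinuousLinearMap.proj (R := ℝ) (φ := fun _ : V => ℝ) y) t :=
    fun y => hasFDerivAt_apply y t
  have h1 : HasFDerivAt (fun t => Bt W ε t x)
     (∑ y, W x y • (Real.exp (t y - t x) • (ContinuousLinearMap.proj (R := ℝ) (φ := fun _ : V => ℝ) y - ContinuousLinearMap.proj (R := ℝ) (φ := fun _ : V => ℝ) x)) +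
       ε • (Real.exp (-t x) • (-ContinuousLinearMap.proj (R := ℝ) (φ := fun _ : V => ℝ) x))) t := by
    refine HasFDerivAt.add (HasFDerivAt.fun_sum fun y _ => ?_) ?_
    · exact (((hp y).sub (hp x)).exp).const_mul _
    · exact ((hp x).neg.exp).const_mul _
  refine h1.congr_fderiv ?_
  ext h
  simp only [_root_.add_apply, _root_.sum_apply, _root_.smul_apply,
    _root_.sub_apply, ContinuousLinearMap.proj_apply, _root_.neg_apply, smul_eq_mul,
    ContinuousLinearMap.comp_apply, LinearMap.coe_toContinuousLinearMap', Matrix.toLin'_apply]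
  rw [Mt, Matrix.neg_mulVec, ← Matrix.mulVec_mulVec, ← Matrix.mulVec_mulVec, Pi.neg_apply, Matrix.mulVec_diagonal,
    Ht, Matrix.sub_mulVec, Pi.sub_apply, Matrix.mulVec_diagonal, Matrix.mulVec_diagonal]
  simp only [Matrix.mulVec, dotProduct, Matrix.diagonal_apply, Bt]
  simp only [ite_mul, zero_mul, Finset.sum_ite_eq, Finset.mem_univ, if_true]
  have e0 : Real.exp (-t x) * Real.exp (t x) = 1 := by rw [← Real.exp_add]; simp
  have e1 : ∀ y, W x y * (Real.exp (t y - t x) * (h y - h x)) = Real.exp (-t x) * (W x y * (Real.exp (t y) * h y)) -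
     W x y * Real.exp (t y - t x) * h x := by
    intro y
    rw [show t y - t x = -t x + t y by ring, Real.exp_add]; ring
  simp_rw [e1, Finset.sum_sub_distrib, ← Finset.mul_sum, ← Finset.sum_mul]
  linear_combination ((∑ i, W x i * Real.exp (t i - t x) + ε * Real.exp (-t x)) * h x) * e0

lemma Zb (W : Matrix V V ℝ) (hW : W.IsSymm) (ε : ℝ) :
    ∫⁻ t in {t : V → ℝ | (Ht W ε t).PosDef}, ENNReal.ofReal (Real.sqrt (Ht W ε t).det *
      Real.exp (-(1/2) * ((1 : V → ℝ) ⬝ᵥ (Ht W ε t *ᵥ 1)) - (1/2) * (ε * ∑ x, Real.exp (t x)))) ≤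
    ENNReal.ofReal (Real.sqrt (2*Real.pi) ^ (Fintype.card V) * Real.exp (-(Fintype.card V * ε))) := by
  set S := {t : V → ℝ | (Ht W ε t).PosDef} with hS
  have hSm : MeasurableSet S := measurableSet_posDef _ (Ht_cont W ε)
  have hinj : Set.InjOn (Bt W ε) S := by
    intro t ht t' ht' he
    have hH : Ht W ε t = Ht W ε t' := by simp [Ht, he]
    have h1 := Ht_mulVec W ε t
    have h2 := Ht_mulVec W ε t'
    rw [← h2, hH] at h1
    have hu : IsUnit (Ht W ε t').det := isUnit_iff_ne_zero.2 (PosDef.det_pos ht').ne'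
    have h3 := congrArg (fun v => (Ht W ε t')⁻¹ *ᵥ v) h1
    simp only [Matrix.mulVec_mulVec, Matrix.nonsing_inv_mul _ hu, Matrix.one_mulVec] at h3
    funext x
    exact Real.exp_injective (congrFun h3 x)
  have key := lintegral_image_eq_lintegral_abs_det_fderiv_mul volume hSm
    (fun t _ => (Bt_hasFDerivAt W ε t).hasFDerivWithinAt) hinj (gfun W (fun _ => ε))
  have hG := GI_all V W hW (fun _ => ε)
  refine le_trans (le_of_eq ?_) ((key.symm.le.trans (setLIntegral_le_lintegral _ _)).trans (hG.trans ?_))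
  · refine setLIntegral_congr_fun hSm fun t ht => ?_
    have ht' : (Ht W ε t).PosDef := ht
    have hd := ht'.det_pos
    have hu : IsUnit (Ht W ε t).det := isUnit_iff_ne_zero.2 hd.ne'
    have e : gfun W (fun _ => ε) (Bt W ε t) = ENNReal.ofReal ((Real.sqrt (Ht W ε t).det)⁻¹ *
      Real.exp (-(1/2) * ((1 : V → ℝ) ⬝ᵥ (Ht W ε t *ᵥ 1))
        - (1/2) * ((fun _ => ε) ⬝ᵥ ((Ht W ε t)⁻¹ *ᵥ (fun _ => ε))))) := by
      unfold gfun
      rw [if_pos (show (Matrix.diagonal (Bt W ε t) - W).PosDef from ht')]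
      rfl
    have e2 : (Ht W ε t)⁻¹ *ᵥ (fun _ => ε) = fun x => Real.exp (t x) := by
      rw [← Ht_mulVec W ε t, Matrix.mulVec_mulVec, Matrix.nonsing_inv_mul _ hu, Matrix.one_mulVec]
    have e3 : |(LinearMap.toContinuousLinearMap (Matrix.toLin' (Mt W ε t))).det| = (Ht W ε t).det := by
      have : (LinearMap.toContinuousLinearMap (Matrix.toLin' (Mt W ε t))).det = (Mt W ε t).det := by
        rw [ContinuousLinearMap.det, LinearMap.coe_toContinuousLinearMap, LinearMap.det_toLin']
      rw [this, Mt_det, abs_of_pos hd]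
    rw [e3, e, e2, ← ENNReal.ofReal_mul hd.le]
    congr 1
    have e4 : (fun _ : V => ε) ⬝ᵥ (fun x => Real.exp (t x)) = ε * ∑ x, Real.exp (t x) := by
      simp [dotProduct, Finset.mul_sum]
    rw [e4, ← mul_assoc (Ht W ε t).det, ← div_eq_mul_inv, Real.div_sqrt]
  · simp
end cov
end

end PartA4

section PartA5
open scoped BigOperators Classical
open MeasureTheory Matrix
noncomputable section

section tilt
variable {V : Type} [Fintype V]

lemma rank_one_det (A : Matrix V V ℝ) (hA : A.PosDef) (l : List (ℝ × (V → ℝ)))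
    (hl : ∀ p ∈ l, 0 ≤ p.1)
    (h : ∀ u : V → ℝ, (l.map fun p => p.1 * (p.2 ⬝ᵥ u)^2).sum ≤ (1/2) * (u ⬝ᵥ (A *ᵥ u))) :
    (A - (l.map fun p => p.1 • Matrix.vecMulVec p.2 p.2).sum).PosDef ∧
      A.det ≤ 2 ^ l.length * (A - (l.map fun p => p.1 • Matrix.vecMulVec p.2 p.2).sum).det := by
  have hquad : ∀ (l : List (ℝ × (V → ℝ))) (u : V → ℝ),
      u ⬝ᵥ ((l.map fun p => p.1 • Matrix.vecMulVec p.2 p.2).sum *ᵥ u) = (l.map fun p => p.1 * (p.2 ⬝ᵥ u)^2).sum := by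
    intro l u
    induction l with
    | nil => simp
    | cons p l ih =>
      simp only [List.map_cons, List.sum_cons, Matrix.add_mulVec, dotProduct_add, ih]
      rw [Matrix.smul_mulVec, dotProduct_smul, Matrix.vecMulVec_mulVec]
      simp only [dotProduct_smul, smul_eq_mul, MulOpposite.smul_eq_mul_unop, MulOpposite.unop_op]
      rw [dotProduct_comm u p.2]; ring
  have hherm : ∀ (l : List (ℝ × (V → ℝ))), ((l.map fun p => p.1 • Matrix.vecMulVec p.2 p.2).sum).IsHermitian := by
    intro l
    induction l with
    | nil => simp
    | cons p l ih =>
      simp only [List.map_cons, List.sum_cons]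
      refine Matrix.IsHermitian.add ?_ ih
      ext i j
      simp [Matrix.conjTranspose_apply, Matrix.vecMulVec_apply, mul_comm]
  have hpd : ∀ (l : List (ℝ × (V → ℝ))), (∀ u : V → ℝ, (l.map fun p => p.1 * (p.2 ⬝ᵥ u)^2).sum ≤ (1/2) * (u ⬝ᵥ (A *ᵥ u))) →
      (A - (l.map fun p => p.1 • Matrix.vecMulVec p.2 p.2).sum).PosDef := by
    intro l h
    refine PosDef.of_dotProduct_mulVec_pos (hA.1.sub (hherm l)) fun u hu => ?_
    have h1 := hA.dotProduct_mulVec_pos hu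
    have h2 := h u
    simp only [star_trivial] at h1 ⊢
    rw [Matrix.sub_mulVec, dotProduct_sub, hquad]
    linarith
  refine ⟨hpd l h, ?_⟩
  induction l with
  | nil => simp
  | cons p l ih =>
    have hp : 0 ≤ p.1 := hl p (by simp)
    have h' : ∀ u : V → ℝ, (l.map fun p => p.1 * (p.2 ⬝ᵥ u)^2).sum ≤ (1/2) * (u ⬝ᵥ (A *ᵥ u)) := by
      intro u
      have := h u
      simp only [List.map_cons, List.sum_cons] at this
      have h3 : 0 ≤ p.1 * (p.2 ⬝ᵥ u)^2 := by positivity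
      linarith
    have ih' := ih (fun q hq => hl q (by simp [hq])) h'
    refine ih'.trans ?_
    have hB := hpd (p :: l) h
    set B := A - ((p :: l).map fun p => p.1 • Matrix.vecMulVec p.2 p.2).sum with hBdef
    have hBA : A - (l.map fun p => p.1 • Matrix.vecMulVec p.2 p.2).sum = B + p.1 • Matrix.vecMulVec p.2 p.2 := by
      rw [hBdef]; simp only [List.map_cons, List.sum_cons]; abel
    have hBge : ∀ u : V → ℝ, p.1 * (p.2 ⬝ᵥ u)^2 ≤ u ⬝ᵥ (B *ᵥ u) := by
      intro u
      rw [hBdef, Matrix.sub_mulVec, dotProduct_sub, hquad]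
      have h1 := h u
      have h2 : 0 ≤ (l.map fun p => p.1 * (p.2 ⬝ᵥ u)^2).sum := by
        apply List.sum_nonneg
        intro x hx
        obtain ⟨q, hq, rfl⟩ := List.mem_map.1 hx
        have := hl q (by simp [hq])
        positivity
      simp only [List.map_cons, List.sum_cons] at h1 ⊢
      linarith
    have hu : IsUnit B.det := isUnit_iff_ne_zero.2 hB.det_pos.ne'
    have hdet : (B + p.1 • Matrix.vecMulVec p.2 p.2).det = B.det * (1 + p.1 * (p.2 ⬝ᵥ (B⁻¹ *ᵥ p.2))) := by
      have := Matrix.det_add_replicateCol_mul_replicateRow (ι := Unit) (A := B) hu (p.1 • p.2) p.2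
      rw [← Matrix.vecMulVec_eq Unit, Matrix.smul_vecMulVec] at this
      rw [this]
      congr 1
      rw [Matrix.det_unique]
      simp only [Matrix.add_apply, Matrix.one_apply_eq]
      congr 1
      rw [Matrix.mul_assoc]
      simp [Matrix.mul_apply, Matrix.vecMul, Matrix.mulVec, dotProduct, Finset.mul_sum]
      refine Finset.sum_congr rfl fun i _ => Finset.sum_congr rfl fun j _ => ?_
      ring
    rw [hBA, hdet, List.length_cons, pow_succ, mul_assoc, mul_comm B.det]
    have hq : p.1 * (p.2 ⬝ᵥ (B⁻¹ *ᵥ p.2)) ≤ 1 := by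
      have h1 := hBge (B⁻¹ *ᵥ p.2)
      rw [Matrix.mulVec_mulVec, Matrix.mul_nonsing_inv _ hu, Matrix.one_mulVec, dotProduct_comm _ p.2] at h1
      set q := p.2 ⬝ᵥ (B⁻¹ *ᵥ p.2)
      by_contra hc
      push Not at hc
      have : 0 < q := by
        by_contra hc'
        nlinarith
      nlinarith
    have := hB.det_pos
    gcongr
    linarith
end tilt
end

end PartA5

section PartA6
open scoped BigOperators Classical
open MeasureTheory Matrix
noncomputable section

section tilt2
variable {V : Type} [Fintype V]

def Qf (W : Matrix V V ℝ) (ε : ℝ) (t v : V → ℝ) : ℝ :=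
  (1/2) * ∑ x, ∑ y, W x y * Real.exp (t x + t y) * (v x - v y)^2 + ε * ∑ x, Real.exp (t x) * (v x)^2

def wtW (W : Matrix V V ℝ) (ε : ℝ) (t : V → ℝ) : ℝ :=
  Real.sqrt (Ht W ε t).det * Real.exp (-(1/2) * ((1 : V → ℝ) ⬝ᵥ (Ht W ε t *ᵥ 1)) - (1/2) * (ε * ∑ x, Real.exp (t x)))

lemma Ht_one (W : Matrix V V ℝ) (hW : W.IsSymm) (ε : ℝ) (t : V → ℝ) :
    (1 : V → ℝ) ⬝ᵥ (Ht W ε t *ᵥ 1) = ∑ x, ∑ y, W x y * (Real.cosh (t x - t y) - 1) + ε * ∑ x, Real.exp (-t x) := by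
  have h1 : (1 : V → ℝ) ⬝ᵥ (Ht W ε t *ᵥ 1) = ∑ x, ∑ y, W x y * (Real.exp (t y - t x) - 1) + ε * ∑ x, Real.exp (-t x) := by
    rw [Ht, Matrix.sub_mulVec, dotProduct_sub]
    simp only [dotProduct, Matrix.mulVec_diagonal, Pi.one_apply, one_mul, mul_one, Bt]
    simp only [dotProduct, Matrix.mulVec, Pi.one_apply, mul_one]
    rw [Finset.sum_add_distrib, Finset.mul_sum]
    simp_rw [mul_sub, Finset.sum_sub_distrib, mul_one]
    ring
  rw [h1]
  congr 1
  have h2 : ∑ x, ∑ y, W x y * (Real.exp (t y - t x) - 1) = ∑ x, ∑ y, W x y * (Real.exp (t x - t y) - 1) := by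
    rw [Finset.sum_comm]
    refine Finset.sum_congr rfl fun x _ => Finset.sum_congr rfl fun y _ => ?_
    rw [hW.apply]
  have h3 : ∑ x, ∑ y, W x y * (Real.cosh (t x - t y) - 1) = (1/2) * (∑ x, ∑ y, W x y * (Real.exp (t y - t x) - 1) +
     ∑ x, ∑ y, W x y * (Real.exp (t x - t y) - 1)) := by
    rw [← Finset.sum_add_distrib, Finset.mul_sum]
    refine Finset.sum_congr rfl fun x _ => ?_
    rw [← Finset.sum_add_distrib, Finset.mul_sum]
    refine Finset.sum_congr rfl fun y _ => ?_
    rw [Real.cosh_eq, neg_sub]; ring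
  rw [h3, ← h2]; ring

lemma Ht_quad (W : Matrix V V ℝ) (hW : W.IsSymm) (ε : ℝ) (t v : V → ℝ) :
    (fun x => Real.exp (t x) * v x) ⬝ᵥ (Ht W ε t *ᵥ (fun x => Real.exp (t x) * v x)) = Qf W ε t v := by
  have h1 : (fun x => Real.exp (t x) * v x) ⬝ᵥ (Ht W ε t *ᵥ (fun x => Real.exp (t x) * v x)) =
     ∑ x, ∑ y, W x y * Real.exp (t x + t y) * ((v x)^2 - v x * v y) + ε * ∑ x, Real.exp (t x) * (v x)^2 := by
    rw [Ht, Matrix.sub_mulVec, dotProduct_sub]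
    simp only [dotProduct, Matrix.mulVec_diagonal, Bt]
    simp only [dotProduct, Matrix.mulVec]
    rw [Finset.mul_sum, ← Finset.sum_sub_distrib, ← Finset.sum_add_distrib]
    refine Finset.sum_congr rfl fun x _ => ?_
    have e0 : Real.exp (-t x) * Real.exp (t x) = 1 := by rw [← Real.exp_add]; simp
    have e1 : ∀ y, W x y * Real.exp (t x + t y) * ((v x)^2 - v x * v y) =
      W x y * Real.exp (t y - t x) * (Real.exp (t x) * Real.exp (t x) * (v x)^2) - Real.exp (t x) * v x * (W x y * (Real.exp (t y) * v y)) := by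
      intro y
      rw [Real.exp_add, Real.exp_sub]
      field_simp
    simp_rw [e1, Finset.sum_sub_distrib, ← Finset.sum_mul, ← Finset.mul_sum]
    linear_combination (Real.exp (t x) * ε * (v x)^2) * e0
  rw [h1, Qf]
  congr 1
  have h2 : ∑ x, ∑ y, W x y * Real.exp (t x + t y) * ((v x)^2 - v x * v y) =
     ∑ x, ∑ y, W x y * Real.exp (t x + t y) * ((v y)^2 - v x * v y) := by
    rw [Finset.sum_comm]
    refine Finset.sum_congr rfl fun x _ => Finset.sum_congr rfl fun y _ => ?_
    rw [hW.apply, add_comm (t y), mul_comm (v y)]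
  have h3 : ∑ x, ∑ y, W x y * Real.exp (t x + t y) * (v x - v y)^2 = ∑ x, ∑ y, W x y * Real.exp (t x + t y) * ((v x)^2 - v x * v y) +
     ∑ x, ∑ y, W x y * Real.exp (t x + t y) * ((v y)^2 - v x * v y) := by
    simp_rw [← Finset.sum_add_distrib]
    refine Finset.sum_congr rfl fun x _ => Finset.sum_congr rfl fun y _ => ?_
    ring
  rw [h3, ← h2]; ring

lemma Ht_posDef (W : Matrix V V ℝ) (hW : W.IsSymm) (hW0 : ∀ x y, 0 ≤ W x y) (ε : ℝ) (hε : 0 < ε) (t : V → ℝ) :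
    (Ht W ε t).PosDef := by
  refine PosDef.of_dotProduct_mulVec_pos ?_ fun u hu => ?_
  · refine Matrix.IsHermitian.sub ?_ ?_
    · exact Matrix.isHermitian_diagonal _
    · rw [Matrix.IsHermitian, Matrix.conjTranspose_eq_transpose_of_trivial]; exact hW
  · have e : u = fun x => Real.exp (t x) * (Real.exp (-t x) * u x) := by
      funext x; rw [← mul_assoc, ← Real.exp_add]; simp
    rw [star_trivial, e, Ht_quad W hW ε t (fun x => Real.exp (-t x) * u x)]
    obtain ⟨x, hx⟩ := Function.ne_iff.1 hu
    rw [Qf]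
    apply add_pos_of_nonneg_of_pos
    · have : ∀ x y, 0 ≤ W x y * Real.exp (t x + t y) * (Real.exp (-t x) * u x - Real.exp (-t y) * u y)^2 := by
        intro x y; have := hW0 x y; positivity
      have := Finset.sum_nonneg fun x (_ : x ∈ Finset.univ) => Finset.sum_nonneg fun y (_ : y ∈ Finset.univ) => this x y
      positivity
    · apply mul_pos hε
      refine Finset.sum_pos' (fun x _ => by positivity) ⟨x, Finset.mem_univ _, ?_⟩
      have : u x ≠ 0 := hx
      positivity

def pairM (i j : V) : Matrix V V ℝ := Matrix.single i j 1 + Matrix.single j i 1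

lemma pairM_symm (i j : V) : (pairM i j).IsSymm := by
  unfold pairM Matrix.IsSymm
  rw [Matrix.transpose_add, Matrix.transpose_single, Matrix.transpose_single, add_comm]

def avec (t : V → ℝ) (i j : V) : V → ℝ := fun x =>
  Real.exp ((t i + t j)/2) * ((if x = i then Real.exp (-t i) else 0) - (if x = j then Real.exp (-t j) else 0))

lemma Ht_sub_pair (W : Matrix V V ℝ) (ε : ℝ) (t : V → ℝ) (γ : ℝ) (i j : V) :
    Ht (W - γ • pairM i j) ε t = Ht W ε t - γ • Matrix.vecMulVec (avec t i j) (avec t i j) := by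
  have hB : ∀ x, Bt (W - γ • pairM i j) ε t x = Bt W ε t x - γ * ((if x = i then Real.exp (t j - t i) else 0)
     + (if x = j then Real.exp (t i - t j) else 0)) := by
    intro x
    simp only [Bt, Matrix.sub_apply, Matrix.smul_apply, smul_eq_mul, sub_mul, Finset.sum_sub_distrib]
    have : ∑ z, γ * pairM i j x z * Real.exp (t z - t x) = γ * ((if x = i then Real.exp (t j - t i) else 0)
     + (if x = j then Real.exp (t i - t j) else 0)) := by
      simp only [pairM, Matrix.add_apply, Matrix.single_apply, mul_assoc, ← Finset.mul_sum, add_mul,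
        Finset.sum_add_distrib]
      congr 2
      · by_cases h : x = i
        · subst h; simp
        · simp [h, Ne.symm h]
      · by_cases h : x = j
        · subst h; simp
        · simp [h, Ne.symm h]
    rw [this]; ring
  have e1 : Real.exp ((t i + t j)/2) * Real.exp ((t i + t j)/2) = Real.exp (t i) * Real.exp (t j) := by
    rw [← Real.exp_add, ← Real.exp_add]; congr 1; ring
  have e2 : Real.exp (t i) * Real.exp (-t i) = 1 := by rw [← Real.exp_add]; simp
  have e3 : Real.exp (t j) * Real.exp (-t j) = 1 := by rw [← Real.exp_add]; simp
  have f1 : Real.exp (t j - t i) = Real.exp (t j) * Real.exp (-t i) := by rw [← Real.exp_add]; rfl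
  have f2 : Real.exp (t i - t j) = Real.exp (t i) * Real.exp (-t j) := by rw [← Real.exp_add]; rfl
  have hv : ∀ x y, (avec t i j x) * (avec t i j y) = Real.exp (t i) * Real.exp (t j) *
     (((if x = i then Real.exp (-t i) else 0) - (if x = j then Real.exp (-t j) else 0)) *
     ((if y = i then Real.exp (-t i) else 0) - (if y = j then Real.exp (-t j) else 0))) := by
    intro x y
    unfold avec
    rw [← e1]; ring
  ext x y
  have L1 : Ht (W - γ • pairM i j) ε t x y = (if x = y then Bt (W - γ • pairM i j) ε t x else 0) - (W x y - γ * (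
      (if i = x ∧ j = y then 1 else 0) + (if j = x ∧ i = y then 1 else 0))) := by
    simp only [Ht, Matrix.sub_apply, Matrix.smul_apply, smul_eq_mul, pairM, Matrix.add_apply, Matrix.single_apply, Matrix.diagonal_apply]
  have L2 : (Ht W ε t - γ • Matrix.vecMulVec (avec t i j) (avec t i j)) x y = (if x = y then Bt W ε t x else 0) - W x y - γ *
      (avec t i j x * avec t i j y) := by
    simp only [Ht, Matrix.sub_apply, Matrix.smul_apply, smul_eq_mul, Matrix.vecMulVec_apply, Matrix.diagonal_apply]
  rw [L1, L2, hB, hv, f1, f2]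
  clear L1 L2
  generalize Bt W ε t x = bb
  generalize W x y = ww
  clear hB hv f1 f2 e1
  by_cases hij : i = j
  · subst hij
    by_cases hxy : x = y
    · subst hxy
      by_cases hxi : x = i
      · subst hxi
        simp only [if_true, and_self]
        linear_combination (- 2 * γ) * e2
      · simp only [if_true, if_neg hxi, if_neg (Ne.symm hxi), and_false, and_self]
        ring
    · have : ¬ (i = x ∧ i = y) := by rintro ⟨h1, h2⟩; exact hxy (h1.symm.trans h2)
      simp only [if_neg hxy, if_neg this]
      ring
  generalize Real.exp (t i) = A at *
  generalize Real.exp (t j) = B at *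
  generalize Real.exp (- t i) = a at *
  generalize Real.exp (- t j) = b at *
  have hji := Ne.symm hij
  by_cases hxi : x = i
  · subst hxi
    by_cases hyj : y = j
    · subst hyj
      simp only [if_true, if_neg hij, if_neg hji, and_self, and_false, false_and, hji, if_false]
      linear_combination (-γ * A * a) * e3 - γ * e2
    · by_cases hxy : x = y
      · subst hxy
        simp only [if_true, if_neg hij, if_neg hji, and_self, and_false, false_and, hij, hji, if_false]
        linear_combination (γ * B * a) * e2
      · simp only [if_true, if_neg hij, if_neg hxy, if_neg (Ne.symm hxy), if_neg hyj, and_self, and_false, false_and, hji, Ne.symm hyj, if_false]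
        ring
  · by_cases hxj : x = j
    · subst hxj
      by_cases hyi : y = i
      · subst hyi
        simp only [if_true, if_neg hij, if_neg hji, and_self, and_false, false_and, hij, if_false]
        linear_combination (-γ * A * a) * e3 - γ * e2
      · by_cases hxy : x = y
        · subst hxy
          simp only [if_true, if_neg hij, if_neg hji, and_self, and_false, false_and, hij, hji, if_false]
          linear_combination (γ * A * b) * e3
        · simp only [if_true, if_neg hji, if_neg hxy, if_neg (Ne.symm hxy), if_neg hyi, and_self, and_false, false_and, hij, Ne.symm hyi, if_false]
          ring
    · simp only [if_neg hxi, if_neg hxj, Ne.symm hxi, Ne.symm hxj, and_false, false_and, if_false]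
      by_cases hxy : x = y
      · simp only [if_pos hxy]; ring
      · simp only [if_neg hxy]; ring

end tilt2
end

end PartA6

section PartA7
open scoped BigOperators Classical
open MeasureTheory Matrix
noncomputable section

def Gam {V : Type} (l : List (ℝ × V × V)) (t v : V → ℝ) : ℝ := (l.map fun p => p.1 * (Real.exp (t p.2.1 + t p.2.2) * (v p.2.1 - v p.2.2)^2)).sum

def Csum {V : Type} (l : List (ℝ × V × V)) (t : V → ℝ) : ℝ := (l.map fun p => p.1 * (Real.cosh (t p.2.1 - t p.2.2) - 1)).sum

section tilt3
variable {V : Type} [Fintype V]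

def Wsub (W : Matrix V V ℝ) (l : List (ℝ × V × V)) : Matrix V V ℝ := W - (l.map fun p => p.1 • pairM p.2.1 p.2.2).sum

lemma Wsub_cons (W : Matrix V V ℝ) (p) (l : List (ℝ × V × V)) : Wsub W (p :: l) = Wsub W l - p.1 • pairM p.2.1 p.2.2 := by
  simp only [Wsub, List.map_cons, List.sum_cons]; abel

lemma Wsub_symm (W : Matrix V V ℝ) (hW : W.IsSymm) (l : List (ℝ × V × V)) : (Wsub W l).IsSymm := by
  induction l with
  | nil => simpa [Wsub] using hW
  | cons p l ih => rw [Wsub_cons]; exact ih.sub ((pairM_symm _ _).smul _)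

lemma Ht_Wsub (W : Matrix V V ℝ) (ε : ℝ) (t : V → ℝ) (l : List (ℝ × V × V)) :
    Ht (Wsub W l) ε t = Ht W ε t - ((l.map fun p => (p.1, avec t p.2.1 p.2.2)).map
      fun q => q.1 • Matrix.vecMulVec q.2 q.2).sum := by
  induction l with
  | nil => simp [Wsub]
  | cons p l ih =>
    rw [Wsub_cons, Ht_sub_pair, ih]
    simp only [List.map_cons, List.sum_cons]; abel

lemma avec_dot (t : V → ℝ) (i j : V) (u : V → ℝ) :
    avec t i j ⬝ᵥ u = Real.exp ((t i + t j)/2) * (Real.exp (- t i) * u i - Real.exp (- t j) * u j) := by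
  simp only [dotProduct, avec, mul_assoc, ← Finset.mul_sum, sub_mul, Finset.sum_sub_distrib, ite_mul, zero_mul,
    Finset.sum_ite_eq', Finset.mem_univ, if_true]

lemma Ht_one_Wsub (W : Matrix V V ℝ) (ε : ℝ) (t : V → ℝ) (l : List (ℝ × V × V)) :
    (1 : V → ℝ) ⬝ᵥ (Ht (Wsub W l) ε t *ᵥ 1) = (1 : V → ℝ) ⬝ᵥ (Ht W ε t *ᵥ 1) - 2 * Csum l t := by
  induction l with
  | nil => simp [Wsub, Csum]
  | cons p l ih =>
    rw [Wsub_cons, Ht_sub_pair, Matrix.sub_mulVec, dotProduct_sub, ih, Matrix.smul_mulVec, dotProduct_smul]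
    rw [Matrix.vecMulVec_mulVec]
    have e : (1 : V → ℝ) ⬝ᵥ (MulOpposite.op (avec t p.2.1 p.2.2 ⬝ᵥ 1) • avec t p.2.1 p.2.2) = 2 * (Real.cosh (t p.2.1 - t p.2.2) - 1) := by
      rw [op_smul_eq_smul, dotProduct_smul, dotProduct_comm 1, avec_dot, smul_eq_mul]
      simp only [Pi.one_apply, mul_one]
      have e1 : Real.exp ((t p.2.1 + t p.2.2)/2) * Real.exp ((t p.2.1 + t p.2.2)/2) = Real.exp (t p.2.1) * Real.exp (t p.2.2) := by
        rw [← Real.exp_add, ← Real.exp_add]; congr 1; ring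
      have e2 : Real.exp (t p.2.1) * Real.exp (-t p.2.1) = 1 := by rw [← Real.exp_add]; simp
      have e3 : Real.exp (t p.2.2) * Real.exp (-t p.2.2) = 1 := by rw [← Real.exp_add]; simp
      rw [Real.cosh_eq, neg_sub, sub_eq_add_neg (t p.2.1), Real.exp_add (t p.2.1), sub_eq_add_neg (t p.2.2), Real.exp_add (t p.2.2)]
      linear_combination (Real.exp (-t p.2.1) - Real.exp (-t p.2.2))^2 * e1 + (Real.exp (t p.2.2) * Real.exp (-t p.2.1)- 2 * Real.exp (t p.2.2) * Real.exp (-t p.2.2)) * e2 + (Real.exp (t p.2.1) * Real.exp (-t p.2.2) - 2) * e3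
    rw [e, smul_eq_mul]
    simp only [Csum, List.map_cons, List.sum_cons]
    ring

lemma tilt_point (W : Matrix V V ℝ) (hW : W.IsSymm) (hW0 : ∀ x y, 0 ≤ W x y) (ε : ℝ) (hε : 0 < ε) (t : V → ℝ)
    (l : List (ℝ × V × V)) (hl : ∀ p ∈ l, 0 ≤ p.1) (h : ∀ v, Gam l t v ≤ (1/2) * Qf W ε t v) :
    (Ht (Wsub W l) ε t).PosDef ∧ Real.exp (Csum l t) * wtW W ε t ≤ Real.sqrt 2 ^ l.length * wtW (Wsub W l) ε t := by
  have := rank_one_det (Ht W ε t) (Ht_posDef W hW hW0 ε hε t) (l.map fun p => (p.1, avec t p.2.1 p.2.2)) ?_ ?_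
  · rw [← Ht_Wsub] at this
    refine ⟨this.1, ?_⟩
    have h2 := this.2
    rw [List.length_map] at h2
    have h3 := Real.sqrt_le_sqrt h2
    rw [Real.sqrt_mul (by positivity)] at h3
    have h4 : Real.sqrt (2^l.length) = Real.sqrt 2 ^ l.length := by
      rw [Real.sqrt_eq_iff_mul_self_eq (by positivity) (by positivity), ← mul_pow]; simp
    rw [h4] at h3
    unfold wtW
    rw [Ht_one_Wsub]
    rw [show -(1/2) * ((1 : V → ℝ) ⬝ᵥ Ht W ε t *ᵥ 1 - 2 * Csum l t) - 1 / 2 * (ε * ∑ x, Real.exp (t x)) =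
      Csum l t + (-(1/2) * ((1 : V → ℝ) ⬝ᵥ Ht W ε t *ᵥ 1) - 1 / 2 * (ε * ∑ x, Real.exp (t x))) by ring, Real.exp_add (Csum l t)]
    set X := Real.exp (-(1/2) * ((1 : V → ℝ) ⬝ᵥ Ht W ε t *ᵥ 1) - 1 / 2 * (ε * ∑ x, Real.exp (t x)))
    calc _ = Real.sqrt (Ht W ε t).det * (Real.exp (Csum l t) * X) := by ring
      _ ≤ (Real.sqrt 2 ^ l.length * Real.sqrt (Ht (Wsub W l) ε t).det) * (Real.exp (Csum l t) * X) := by gcongr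
      _ = _ := by ring
  · intro p hp
    obtain ⟨q, hq, rfl⟩ := List.mem_map.1 hp
    exact hl q hq
  · intro u
    have e : u = fun x => Real.exp (t x) * (Real.exp (-t x) * u x) := by
      funext x; rw [← mul_assoc, ← Real.exp_add]; simp
    have h5 := h (fun x => Real.exp (-t x) * u x)
    rw [← Ht_quad W hW, ← e] at h5
    refine le_trans (le_of_eq ?_) h5
    rw [List.map_map, Gam]
    congr 1
    apply List.map_congr_left
    intro p hp
    simp only [Function.comp, avec_dot, mul_pow]
    rw [← Real.exp_nat_mul]
    congr 3
    push_cast; ring_nf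

lemma tilt_int (W : Matrix V V ℝ) (hW : W.IsSymm) (hW0 : ∀ x y, 0 ≤ W x y) (ε : ℝ) (hε : 0 < ε)
    (l : List (ℝ × V × V)) (hl : ∀ p ∈ l, 0 ≤ p.1) (S : Set (V → ℝ)) (hS : MeasurableSet S) (h : ∀ t ∈ S, ∀ v, Gam l t v ≤ (1/2) * Qf W ε t v) :
    ∫⁻ t in S, ENNReal.ofReal (Real.exp (Csum l t) * wtW W ε t) ≤
     ENNReal.ofReal (Real.sqrt 2 ^ l.length * (Real.sqrt (2 * Real.pi) ^ Fintype.card V * Real.exp (-(Fintype.card V * ε)))) := by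
  have hsub : S ⊆ {t | (Ht (Wsub W l) ε t).PosDef} := fun t ht => (tilt_point W hW hW0 ε hε t l hl (h t ht)).1
  have hmeas : MeasurableSet {t | (Ht (Wsub W l) ε t).PosDef} := measurableSet_posDef _ (Ht_cont _ _)
  calc ∫⁻ t in S, ENNReal.ofReal (Real.exp (Csum l t) * wtW W ε t)
     ≤ ∫⁻ t in S, ENNReal.ofReal (Real.sqrt 2 ^ l.length) * ENNReal.ofReal (wtW (Wsub W l) ε t) := by
        refine setLIntegral_mono' hS fun t ht => ?_
        rw [← ENNReal.ofReal_mul (by positivity)]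
        exact ENNReal.ofReal_le_ofReal (tilt_point W hW hW0 ε hε t l hl (h t ht)).2
    _ ≤ ∫⁻ t in {t | (Ht (Wsub W l) ε t).PosDef}, ENNReal.ofReal (Real.sqrt 2 ^ l.length) * ENNReal.ofReal (wtW (Wsub W l) ε t) :=
        lintegral_mono_set hsub
    _ = ENNReal.ofReal (Real.sqrt 2 ^ l.length) * ∫⁻ t in {t | (Ht (Wsub W l) ε t).PosDef}, ENNReal.ofReal (wtW (Wsub W l) ε t) :=
        lintegral_const_mul' _ _ ENNReal.ofReal_ne_top
    _ ≤ _ := by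
        rw [ENNReal.ofReal_mul (by positivity)]
        gcongr
        exact Zb (Wsub W l) (Wsub_symm W hW l) ε
end tilt3
end

end PartA7

section PartA8
open scoped BigOperators Classical
open MeasureTheory Matrix
noncomputable section

lemma Ht_apply {V : Type} [Fintype V] (W : Matrix V V ℝ) (ε : ℝ) (t : V → ℝ) (x y : V) :
    Ht W ε t x y = (if x = y then Bt W ε t x else 0) - W x y := by
  simp only [Ht, Matrix.sub_apply, Matrix.diagonal_apply]

def dH {V : Type} [Fintype V] (W : Matrix V V ℝ) (ε : ℝ) (t : V → ℝ) : ℝ := (Ht W ε t).det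

lemma dH_eq {V : Type} [Fintype V] [i : DecidableEq V] (W : Matrix V V ℝ) (ε : ℝ) (t : V → ℝ) : dH W ε t = (Ht W ε t).det := by
  unfold dH; congr

lemma wtW_dH {V : Type} [Fintype V] (W : Matrix V V ℝ) (ε : ℝ) (t : V → ℝ) : wtW W ε t = Real.sqrt (dH W ε t) * 
    Real.exp (-(1/2) * ((1 : V → ℝ) ⬝ᵥ (Ht W ε t *ᵥ 1)) - (1/2) * (ε * ∑ x, Real.exp (t x))) := rfl

lemma dH_pos {V : Type} [Fintype V] (W : Matrix V V ℝ) (hW : W.IsSymm) (hW0 : ∀ x y, 0 ≤ W x y) (ε : ℝ) (hε : 0 < ε) (t : V → ℝ) :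
    0 < dH W ε t := (Ht_posDef W hW hW0 ε hε t).det_pos

section ident
variable {L : ℕ} [NeZero L]

lemma NN_symm {x y : Torus L} (h : NN x y) : NN y x := by
  obtain ⟨h1, i, h2⟩ := h
  refine ⟨h1.symm, i, ?_⟩
  rcases h2 with rfl | rfl
  · right; simp
  · left; simp

def W0 (β : ℝ) : Matrix (Torus L) (Torus L) ℝ := fun x y => if NN x y then β else 0

lemma W0_symm (β : ℝ) : (W0 β : Matrix (Torus L) (Torus L) ℝ).IsSymm := by
  ext x y
  simp only [Matrix.transpose_apply, W0]
  by_cases h : NN x y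
  · rw [if_pos h, if_pos (NN_symm h)]
  · rw [if_neg h, if_neg (fun h' => h (NN_symm h'))]

lemma W0_nonneg {β : ℝ} (hβ : 0 ≤ β) (x y : Torus L) : 0 ≤ W0 β x y := by
  unfold W0; split_ifs <;> simp [hβ]

lemma W0_diag (β : ℝ) (x : Torus L) : W0 β x x = 0 := by
  unfold W0; rw [if_neg]; rintro ⟨h, _⟩; exact h rfl

lemma Dmat_eq (β ε : ℝ) (t : Torus L → ℝ) : Dmat β ε t = Matrix.diagonal (fun x => Real.exp (t x)) * Ht (W0 β) ε t *
    Matrix.diagonal (fun x => Real.exp (t x)) := by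
  ext j k
  rw [Matrix.mul_diagonal, Matrix.diagonal_mul]
  rw [Ht_apply]
  simp only [Dmat, Matrix.of_apply]
  by_cases h : j = k
  · subst h
    rw [if_pos rfl, if_pos rfl, W0_diag, sub_zero, Bt]
    have e1 : Real.exp (t j) * Real.exp (-t j) = 1 := by rw [← Real.exp_add]; simp
    have e2 : β * ∑ i, (if NN i j then Real.exp (t i + t j) else 0) = Real.exp (t j) * (∑ y, W0 β j y * Real.exp (t y - t j)) * Real.exp (t j) := by
      rw [Finset.mul_sum, Finset.mul_sum, Finset.sum_mul]
      refine Finset.sum_congr rfl fun i _ => ?_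
      rw [← (W0_symm β).apply, W0]
      split_ifs
      · rw [Real.exp_add, sub_eq_add_neg, Real.exp_add]
        linear_combination (- β * Real.exp (t i) * Real.exp (t j)) * e1
      · simp
    rw [e2]
    linear_combination (-ε * Real.exp (t j)) * e1
  · rw [if_neg h, if_neg h, W0]
    split_ifs
    · rw [Real.exp_add]; ring
    · simp

lemma det_Dmat (β ε : ℝ) (t : Torus L → ℝ) : (Dmat β ε t).det = Real.exp (2 * ∑ x, t x) * dH (W0 β) ε t := by
  have h := congrArg (fun M : Matrix (Torus L) (Torus L) ℝ => Matrix.det M) (Dmat_eq β ε t)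
  simp only [Matrix.det_mul, Matrix.det_diagonal] at h
  rw [h, dH_eq]
  rw [two_mul, Real.exp_add, Real.exp_sum]
  ring

lemma exp_neg_F (β ε : ℝ) (hβ : 0 ≤ β) (hε : 0 < ε) (t : Torus L → ℝ) :
    Real.exp (-(freeEnergy β ε t)) = Real.exp (Fintype.card (Torus L) * ε) * wtW (W0 β) ε t := by
  have hd := dH_pos (W0 β) (W0_symm β) (W0_nonneg hβ) ε hε t
  have hs : Real.sqrt (dH (W0 β) ε t) = Real.exp ((1/2) * Real.log (dH (W0 β) ε t)) := by
    rw [Real.sqrt_eq_rpow, Real.rpow_def_of_pos hd]; ring_nf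
  rw [wtW_dH, hs, freeEnergy, det_Dmat, Real.log_mul (Real.exp_ne_zero _) hd.ne', Real.log_exp, Ht_one _ (W0_symm β), ← Real.exp_add,
    ← Real.exp_add]
  congr 1
  have e1 : β * nnSum (fun i j => Real.cosh (t i - t j) - 1) = (1/2) * ∑ x, ∑ y, W0 β x y * (Real.cosh (t x - t y) - 1) := by
    rw [nnSum, ← mul_assoc, mul_comm β, mul_assoc, Finset.mul_sum]
    congr 1
    refine Finset.sum_congr rfl fun x _ => ?_
    rw [Finset.mul_sum]
    refine Finset.sum_congr rfl fun y _ => ?_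
    rw [W0]; split_ifs <;> simp
  have e2 : ∑ k, (t k - ε + ε * Real.cosh (t k)) = ∑ x, t x - Fintype.card (Torus L) * ε + (1/2) * (ε * ∑ x, Real.exp (t x)) + (1/2) * (ε * ∑ x, Real.exp (-t x)) := by
    simp_rw [Real.cosh_eq]
    rw [Finset.sum_add_distrib, Finset.sum_sub_distrib, Finset.sum_const, Finset.card_univ, nsmul_eq_mul,
      ← Finset.mul_sum, ← Finset.sum_div, Finset.sum_add_distrib]
    ring
  rw [e1, e2]
  ring

lemma wtW_cont {V : Type} [Fintype V] (W : Matrix V V ℝ) (ε : ℝ) : Continuous (wtW W ε) := by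
  unfold wtW
  have h := Ht_cont W ε
  have h1 : Continuous fun t => (Ht W ε t).det := h.matrix_det
  have h2 : Continuous fun t => (1 : V → ℝ) ⬝ᵥ (Ht W ε t *ᵥ 1) := continuous_const.dotProduct (h.matrix_mulVec continuous_const)
  fun_prop

end ident

abbrev Site := Fin 3 → ℕ
abbrev Fld := Site → ℝ
abbrev Edge := Site × Fin 3

def ev (d : Fin 3) : Site := Pi.single d 1

def En (E : Finset Edge) (t v : Fld) : ℝ :=
  ∑ e ∈ E, Real.exp (t e.1 + t (e.1 + ev e.2)) * (v e.1 - v (e.1 + ev e.2))^2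

def Evt (β : ℝ) (l : List (ℝ × Site × Site)) (E : Finset Edge) : Set Fld := {t | ∀ v, Gam l t v ≤ (β/2) * En E t v}

lemma Evt_meas (β : ℝ) (l : List (ℝ × Site × Site)) (E : Finset Edge) : MeasurableSet (Evt β l E) := by
  have hcl : IsClosed (Evt β l E) := by
    rw [Evt, Set.setOf_forall]
    refine isClosed_iInter fun v => isClosed_le ?_ ?_
    · unfold Gam
      induction l with
      | nil => simp; fun_prop
      | cons p l ih =>
        simp only [List.map_cons, List.sum_cons]
        exact Continuous.add (by fun_prop) ih
    · unfold En; fun_prop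
  exact hcl.measurableSet

lemma Csum_meas (l : List (ℝ × Site × Site)) : Measurable (Csum l) := by
  unfold Csum
  induction l with
  | nil => simp
  | cons p l ih =>
    simp only [List.map_cons, List.sum_cons]
    exact Measurable.add (by fun_prop) ih

section mu
variable {L : ℕ} [NeZero L]

def mu0 (L : ℕ) [NeZero L] (β ε : ℝ) : Measure (Torus L → ℝ) := volume.withDensity fun t =>
  ENNReal.ofReal (Real.exp (-(freeEnergy β ε t)) * ((Real.sqrt (2 * Real.pi))⁻¹) ^ (Fintype.card (Torus L)))

def phi (o : Torus L) (x : Site) : Torus L := fun i => o i + (x i : ZMod L)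

def tau (o : Torus L) (t : Torus L → ℝ) : Fld := fun x => t (phi o x)

lemma tau_meas (o : Torus L) : Measurable (tau o) := measurable_pi_lambda _ fun x => measurable_pi_apply _

def mu (L : ℕ) [NeZero L] (β ε : ℝ) (o : Torus L) : Measure Fld := (mu0 L β ε).map (tau o)

lemma phi_add (o : Torus L) (x : Site) (d : Fin 3) : phi o (x + ev d) = phi o x + unitVec L d := by
  funext i
  simp only [phi, ev, unitVec, Pi.add_apply, Nat.cast_add, Pi.single_apply]
  split_ifs <;> simp [add_assoc]

lemma mu0_lint (β ε : ℝ) (hβ : 0 ≤ β) (hε : 0 < ε) (f : (Torus L → ℝ) → ENNReal) (hf : Measurable f) :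
    ∫⁻ t, f t ∂(mu0 L β ε) = ENNReal.ofReal (Real.exp (Fintype.card (Torus L) * ε) * ((Real.sqrt (2 * Real.pi))⁻¹) ^ (Fintype.card (Torus L)))
      * ∫⁻ t, ENNReal.ofReal (wtW (W0 β) ε t) * f t := by
  have hd : (fun t : Torus L → ℝ => ENNReal.ofReal (Real.exp (-(freeEnergy β ε t)) * ((Real.sqrt (2 * Real.pi))⁻¹) ^ (Fintype.card (Torus L)))) =
    fun t : Torus L → ℝ => ENNReal.ofReal (Real.exp (Fintype.card (Torus L) * ε) * ((Real.sqrt (2 * Real.pi))⁻¹) ^ (Fintype.card (Torus L))) *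
      ENNReal.ofReal (wtW (W0 β) ε t) := by
    funext t
    rw [exp_neg_F β ε hβ hε, ← ENNReal.ofReal_mul (by positivity)]
    congr 1; ring
  have hm : Measurable fun t : Torus L → ℝ => ENNReal.ofReal (wtW (W0 β) ε t) := (wtW_cont _ _).measurable.ennreal_ofReal
  rw [mu0, hd, lintegral_withDensity_eq_lintegral_mul _ (hm.const_mul _) hf]
  simp only [Pi.mul_apply, mul_assoc]
  rw [lintegral_const_mul']
  exact ENNReal.ofReal_ne_top

lemma En_le (β ε : ℝ) (hβ : 0 ≤ β) (hε : 0 < ε) (o : Torus L) (S : Finset Site) (hS : ∀ x ∈ S, ∀ y ∈ S, phi o x = phi o y → x = y)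
    (E : Finset Edge) (hE : ∀ e ∈ E, e.1 ∈ S ∧ e.1 + ev e.2 ∈ S) (t u : Torus L → ℝ) :
    β * En E (tau o t) (fun x => u (phi o x)) ≤ Qf (W0 β) ε t u := by
  have h0 : 0 ≤ ε * ∑ x, Real.exp (t x) * (u x)^2 :=
    mul_nonneg hε.le (Finset.sum_nonneg fun x _ => by positivity)
  set w : Torus L × Torus L → ℝ := fun p => W0 β p.1 p.2 * Real.exp (t p.1 + t p.2) * (u p.1 - u p.2)^2 with hw
  have hw0 : ∀ p, 0 ≤ w p := fun p => by have := W0_nonneg hβ p.1 p.2; simp only [hw]; positivity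
  have hws : ∀ a b, w (a, b) = w (b, a) := by
    intro a b; simp only [hw]; rw [← (W0_symm β).apply, add_comm (t a)]; ring
  have hev : ∀ d : Fin 3, ev d ≠ 0 := by
    intro d h; have := congrFun h d; simp [ev] at this
  have hne : ∀ e ∈ E, phi o e.1 ≠ phi o (e.1 + ev e.2) := by
    intro e he h
    have := hS _ (hE e he).1 _ (hE e he).2 h
    exact hev e.2 (by simpa using this)
  have h1 : β * En E (tau o t) (fun x => u (phi o x)) = ∑ e ∈ E, w (phi o e.1, phi o (e.1 + ev e.2)) := by
    rw [En, Finset.mul_sum]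
    refine Finset.sum_congr rfl fun e he => ?_
    simp only [hw, tau, W0]
    rw [if_pos, mul_assoc]
    exact ⟨hne e he, e.2, Or.inl (phi_add _ _ _)⟩
  let g : Edge × Bool → Torus L × Torus L := fun p => if p.2 then (phi o p.1.1, phi o (p.1.1 + ev p.1.2)) else (phi o (p.1.1 + ev p.1.2), phi o p.1.1)
  have hginj : Set.InjOn g ((E ×ˢ (Finset.univ : Finset Bool) : Finset (Edge × Bool)) : Set (Edge × Bool)) := by
    have key1 : ∀ e ∈ E, ∀ e' ∈ E, phi o e.1 = phi o e'.1 → phi o (e.1 + ev e.2) = phi o (e'.1 + ev e'.2) → e = e' := by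
      intro e he e' he' h1 h2
      have h1 := hS _ (hE e he).1 _ (hE e' he').1 h1
      have h2 := hS _ (hE e he).2 _ (hE e' he').2 h2
      rw [h1] at h2
      have h3 : ev e.2 = ev e'.2 := by simpa using h2
      have h4 : e.2 = e'.2 := by
        have := congrFun h3 e.2
        simp only [ev, Pi.single_apply] at this
        by_contra hc
        simp [hc] at this
      exact Prod.ext h1 h4
    have key2 : ∀ e ∈ E, ∀ e' ∈ E, phi o e.1 = phi o (e'.1 + ev e'.2) → phi o (e.1 + ev e.2) = phi o e'.1 → False := by
      intro e he e' he' h1 h2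
      have h1 := hS _ (hE e he).1 _ (hE e' he').2 h1
      have h2 := hS _ (hE e he).2 _ (hE e' he').1 h2
      rw [h1, add_assoc] at h2
      have h3 : ev e'.2 + ev e.2 = 0 := by simpa using h2
      have := congrFun h3 e.2
      simp [ev] at this
    rintro ⟨e, b⟩ he ⟨e', b'⟩ he' h
    simp only [Finset.coe_product, Finset.coe_univ, Set.mem_prod, Finset.mem_coe, Set.mem_univ, and_true] at he he'
    cases b <;> cases b' <;> simp only [g, if_true, Bool.false_eq_true, if_false, Prod.mk.injEq] at h
    · rw [key1 e he e' he' h.2 h.1]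
    · exact (key2 e' he' e he h.1.symm h.2.symm).elim
    · exact (key2 e he e' he' h.1 h.2).elim
    · rw [key1 e he e' he' h.1 h.2]
  have h2 : 2 * ∑ e ∈ E, w (phi o e.1, phi o (e.1 + ev e.2)) ≤ ∑ p : Torus L × Torus L, w p := by
    calc _ = ∑ p ∈ E ×ˢ (Finset.univ : Finset Bool), w (g p) := by
          rw [Finset.sum_product, Finset.mul_sum]
          refine Finset.sum_congr rfl fun e he => ?_
          simp only [Fintype.sum_bool, g, if_true, Bool.false_eq_true, if_false]
          rw [hws (phi o (e.1 + ev e.2))]; ring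
      _ = ∑ p ∈ (E ×ˢ (Finset.univ : Finset Bool)).image g, w p := (Finset.sum_image hginj).symm
      _ ≤ _ := Finset.sum_le_sum_of_subset_of_nonneg (Finset.subset_univ _) fun p _ _ => hw0 p
  rw [h1, Qf]
  rw [Fintype.sum_prod_type] at h2
  simp only [hw] at h2 ⊢
  linarith

theorem hT (β ε : ℝ) (hβ : 0 ≤ β) (hε : 0 < ε) (o : Torus L) (S : Finset Site) (hS : ∀ x ∈ S, ∀ y ∈ S, phi o x = phi o y → x = y)
    (E : Finset Edge) (hE : ∀ e ∈ E, e.1 ∈ S ∧ e.1 + ev e.2 ∈ S) (l : List (ℝ × Site × Site)) (hl : ∀ p ∈ l, 0 ≤ p.1) :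
    ∫⁻ t in Evt β l E, ENNReal.ofReal (Real.exp (Csum l t)) ∂(mu L β ε o) ≤ ENNReal.ofReal (Real.sqrt 2 ^ l.length) := by
  have hm := (Csum_meas l).exp.ennreal_ofReal
  set S' := tau o ⁻¹' (Evt β l E) with hS'
  have hS'm : MeasurableSet S' := tau_meas o (Evt_meas β l E)
  rw [mu, setLIntegral_map (Evt_meas β l E) hm (tau_meas o), ← lintegral_indicator hS'm]
  have hm2 : Measurable (S'.indicator fun t => ENNReal.ofReal (Real.exp (Csum l (tau o t)))) := (hm.comp (tau_meas o)).indicator hS'm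
  rw [mu0_lint β ε hβ hε _ hm2]
  set l' : List (ℝ × Torus L × Torus L) := l.map fun p => (p.1, phi o p.2.1, phi o p.2.2) with hl'
  have hC : ∀ t, Csum l (tau o t) = Csum l' t := by
    intro t; simp only [Csum, hl', List.map_map]; rfl
  have hG : ∀ t u, Gam l (tau o t) (fun x => u (phi o x)) = Gam l' t u := by
    intro t u; simp only [Gam, hl', List.map_map]; rfl
  have key := tilt_int (W0 β) (W0_symm β) (W0_nonneg hβ) ε hε l' ?_ S' hS'm ?_
  · have e : ∫⁻ t, ENNReal.ofReal (wtW (W0 β) ε t) * S'.indicator (fun t => ENNReal.ofReal (Real.exp (Csum l (tau o t)))) t =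
      ∫⁻ t in S', ENNReal.ofReal (Real.exp (Csum l' t) * wtW (W0 β) ε t) := by
      rw [← lintegral_indicator hS'm]
      congr 1; funext t
      by_cases ht : t ∈ S'
      · rw [Set.indicator_of_mem ht, Set.indicator_of_mem ht, hC, ENNReal.ofReal_mul (by positivity), mul_comm]
      · rw [Set.indicator_of_notMem ht, Set.indicator_of_notMem ht, mul_zero]
    rw [e]
    refine (mul_le_mul_right key _).trans ?_
    rw [← ENNReal.ofReal_mul (by positivity)]
    apply ENNReal.ofReal_le_ofReal
    have hlen : l'.length = l.length := by simp [hl']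
    rw [hlen]
    have e1 : Real.exp (Fintype.card (Torus L) * ε) * Real.exp (-(Fintype.card (Torus L) * ε)) = 1 := by
      rw [← Real.exp_add]; simp
    have e2 : ((Real.sqrt (2 * Real.pi))⁻¹) ^ (Fintype.card (Torus L)) * (Real.sqrt (2 * Real.pi)) ^ (Fintype.card (Torus L)) = 1 := by
      rw [← mul_pow, inv_mul_cancel₀ (by positivity), one_pow]
    apply le_of_eq
    linear_combination (Real.sqrt 2 ^ l.length) * ((((Real.sqrt (2 * Real.pi))⁻¹) ^ (Fintype.card (Torus L)) * (Real.sqrt (2 * Real.pi)) ^ (Fintype.card (Torus L))) * e1 + e2)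
  · intro p hp
    obtain ⟨q, hq, rfl⟩ := List.mem_map.1 hp
    exact hl q hq
  · intro t ht u
    have h1 := ht (fun x => u (phi o x))
    rw [hG] at h1
    have h2 := En_le β ε hβ hε o S hS E hE t u
    linarith
end mu
end

end PartA8

section PartA9
open scoped BigOperators Classical ENNReal
open MeasureTheory Matrix
noncomputable section

abbrev Pat := List (ℝ × Site × Site)

def Phi (β : ℝ) (E : Finset Edge) (l : Pat) (t : Fld) : ℝ≥0∞ := (Evt β l E).indicator (fun t => ENNReal.ofReal (Real.exp (Csum l t))) t

def s2 : ℝ≥0∞ := ENNReal.ofReal (Real.sqrt 2)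

def Dom (β : ℝ) (E : Finset Edge) (f : Fld → ℝ≥0∞) (q : ℝ≥0∞) : Prop :=
  ∃ c : List (ℝ≥0∞ × Pat), (∀ p ∈ c, ∀ r ∈ p.2, 0 ≤ r.1) ∧ (∀ t, f t ≤ (c.map fun p => p.1 * Phi β E p.2 t).sum) ∧
    (c.map fun p => p.1 * s2 ^ p.2.length).sum ≤ q

def UB (μ : Measure Fld) (f : Fld → ℝ≥0∞) (c : ℝ≥0∞) : Prop := ∃ g : Fld → ℝ≥0∞, Measurable g ∧ (∀ t, f t ≤ g t) ∧ ∫⁻ t, g t ∂μ ≤ c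

def HT (μ : Measure Fld) (β : ℝ) (WE : Set Edge) : Prop := ∀ E : Finset Edge, (∀ e ∈ E, e ∈ WE) → ∀ l : Pat, (∀ p ∈ l, 0 ≤ p.1) →
  ∫⁻ t, Phi β E l t ∂μ ≤ s2 ^ l.length

lemma Phi_meas (β : ℝ) (E : Finset Edge) (l : Pat) : Measurable (Phi β E l) :=
  ((Csum_meas l).exp.ennreal_ofReal).indicator (Evt_meas β l E)

lemma En_nonneg (E : Finset Edge) (t v : Fld) : 0 ≤ En E t v := Finset.sum_nonneg fun e _ => by positivity

lemma En_mono {E E' : Finset Edge} (h : E ⊆ E') (t v : Fld) : En E t v ≤ En E' t v :=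
  Finset.sum_le_sum_of_subset_of_nonneg h fun e _ _ => by positivity

lemma En_union {E E' : Finset Edge} (h : Disjoint E E') (t v : Fld) : En (E ∪ E') t v = En E t v + En E' t v :=
  Finset.sum_union h

lemma Phi_mono {β : ℝ} (hβ : 0 ≤ β) {E E' : Finset Edge} (h : E ⊆ E') (l : Pat) (t : Fld) : Phi β E l t ≤ Phi β E' l t := by
  unfold Phi
  apply Set.indicator_le_indicator_of_subset
  · intro t ht v
    have := En_mono h t v
    exact (ht v).trans (by gcongr)
  · intro _; exact zero_le

lemma Phi_mul (β : ℝ) {E E' : Finset Edge} (h : Disjoint E E') (l l' : Pat) (t : Fld) :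
    Phi β E l t * Phi β E' l' t ≤ Phi β (E ∪ E') (l ++ l') t := by
  unfold Phi
  by_cases h1 : t ∈ Evt β l E
  · by_cases h2 : t ∈ Evt β l' E'
    · have h3 : t ∈ Evt β (l ++ l') (E ∪ E') := by
        intro v
        have a := h1 v
        have b := h2 v
        rw [En_union h, Gam, List.map_append, List.sum_append]
        rw [Gam] at a b
        linarith
      rw [Set.indicator_of_mem h1, Set.indicator_of_mem h2, Set.indicator_of_mem h3, ← ENNReal.ofReal_mul (by positivity), ← Real.exp_add]
      simp [Csum]
    · simp [Set.indicator_of_notMem h2]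
  · simp [Set.indicator_of_notMem h1]

namespace Dom
variable {β : ℝ} {E E' : Finset Edge} {f g : Fld → ℝ≥0∞} {q r : ℝ≥0∞}

lemma mono (h : Dom β E f q) (hf : ∀ t, g t ≤ f t) (hq : q ≤ r) : Dom β E g r := by
  obtain ⟨c, h1, h2, h3⟩ := h
  exact ⟨c, h1, fun t => (hf t).trans (h2 t), h3.trans hq⟩

lemma mono_E (hβ : 0 ≤ β) (h : Dom β E f q) (hE : E ⊆ E') : Dom β E' f q := by
  obtain ⟨c, h1, h2, h3⟩ := h
  refine ⟨c, h1, fun t => (h2 t).trans ?_, h3⟩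
  apply List.sum_le_sum
  intro p hp
  have := Phi_mono hβ hE p.2 t
  gcongr

lemma zero : Dom β E (fun _ => 0) 0 := ⟨[], by simp, by simp, by simp⟩

lemma one (hβ : 0 ≤ β) : Dom β E (fun _ => 1) 1 := by
  refine ⟨[(1, [])], by simp, fun t => ?_, by simp⟩
  have : t ∈ Evt β ([] : Pat) E := by
    intro v
    have := En_nonneg E t v
    simp only [Gam, List.map_nil, List.sum_nil]; positivity
  simp [Phi, Set.indicator_of_mem this, Csum]

lemma pat (l : Pat) (hl : ∀ p ∈ l, 0 ≤ p.1) : Dom β E (Phi β E l) (s2 ^ l.length) :=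
  ⟨[(1, l)], by simpa using hl, by simp, by simp⟩

lemma add (h : Dom β E f q) (h' : Dom β E g r) : Dom β E (fun t => f t + g t) (q + r) := by
  obtain ⟨c, h1, h2, h3⟩ := h
  obtain ⟨c', h1', h2', h3'⟩ := h'
  refine ⟨c ++ c', ?_, fun t => ?_, ?_⟩
  · intro p hp
    rcases List.mem_append.1 hp with hp | hp
    · exact h1 p hp
    · exact h1' p hp
  · rw [List.map_append, List.sum_append]; exact add_le_add (h2 t) (h2' t)
  · rw [List.map_append, List.sum_append]; exact add_le_add h3 h3'

lemma const_mul (a : ℝ≥0∞) (h : Dom β E f q) : Dom β E (fun t => a * f t) (a * q) := by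
  obtain ⟨c, h1, h2, h3⟩ := h
  refine ⟨c.map fun p => (a * p.1, p.2), ?_, fun t => ?_, ?_⟩
  · intro p hp
    obtain ⟨p', hp', rfl⟩ := List.mem_map.1 hp
    exact h1 p' hp'
  · refine (mul_le_mul_right (h2 t) a).trans (le_of_eq ?_)
    rw [← List.sum_map_mul_left, List.map_map]
    congr 1; apply List.map_congr_left; intro p _; simp [mul_assoc]
  · refine le_trans (le_of_eq ?_) (mul_le_mul_right h3 a)
    rw [← List.sum_map_mul_left, List.map_map]
    congr 1; apply List.map_congr_left; intro p _; simp [mul_assoc]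

lemma sum {ι : Type*} (s : Finset ι) (f : ι → Fld → ℝ≥0∞) (q : ι → ℝ≥0∞) (h : ∀ i ∈ s, Dom β E (f i) (q i)) :
    Dom β E (fun t => ∑ i ∈ s, f i t) (∑ i ∈ s, q i) := by
  induction s using Finset.induction_on with
  | empty => simpa using zero
  | insert a s ha ih =>
    simp only [Finset.sum_insert ha]
    exact (h a (Finset.mem_insert_self _ _)).add (ih fun i hi => h i (Finset.mem_insert_of_mem hi))

/-- finite cover by events with the same bound -/
lemma cover {ι : Type*} (s : Finset ι) (g : Fld → ℝ≥0∞) (f : ι → Fld → ℝ≥0∞) (q : ℝ≥0∞) (h : ∀ i ∈ s, Dom β E (f i) q)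
    (hc : ∀ t, g t ≠ 0 → ∃ i ∈ s, g t ≤ f i t) (C : ℝ≥0∞) (hs : (s.card : ℝ≥0∞) ≤ C) :
    Dom β E g (C * q) := by
  refine (sum s f (fun _ => q) h).mono (fun t => ?_) ?_
  · by_cases h0 : g t = 0
    · rw [h0]; exact zero_le
    · obtain ⟨i, hi, hle⟩ := hc t h0
      exact hle.trans (Finset.single_le_sum (f := fun i => f i t) (fun _ _ => zero_le) hi)
  · rw [Finset.sum_const, nsmul_eq_mul]; gcongr

lemma mul (hd : Disjoint E E') (h : Dom β E f q) (h' : Dom β E' g r) : Dom β (E ∪ E') (fun t => f t * g t) (q * r) := by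
  obtain ⟨c, h1, h2, h3⟩ := h
  obtain ⟨c', h1', h2', h3'⟩ := h'
  have key : ∀ (F F' G : ℝ≥0∞ × Pat → ℝ≥0∞) , (∀ p p', F p * F' p' ≤ G (p.1 * p'.1, p.2 ++ p'.2)) →
      (c.map F).sum * (c'.map F').sum ≤ ((c.flatMap fun p => c'.map fun p' => (p.1 * p'.1, p.2 ++ p'.2)).map G).sum := by
    intro F F' G hG
    clear h1 h2 h3 
    induction c with
    | nil => simp
    | cons p c ih =>
      simp only [List.map_cons, List.sum_cons, List.flatMap_cons, List.map_append, List.sum_append, add_mul]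
      refine add_le_add ?_ ih
      rw [← List.sum_map_mul_left, List.map_map]
      apply List.sum_le_sum
      intro p' _
      exact hG p p'
  refine ⟨c.flatMap fun p => c'.map fun p' => (p.1 * p'.1, p.2 ++ p'.2), ?_, fun t => ?_, ?_⟩
  · intro p hp
    obtain ⟨a, ha, hb⟩ := List.mem_flatMap.1 hp
    obtain ⟨b, hb2, rfl⟩ := List.mem_map.1 hb
    intro x hx
    rcases List.mem_append.1 hx with hx | hx
    · exact h1 a ha x hx
    · exact h1' b hb2 x hx
  · refine (mul_le_mul' (h2 t) (h2' t)).trans (key _ _ _ ?_)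
    intro p p'
    calc _ = p.1 * p'.1 * (Phi β E p.2 t * Phi β E' p'.2 t) := by ring
      _ ≤ _ := by
        simp only
        have := Phi_mul β hd p.2 p'.2 t
        gcongr
  · refine le_trans ?_ (mul_le_mul' h3 h3')
    clear h1 h2 h3 key
    induction c with
    | nil => simp
    | cons p c ih =>
      simp only [List.map_cons, List.sum_cons, List.flatMap_cons, List.map_append, List.sum_append, add_mul]
      refine add_le_add ?_ ih
      rw [← List.sum_map_mul_left, List.map_map]
      apply List.sum_le_sum
      intro p' _
      simp only [Function.comp, List.length_append, pow_add]
      exact le_of_eq (by ring)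

lemma toUB {μ : Measure Fld} {WE : Set Edge} (hT : HT μ β WE) (hE : ∀ e ∈ E, e ∈ WE) (h : Dom β E f q) : UB μ f q := by
  obtain ⟨c, h1, h2, h3⟩ := h
  refine ⟨fun t => (c.map fun p => p.1 * Phi β E p.2 t).sum, ?_, h2, le_trans ?_ h3⟩
  · clear h1 h2 h3
    induction c with
    | nil => simp
    | cons p c ih => simp only [List.map_cons, List.sum_cons]; exact ((Phi_meas β E p.2).const_mul _).add ih
  · clear h2 h3
    induction c with
    | nil => simp
    | cons p c ih =>
      simp only [List.map_cons, List.sum_cons]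
      rw [lintegral_add_left ((Phi_meas β E p.2).const_mul _), lintegral_const_mul _ (Phi_meas β E p.2)]
      refine add_le_add ?_ (ih fun p hp => h1 p (List.mem_cons_of_mem _ hp))
      exact mul_le_mul_right (hT E hE p.2 (h1 p List.mem_cons_self)) _
end Dom

namespace UB
variable {μ : Measure Fld} {f g h : Fld → ℝ≥0∞} {a b c : ℝ≥0∞}

lemma mono (hf : UB μ f a) (hg : ∀ t, g t ≤ f t) (hab : a ≤ b) : UB μ g b := by
  obtain ⟨F, h1, h2, h3⟩ := hf
  exact ⟨F, h1, fun t => (hg t).trans (h2 t), h3.trans hab⟩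

lemma zero : UB μ (fun _ => 0) 0 := ⟨fun _ => 0, measurable_const, fun _ => le_rfl, by simp⟩

lemma add (hf : UB μ f a) (hg : UB μ g b) : UB μ (fun t => f t + g t) (a + b) := by
  obtain ⟨F, h1, h2, h3⟩ := hf
  obtain ⟨G, h1', h2', h3'⟩ := hg
  refine ⟨fun t => F t + G t, h1.add h1', fun t => add_le_add (h2 t) (h2' t), ?_⟩
  rw [lintegral_add_left h1]; exact add_le_add h3 h3'

lemma sum {ι : Type*} (s : Finset ι) (f : ι → Fld → ℝ≥0∞) (q : ι → ℝ≥0∞) (h : ∀ i ∈ s, UB μ (f i) (q i)) :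
    UB μ (fun t => ∑ i ∈ s, f i t) (∑ i ∈ s, q i) := by
  induction s using Finset.induction_on with
  | empty => simpa using zero
  | insert a s ha ih =>
    simp only [Finset.sum_insert ha]
    exact (h a (Finset.mem_insert_self _ _)).add (ih fun i hi => h i (Finset.mem_insert_of_mem hi))

lemma holder3 (hf : UB μ f a) (hg : UB μ g b) (hh : UB μ h c) (x y z : ℝ) (hx : 0 ≤ x) (hy : 0 ≤ y) (hz : 0 ≤ z) (hs : x + y + z = 1) :
    UB μ (fun t => f t ^ x * g t ^ y * h t ^ z) (a ^ x * b ^ y * c ^ z) := by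
  obtain ⟨F, h1, h2, h3⟩ := hf
  obtain ⟨G, h1', h2', h3'⟩ := hg
  obtain ⟨H, h1'', h2'', h3''⟩ := hh
  refine ⟨fun t => F t ^ x * G t ^ y * H t ^ z, ((h1.pow_const _).mul (h1'.pow_const _)).mul (h1''.pow_const _), fun t => ?_, ?_⟩
  · exact mul_le_mul' (mul_le_mul' (ENNReal.rpow_le_rpow (h2 t) hx) (ENNReal.rpow_le_rpow (h2' t) hy)) (ENNReal.rpow_le_rpow (h2'' t) hz)
  · have := ENNReal.lintegral_prod_norm_pow_le (μ := μ) (Finset.univ : Finset (Fin 3)) (f := ![F, G, H]) (p := ![x, y, z])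
      (by intro i _; fin_cases i; exacts [h1.aemeasurable, h1'.aemeasurable, h1''.aemeasurable])
      (by simpa [Fin.sum_univ_three] using hs) (by intro i _; fin_cases i <;> simpa)
    simp only [Fin.prod_univ_three, Matrix.cons_val_zero, Matrix.cons_val_one, Matrix.cons_val] at this
    exact this.trans (mul_le_mul' (mul_le_mul' (ENNReal.rpow_le_rpow h3 hx) (ENNReal.rpow_le_rpow h3' hy)) (ENNReal.rpow_le_rpow h3'' hz))
end UB
end

end PartA9

section PartB1
open scoped BigOperators Classical ENNReal
open MeasureTheory Matrix
noncomputable section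

def sg : ℕ := 10000000
lemma sg_eq : sg = 10000000 := rfl
attribute [irreducible] sg
lemma sg_pos : 0 < sg := by rw [sg_eq]; norm_num
def rh : ℕ := 3 * sg
lemma rh_pos : 0 < rh := by rw [rh, sg_eq]; norm_num
attribute [irreducible] rh
lemma rh_eq : rh = 3 * sg := by unfold rh; rfl

def anc (k : ℕ) (x : Site) : Site := fun i => x i / rh ^ k
def cells (k : ℕ) (Q : Site) : Finset Site := Fintype.piFinset fun i => Finset.Ico (rh ^ k * Q i) (rh ^ k * (Q i + 1))
def edgesIn (S : Finset Site) : Finset Edge := (S ×ˢ (Finset.univ : Finset (Fin 3))).filter fun e => e.1 + ev e.2 ∈ S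
def cellE (k : ℕ) (Q : Site) : Finset Edge := edgesIn (cells k Q)
def domE (k : ℕ) (e : Edge) : Finset Edge := edgesIn (cells k e.1 ∪ cells k (e.1 + ev e.2))

lemma div_eq_iff_Ico {n a q : ℕ} (hn : 0 < n) : a / n = q ↔ n * q ≤ a ∧ a < n * (q + 1) := by
  rw [Nat.div_eq_iff hn]
  have : n * (q+1) = n * q + n := by ring
  rw [this, mul_comm q n]
  omega

lemma mem_cells {k : ℕ} {Q x : Site} : x ∈ cells k Q ↔ anc k x = Q := by
  have := rh_pos
  simp only [cells, Fintype.mem_piFinset, Finset.mem_Ico, anc, funext_iff, div_eq_iff_Ico (pow_pos this k)]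

lemma mem_edgesIn {S : Finset Site} {e : Edge} : e ∈ edgesIn S ↔ e.1 ∈ S ∧ e.1 + ev e.2 ∈ S := by
  simp [edgesIn]

lemma mem_cellE {k : ℕ} {Q : Site} {e : Edge} : e ∈ cellE k Q ↔ anc k e.1 = Q ∧ anc k (e.1 + ev e.2) = Q := by
  simp [cellE, mem_edgesIn, mem_cells]

lemma mem_domE {k : ℕ} {e f : Edge} : f ∈ domE k e ↔ (anc k f.1 = e.1 ∨ anc k f.1 = e.1 + ev e.2) ∧
    (anc k (f.1 + ev f.2) = e.1 ∨ anc k (f.1 + ev f.2) = e.1 + ev e.2) := by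
  simp [domE, mem_edgesIn, mem_cells]

lemma anc_zero (x : Site) : anc 0 x = x := by funext i; simp [anc]

lemma anc_add (j k : ℕ) (x : Site) : anc j (anc k x) = anc (k + j) x := by
  funext i; simp [anc, Nat.div_div_eq_div_mul, pow_add]

lemma anc_succ (k : ℕ) (x : Site) : anc (k+1) x = anc 1 (anc k x) := (anc_add 1 k x).symm

lemma ev_apply (d i : Fin 3) : ev d i = if i = d then 1 else 0 := by simp [ev, Pi.single_apply]

/-- the dominoes in direction `d` overlap at most twice -/
lemma sum_domE_le (k : ℕ) (d : Fin 3) (A : Finset Site) (E : Finset Edge) (hE : ∀ a ∈ A, domE k (a, d) ⊆ E) (t v : Fld) :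
    ∑ a ∈ A, En (domE k (a, d)) t v ≤ 2 * En E t v := by
  set w : Edge → ℝ := fun e => Real.exp (t e.1 + t (e.1 + ev e.2)) * (v e.1 - v (e.1 + ev e.2))^2 with hw
  have hw0 : ∀ e, 0 ≤ w e := fun e => by simp only [hw]; positivity
  have h1 : ∀ a ∈ A, En (domE k (a,d)) t v = ∑ e ∈ E, if e ∈ domE k (a,d) then w e else 0 := by
    intro a ha
    rw [← Finset.sum_filter, Finset.filter_mem_eq_inter, Finset.inter_eq_right.2 (hE a ha)]
    rfl
  rw [Finset.sum_congr rfl h1, Finset.sum_comm, En, Finset.mul_sum]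
  refine Finset.sum_le_sum fun e _ => ?_
  rw [← Finset.sum_filter, Finset.sum_const, nsmul_eq_mul]
  have h2 : (A.filter fun a => e ∈ domE k (a,d)) ⊆ {anc k e.1, anc k e.1 - ev d} := by
    intro a ha
    have := (mem_domE.1 (Finset.mem_filter.1 ha).2).1
    simp only [Finset.mem_insert, Finset.mem_singleton]
    rcases this with h | h
    · left; exact h.symm
    · right; rw [h]; simp
  have h3 : ((A.filter fun a => e ∈ domE k (a,d)).card : ℝ) ≤ 2 := by
    exact_mod_cast (Finset.card_le_card h2).trans Finset.card_le_two
  exact mul_le_mul_of_nonneg_right h3 (hw0 e)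

def dist1 (a b : Site) : ℕ := ∑ i, ((a i - b i) + (b i - a i))

lemma dist1_comm (a b : Site) : dist1 a b = dist1 b a := by
  unfold dist1; refine Finset.sum_congr rfl fun i _ => by omega

lemma dist1_eq_zero {a b : Site} (h : dist1 a b = 0) : a = b := by
  funext i
  have := Finset.sum_eq_zero_iff.1 h i (Finset.mem_univ i)
  omega

lemma dist1_step {a b : Site} {i : Fin 3} (h : a i < b i) : dist1 a b = dist1 (a + ev i) b + 1 := by
  unfold dist1
  rw [← Finset.add_sum_erase _ _ (Finset.mem_univ i), ← Finset.add_sum_erase (a := i) (f := fun j => ((a + ev i) j - b j) + (b j - (a + ev i) j)) _ (Finset.mem_univ i)]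
  have h1 : ∀ j ∈ Finset.univ.erase i, ((a + ev i) j - b j) + (b j - (a + ev i) j) = (a j - b j) + (b j - a j) := by
    intro j hj
    have : j ≠ i := (Finset.mem_erase.1 hj).1
    simp [ev_apply, this]
  rw [Finset.sum_congr rfl h1]
  simp only [Pi.add_apply, ev_apply, if_true]
  omega

lemma boxlem (g : Site → ℝ) (lo hi : Site) (δ : ℝ) (h : ∀ a d, lo ≤ a → a + ev d ≤ hi → |g a - g (a + ev d)| ≤ δ) :
    ∀ a b, lo ≤ a → a ≤ hi → lo ≤ b → b ≤ hi → |g a - g b| ≤ δ * dist1 a b := by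
  suffices H : ∀ n a b, lo ≤ a → a ≤ hi → lo ≤ b → b ≤ hi → dist1 a b = n → |g a - g b| ≤ δ * n by
    intro a b h1 h2 h3 h4; exact H _ a b h1 h2 h3 h4 rfl
  intro n
  induction n with
  | zero => intro a b _ _ _ _ h0; rw [dist1_eq_zero h0]; simp
  | succ n ih =>
    have key : ∀ a b, lo ≤ a → a ≤ hi → lo ≤ b → b ≤ hi → dist1 a b = n + 1 → (∃ i, a i < b i) → |g a - g b| ≤ δ * (n + 1 : ℕ) := by
      rintro a b h1 h2 h3 h4 h5 ⟨i, hi'⟩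
      have h6 := dist1_step hi'
      have h7 : a + ev i ≤ hi := by
        intro j
        have q1 : a j ≤ hi j := h2 j
        have q2 : b j ≤ hi j := h4 j
        by_cases hj : j = i
        · subst hj; simp [ev_apply]; omega
        · simp [ev_apply, hj]; omega
      have h8 : lo ≤ a + ev i := h1.trans (by simp)
      have h9 := ih (a + ev i) b h8 h7 h3 h4 (by omega)
      have h10 := h a i h1 h7
      calc |g a - g b| ≤ |g a - g (a + ev i)| + |g (a + ev i) - g b| := abs_sub_le _ _ _
        _ ≤ δ + δ * n := add_le_add h10 h9
        _ = _ := by push_cast; ring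
    intro a b h1 h2 h3 h4 h5
    by_cases hc : ∃ i, a i < b i
    · exact key a b h1 h2 h3 h4 h5 hc
    · by_cases hc' : ∃ i, b i < a i
      · rw [abs_sub_comm]; exact key b a h3 h4 h1 h2 (by rw [dist1_comm]; exact h5) hc'
      · push Not at hc hc'
        have : a = b := funext fun i => le_antisymm (hc' i) (hc i)
        subst this
        simp [dist1] at h5

def sbc (b : Site) : Finset Site := Fintype.piFinset fun i => Finset.Ico (sg * b i) (sg * (b i + 1))
lemma mem_sub {a b : Site} : a ∈ sbc b ↔ ∀ i, sg * b i ≤ a i ∧ a i < sg * (b i + 1) := by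
  simp [sbc, Fintype.mem_piFinset]
lemma card_sub (b : Site) : (sbc b).card = sg ^ 3 := by
  simp only [sbc, Fintype.card_piFinset, Nat.card_Ico, ← Nat.mul_sub, Nat.add_sub_cancel_left, mul_one, Finset.prod_const, Finset.card_univ, Fintype.card_fin]
def avg (f : Site → ℝ) (b : Site) : ℝ := (∑ a ∈ sbc b, f a) / (sg : ℝ)^3

lemma avg_step (f : Site → ℝ) (b : Site) (d : Fin 3) (U : Finset Site) (hU : ∀ a ∈ sbc b, ∀ i < sg, a + i • ev d ∈ U) :
    (avg f b - avg f (b + ev d))^2 ≤ (1 / sg) * ∑ a ∈ U, (f a - f (a + ev d))^2 := by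
  have hs : (0:ℝ) < sg := by exact_mod_cast sg_pos
  have h1 : ∑ a ∈ sbc (b + ev d), f a = ∑ a ∈ sbc b, f (a + sg • ev d) := by
    symm
    refine Finset.sum_bij (fun a _ => a + sg • ev d) ?_ ?_ ?_ (fun _ _ => rfl)
    · intro a ha
      rw [mem_sub] at ha ⊢
      intro i
      have := ha i
      by_cases hi : i = d
      · simp [ev_apply, hi]; subst hi; constructor <;> nlinarith
      · simp [ev_apply, hi]; exact this
    · intro a _ a' _ h; simpa using h
    · intro a ha
      rw [mem_sub] at ha
      have hle : sg • ev d ≤ a := by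
        intro i
        have := (ha i).1
        by_cases hi : i = d
        · simp [ev_apply, hi] at this ⊢; nlinarith
        · simp [ev_apply, hi]
      refine ⟨a - sg • ev d, ?_, tsub_add_cancel_of_le hle⟩
      rw [mem_sub]
      intro i
      have := ha i
      have h2 := hle i
      by_cases hi : i = d
      · simp [ev_apply, hi] at this h2 ⊢
        have e1 : sg * (b d + 1) = sg * b d + sg := by ring
        have e2 : sg * (b d + 1 + 1) = sg * b d + sg + sg := by ring
        omega
      · simp [ev_apply, hi] at this ⊢; exact this
  have h2 : ∀ a, f a - f (a + sg • ev d) = ∑ i ∈ Finset.range sg, (f (a + i • ev d) - f (a + i • ev d + ev d)) := by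
    intro a
    have := Finset.sum_range_sub' (fun i => f (a + i • ev d)) sg
    simp only [zero_smul, add_zero, succ_nsmul, ← add_assoc] at this
    exact this.symm
  have h3 : avg f b - avg f (b + ev d) = (∑ p ∈ sbc b ×ˢ Finset.range sg, (f (p.1 + p.2 • ev d) - f (p.1 + p.2 • ev d + ev d))) / (sg:ℝ)^3 := by
    rw [avg, avg, h1, ← sub_div, ← Finset.sum_sub_distrib, Finset.sum_product]
    congr 1
    exact Finset.sum_congr rfl fun a _ => h2 a
  have h4 := sq_sum_le_card_mul_sum_sq (s := sbc b ×ˢ Finset.range sg) (f := fun p => f (p.1 + p.2 • ev d) - f (p.1 + p.2 • ev d + ev d))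
  have h5 : ∑ p ∈ sbc b ×ˢ Finset.range sg, (f (p.1 + p.2 • ev d) - f (p.1 + p.2 • ev d + ev d))^2 ≤ sg * ∑ a ∈ U, (f a - f (a + ev d))^2 := by
    rw [Finset.sum_product_right]
    calc _ ≤ ∑ i ∈ Finset.range sg, ∑ a ∈ U, (f a - f (a + ev d))^2 := by
          refine Finset.sum_le_sum fun i hi => ?_
          have hinj : Set.InjOn (fun a : Site => a + i • ev d) (sbc b) := fun a _ a' _ h => by simpa using h
          rw [← Finset.sum_image (f := fun a => (f a - f (a + ev d))^2) hinj]
          refine Finset.sum_le_sum_of_subset_of_nonneg ?_ fun _ _ _ => sq_nonneg _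
          intro x hx
          obtain ⟨a, ha, rfl⟩ := Finset.mem_image.1 hx
          exact hU a ha i (Finset.mem_range.1 hi)
      _ = _ := by simp
  rw [Finset.card_product, card_sub, Finset.card_range] at h4
  rw [h3, div_pow, div_le_iff₀ (by positivity)]
  calc _ ≤ _ := h4
    _ ≤ ((sg ^ 3 * sg : ℕ) : ℝ) * (sg * ∑ a ∈ U, (f a - f (a + ev d))^2) := by gcongr
    _ ≤ _ := by
      apply le_of_eq; push_cast; field_simp

def med (a b c : ℝ) : ℝ := max (min a b) (min (max a b) c)

end

end PartB1

section PartB2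
open scoped BigOperators Classical ENNReal
open MeasureTheory Matrix
noncomputable section

def al : ℝ := 1 / (100000 * sg)
lemma sgR_pos : (0:ℝ) < sg := by exact_mod_cast sg_pos
lemma al_pos : 0 < al := by have := sgR_pos; unfold al; positivity
lemma al_sg : al * sg = 1 / 100000 := by have := sgR_pos; unfold al; field_simp

structure Lev where
  T : Site → ℝ
  bad : Edge → Prop
  A : Fld → Fld

def inS (S : Set Site) (e : Edge) : Prop := e.1 ∈ S ∧ e.1 + ev e.2 ∈ S
def touch (e f : Edge) : Prop := e.1 = f.1 ∨ e.1 = f.1 + ev f.2 ∨ e.1 + ev e.2 = f.1 ∨ e.1 + ev e.2 = f.1 + ev f.2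
def OK (bad : Edge → Prop) (S : Set Site) : Prop := ∀ e f, bad e → bad f → inS S e → inS S f → touch e f
def chS (Q : Site) : Set Site := {a | anc 1 a = Q}
def dmS (e : Edge) : Set Site := {a | anc 1 a = e.1 ∨ anc 1 a = e.1 + ev e.2}
def slab (i : Fin 3) (s : ℕ) : Set Site := {a | a i / sg = s}

lemma cleanslab {bad : Edge → Prop} {S : Set Site} (h : OK bad S) (i : Fin 3) (q : ℕ) :
    ∃ c < 3, ∀ f, bad f → inS S f → ¬ inS (slab i (3 * q + c)) f := by
  by_cases hb : ∃ f, bad f ∧ inS S f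
  · obtain ⟨f, hf, hfS⟩ := hb
    obtain ⟨c, hc, h1, h2⟩ : ∃ c < 3, 3 * q + c ≠ f.1 i / sg ∧ 3 * q + c ≠ (f.1 + ev f.2) i / sg := by
      generalize f.1 i / sg = u
      generalize (f.1 + ev f.2) i / sg = w
      by_cases h0 : 3 * q + 0 ≠ u ∧ 3 * q + 0 ≠ w
      · exact ⟨0, by norm_num, h0⟩
      by_cases h1 : 3 * q + 1 ≠ u ∧ 3 * q + 1 ≠ w
      · exact ⟨1, by norm_num, h1⟩
      exact ⟨2, by norm_num, by omega, by omega⟩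
    refine ⟨c, hc, fun e he heS hes => ?_⟩
    have a1 : e.1 i / sg = 3 * q + c := hes.1
    have a2 : (e.1 + ev e.2) i / sg = 3 * q + c := hes.2
    rcases h e f he hf heS hfS with h | h | h | h
    · rw [h] at a1; exact h1 a1.symm
    · rw [h] at a1; exact h2 a1.symm
    · rw [h] at a2; exact h1 a2.symm
    · rw [h] at a2; exact h2 a2.symm
  · push Not at hb
    exact ⟨0, by norm_num, fun f h1 h2 => (hb f h1 h2).elim⟩

def cc (bad : Edge → Prop) (Q : Site) : ℕ :=
  if h : ∃ c < 3, ∀ f, bad f → inS (chS Q) f → ¬ inS (slab 0 (3 * Q 0 + c)) f then h.choose else 0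

lemma cc_lt (bad : Edge → Prop) (Q : Site) : cc bad Q < 3 := by
  unfold cc; split_ifs with h
  · exact h.choose_spec.1
  · norm_num

lemma cc_spec {bad : Edge → Prop} {Q : Site} (h : OK bad (chS Q)) :
    ∀ f, bad f → inS (chS Q) f → ¬ inS (slab 0 (3 * Q 0 + cc bad Q)) f := by
  have h' := cleanslab h 0 (Q 0)
  unfold cc; rw [dif_pos h']; exact h'.choose_spec.2

def kap (bad : Edge → Prop) (Q : Site) : Site := fun i => 3 * Q i + (if i = 0 then cc bad Q else 0)
def rep (b : Site) (o : ℕ) : Site := fun i => sg * b i + (if i = 0 then o else 0)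

def stepL (l : Lev) : Lev where
  T Q := med (l.T (rep (kap l.bad Q) 0)) (l.T (rep (kap l.bad Q) 1)) (l.T (rep (kap l.bad Q) 2))
  A v Q := avg (l.A v) (kap l.bad Q)
  bad e := ¬ OK l.bad (dmS e) ∨ al < |med (l.T (rep (kap l.bad e.1) 0)) (l.T (rep (kap l.bad e.1) 1)) (l.T (rep (kap l.bad e.1) 2)) -
    med (l.T (rep (kap l.bad (e.1 + ev e.2)) 0)) (l.T (rep (kap l.bad (e.1 + ev e.2)) 1)) (l.T (rep (kap l.bad (e.1 + ev e.2)) 2))|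

lemma stepL_bad (l : Lev) (e : Edge) : (stepL l).bad e ↔ ¬ OK l.bad (dmS e) ∨ al < |(stepL l).T e.1 - (stepL l).T (e.1 + ev e.2)| := Iff.rfl

def GB (l : Lev) (k : ℕ) (t : Fld) (R : ℝ) : Prop := ∀ e, ¬ l.bad e → |l.T e.1 - l.T (e.1 + ev e.2)| ≤ al ∧
  ∀ v, Real.exp (2 * min (l.T e.1) (l.T (e.1 + ev e.2))) * (l.A v e.1 - l.A v (e.1 + ev e.2))^2 ≤ R * En (domE k e) t v

/-- subcube index -/
def sidx (a : Site) : Site := fun i => a i / sg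

lemma mem_sbc' {a b : Site} : a ∈ sbc b ↔ sidx a = b := by
  rw [mem_sub, funext_iff]
  exact forall_congr' fun i => (div_eq_iff_Ico sg_pos).symm

lemma anc1_eq (a : Site) : anc 1 a = fun i => sidx a i / 3 := by
  funext i; simp only [anc, sidx, pow_one, rh_eq, Nat.div_div_eq_div_mul, mul_comm]

def inB (lo hi a : Site) : Prop := lo ≤ sidx a ∧ sidx a ≤ hi

lemma inB_iff {lo hi a : Site} : inB lo hi a ↔ (fun i => sg * lo i) ≤ a ∧ a ≤ (fun i => sg * hi i + (sg - 1)) := by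
  have := sg_pos
  unfold inB
  refine and_congr (forall_congr' fun i => ?_) (forall_congr' fun i => ?_)
  · simp only [sidx, Nat.le_div_iff_mul_le this, mul_comm]
  · simp only [sidx]
    rw [← Nat.lt_succ_iff, Nat.div_lt_iff_lt_mul this, Nat.succ_eq_add_one, add_mul, mul_comm sg]
    omega

def CB (l : Lev) (k : ℕ) (D : Finset Edge) (lo hi : Site) : Prop := ∀ a d, inB lo hi a → inB lo hi (a + ev d) → ¬ l.bad (a, d) ∧ domE k (a, d) ⊆ D

lemma dist1_le_of_box {lo hi a b : Site} (h1 : lo ≤ a) (h2 : a ≤ hi) (h3 : lo ≤ b) (h4 : b ≤ hi) : dist1 a b ≤ dist1 lo hi := by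
  refine Finset.sum_le_sum fun i _ => ?_
  have := h1 i; have := h2 i; have := h3 i; have := h4 i
  simp only at *
  omega

lemma dist1_scale {lo hi : Site} (h : lo ≤ hi) : dist1 (fun i => sg * lo i) (fun i => sg * hi i + (sg - 1)) ≤ sg * (dist1 lo hi + 3) := by
  have hs := sg_pos
  have key : ∀ i, (sg * lo i - (sg * hi i + (sg - 1))) + ((sg * hi i + (sg - 1)) - sg * lo i) ≤ sg * ((lo i - hi i) + (hi i - lo i) + 1) := by
    intro i
    obtain ⟨m, hm⟩ := Nat.exists_eq_add_of_le (h i)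
    have e : sg * hi i = sg * lo i + sg * m := by rw [hm]; ring
    have e2 : sg * ((lo i - hi i) + (hi i - lo i) + 1) = sg * m + sg := by
      rw [show lo i - hi i + (hi i - lo i) + 1 = m + 1 by omega]; ring
    omega
  have k0 := key 0
  have k1 := key 1
  have k2 := key 2
  simp only [dist1, Fin.sum_univ_three, mul_add, mul_one] at *
  omega

lemma dist1_inB {lo hi a b : Site} (h1 : inB lo hi a) (h2 : inB lo hi b) (h : dist1 lo hi ≤ 20) : dist1 a b ≤ 23 * sg := by
  have hlh : lo ≤ hi := h1.1.trans h1.2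
  rw [inB_iff] at h1 h2
  refine (dist1_le_of_box h1.1 h1.2 h2.1 h2.2).trans ((dist1_scale hlh).trans ?_)
  rw [mul_comm]; gcongr; omega

lemma boxlem_sq (g : Site → ℝ) (lo hi : Site) (c X : ℝ) (hc : 0 < c) (hX : 0 ≤ X) (N : ℕ)
    (h : ∀ a d, lo ≤ a → a + ev d ≤ hi → c * (g a - g (a + ev d))^2 ≤ X) (a b : Site)
    (h1 : lo ≤ a) (h2 : a ≤ hi) (h3 : lo ≤ b) (h4 : b ≤ hi) (hN : dist1 a b ≤ N) : c * (g a - g b)^2 ≤ N^2 * X := by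
  have key := boxlem g lo hi (Real.sqrt (X / c)) ?_ a b h1 h2 h3 h4
  · have h5 : |g a - g b| ≤ Real.sqrt (X/c) * N := key.trans (by gcongr)
    have h6 : (g a - g b)^2 ≤ (X/c) * N^2 := by
      rw [← sq_abs]
      calc _ ≤ (Real.sqrt (X/c) * N)^2 := by gcongr
        _ = _ := by rw [mul_pow, Real.sq_sqrt (by positivity)]
    calc c * (g a - g b)^2 ≤ c * ((X/c) * N^2) := by gcongr
      _ = _ := by field_simp
  · intro a d ha hd
    apply Real.abs_le_sqrt
    rw [le_div_iff₀ hc, mul_comm]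
    exact h a d ha hd

section CBsec
variable {l : Lev} {k : ℕ} {t : Fld} {R : ℝ} {D : Finset Edge} {lo hi : Site}

lemma inB_of {a : Site} {d : Fin 3} (h1 : (fun i => sg * lo i) ≤ a) (h2 : a + ev d ≤ (fun i => sg * hi i + (sg - 1))) :
    inB lo hi a ∧ inB lo hi (a + ev d) := by
  rw [inB_iff, inB_iff]
  have h3 : a ≤ a + ev d := by simp
  exact ⟨⟨h1, h3.trans h2⟩, h1.trans h3, h2⟩

lemma CB.T (hG : GB l k t R) (hC : CB l k D lo hi) (hd : dist1 lo hi ≤ 20) {a b : Site} (ha : inB lo hi a) (hb : inB lo hi b) :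
    |l.T a - l.T b| ≤ 1 / 1000 := by
  have h := boxlem l.T _ _ al (fun a d h1 h2 => by
    obtain ⟨h3, h4⟩ := inB_of (lo := lo) (hi := hi) h1 h2
    exact (hG _ (hC a d h3 h4).1).1) a b (inB_iff.1 ha).1 (inB_iff.1 ha).2 (inB_iff.1 hb).1 (inB_iff.1 hb).2
  have h2 : (dist1 a b : ℝ) ≤ 23 * sg := by exact_mod_cast dist1_inB ha hb hd
  have h3 := al_sg
  have := al_pos
  calc _ ≤ _ := h
    _ ≤ al * (23 * sg) := by gcongr
    _ ≤ _ := by nlinarith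

lemma CB.step (hR : 0 ≤ R) (hG : GB l k t R) (hC : CB l k D lo hi) (hd : dist1 lo hi ≤ 20) {a0 a : Site} {d : Fin 3} (h0 : inB lo hi a0)
    (ha : inB lo hi a) (ha' : inB lo hi (a + ev d)) (v : Fld) :
    Real.exp (2 * l.T a0) * (l.A v a - l.A v (a + ev d))^2 ≤ 2 * R * En (domE k (a, d)) t v := by
  have h1 := (hG _ (hC a d ha ha').1).2 v
  have h2 := abs_le.1 (hC.T hG hd h0 ha)
  have h3 := abs_le.1 (hC.T hG hd h0 ha')
  have h4 : Real.exp (2 * l.T a0) ≤ 2 * Real.exp (2 * min (l.T a) (l.T (a + ev d))) := by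
    have h5 : l.T a0 - 1/1000 ≤ min (l.T a) (l.T (a + ev d)) := by rw [le_min_iff]; constructor <;> linarith
    have h6 : Real.exp (1/500) ≤ 2 := by
      have := Real.exp_bound_div_one_sub_of_interval (x := 1/500) (by norm_num) (by norm_num)
      refine this.trans (by norm_num)
    calc Real.exp (2 * l.T a0) ≤ Real.exp (1/500 + 2 * min (l.T a) (l.T (a + ev d))) := by
          apply Real.exp_le_exp.2; linarith
      _ ≤ _ := by rw [Real.exp_add]; gcongr
  simp only at h1
  calc _ ≤ (2 * Real.exp (2 * min (l.T a) (l.T (a + ev d)))) * (l.A v a - l.A v (a + ev d))^2 := by gcongr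
    _ ≤ _ := by nlinarith

lemma CB.A (hR : 0 ≤ R) (hG : GB l k t R) (hC : CB l k D lo hi) (hd : dist1 lo hi ≤ 20) {a0 a b : Site} (h0 : inB lo hi a0)
    (ha : inB lo hi a) (hb : inB lo hi b) (v : Fld) :
    Real.exp (2 * l.T a0) * (l.A v a - l.A v b)^2 ≤ (2000 * (sg:ℝ)^2) * (R * En D t v) := by
  have hE := En_nonneg D t v
  have h := boxlem_sq (l.A v) _ _ (Real.exp (2 * l.T a0)) (2 * R * En D t v) (Real.exp_pos _) (by positivity) (23 * sg)
    (fun a d h1 h2 => by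
      obtain ⟨h3, h4⟩ := inB_of (lo := lo) (hi := hi) h1 h2
      refine (hC.step hR hG hd h0 h3 h4 v).trans ?_
      have := En_mono (hC a d h3 h4).2 t v
      gcongr) a b (inB_iff.1 ha).1 (inB_iff.1 ha).2 (inB_iff.1 hb).1 (inB_iff.1 hb).2 (dist1_inB ha hb hd)
  refine h.trans ?_
  push_cast
  have : 0 ≤ (sg:ℝ)^2 * (R * En D t v) := by positivity
  nlinarith

lemma CB.avg (hR : 0 ≤ R) (hG : GB l k t R) (hC : CB l k D lo hi) (hd : dist1 lo hi ≤ 20) {a0 b b' : Site} (h0 : inB lo hi a0)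
    (hb : lo ≤ b ∧ b ≤ hi) (hb' : lo ≤ b' ∧ b' ≤ hi) (v : Fld) :
    Real.exp (2 * l.T a0) * (avg (l.A v) b - avg (l.A v) b')^2 ≤ (1600 / (sg:ℝ)) * (R * En D t v) := by
  have hE := En_nonneg D t v
  have hs := sgR_pos
  have h := boxlem_sq (_root_.avg (l.A v)) lo hi (Real.exp (2 * l.T a0)) ((4/sg) * (R * En D t v)) (Real.exp_pos _) (by positivity) 20
    (fun b d h1 h2 => by
      set U := (sbc b ∪ sbc (b + ev d)).filter (fun a => a + ev d ∈ sbc b ∪ sbc (b + ev d)) with hU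
      have hmem : ∀ a, a ∈ sbc b ∪ sbc (b + ev d) → inB lo hi a := by
        intro a ha
        have h3 : b ≤ b + ev d := by simp
        rcases Finset.mem_union.1 ha with h | h <;> rw [mem_sbc'] at h <;> unfold inB <;> rw [h]
        · exact ⟨h1, h3.trans h2⟩
        · exact ⟨h1.trans h3, h2⟩
      have hstep := avg_step (l.A v) b d U (by
        have key : ∀ a ∈ sbc b, ∀ i ≤ sg, a + i • ev d ∈ sbc b ∪ sbc (b + ev d) := by
          intro a ha i hi
          rw [Finset.mem_union, mem_sub, mem_sub]
          rw [mem_sub] at ha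
          by_cases hc : a d + i < sg * (b d + 1)
          · left; intro j
            have := ha j
            by_cases hj : j = d
            · subst hj; simp [ev_apply]; omega
            · simpa [ev_apply, hj] using this
          · right; intro j
            have := ha j
            by_cases hj : j = d
            · subst hj; simp [ev_apply]
              have e2 : sg * (b j + 1 + 1) = sg * (b j + 1) + sg := by ring
              omega
            · simpa [ev_apply, hj] using this
        intro a ha i hi
        rw [hU, Finset.mem_filter]
        refine ⟨key a ha i hi.le, ?_⟩
        have := key a ha (i+1) hi
        rwa [succ_nsmul, ← add_assoc] at this)
      calc _ ≤ Real.exp (2 * l.T a0) * ((1 / sg) * ∑ a ∈ U, (l.A v a - l.A v (a + ev d))^2) := by gcongr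
        _ = (1 / sg) * ∑ a ∈ U, Real.exp (2 * l.T a0) * (l.A v a - l.A v (a + ev d))^2 := by
          rw [← Finset.mul_sum]; ring
        _ ≤ (1 / sg) * ∑ a ∈ U, 2 * R * En (domE k (a, d)) t v := by
          refine mul_le_mul_of_nonneg_left (Finset.sum_le_sum fun a ha => ?_) (by positivity)
          rw [hU, Finset.mem_filter] at ha
          exact hC.step hR hG hd h0 (hmem _ ha.1) (hmem _ ha.2) v
        _ ≤ (1 / sg) * (2 * R * (2 * En D t v)) := by
          rw [← Finset.mul_sum]
          have := sum_domE_le k d U D (fun a ha => by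
            rw [hU, Finset.mem_filter] at ha
            exact (hC a d (hmem _ ha.1) (hmem _ ha.2)).2) t v
          gcongr
        _ = _ := by ring) b b' hb.1 hb.2 hb'.1 hb'.2 ((dist1_le_of_box hb.1 hb.2 hb'.1 hb'.2).trans hd)
  refine h.trans (le_of_eq ?_)
  push_cast
  ring
end CBsec
end

end PartB2

section PartB3
open scoped BigOperators Classical ENNReal
open MeasureTheory Matrix
noncomputable section

lemma sidx_rep (b : Site) {o : ℕ} (ho : o < 3) : sidx (rep b o) = b := by
  funext i
  have hs : 3 < sg := by rw [sg_eq]; norm_num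
  have : (if i = 0 then o else 0) < sg := by split_ifs <;> omega
  simp only [sidx, rep]
  rw [Nat.mul_add_div sg_pos, Nat.div_eq_of_lt this]; simp

lemma domE_sub_cellE {k : ℕ} {a : Site} {d : Fin 3} {Q : Site} (h1 : anc 1 a = Q) (h2 : anc 1 (a + ev d) = Q) : domE k (a, d) ⊆ cellE (k+1) Q := by
  intro f hf
  rw [mem_domE] at hf
  rw [mem_cellE, anc_succ k, anc_succ k]
  obtain ⟨h3, h4⟩ := hf
  constructor
  · rcases h3 with h | h <;> rw [h] <;> assumption
  · rcases h4 with h | h <;> rw [h] <;> assumption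

lemma domE_sub_domE {k : ℕ} {a : Site} {d : Fin 3} {e : Edge} (h1 : a ∈ dmS e) (h2 : a + ev d ∈ dmS e) : domE k (a, d) ⊆ domE (k+1) e := by
  intro f hf
  rw [mem_domE] at hf ⊢
  rw [anc_succ k, anc_succ k]
  obtain ⟨h3, h4⟩ := hf
  constructor
  · rcases h3 with h | h <;> rw [h] <;> assumption
  · rcases h4 with h | h <;> rw [h] <;> assumption

lemma cellE_sub_domE (k : ℕ) (e : Edge) : cellE k e.1 ⊆ domE k e ∧ cellE k (e.1 + ev e.2) ⊆ domE k e := by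
  constructor <;> intro f hf <;> rw [mem_cellE] at hf <;> rw [mem_domE] <;> simp [hf]

lemma OK.mono {bad : Edge → Prop} {S S' : Set Site} (h : OK bad S) (hs : S' ⊆ S) : OK bad S' :=
  fun e f he hf h1 h2 => h e f he hf ⟨hs h1.1, hs h1.2⟩ ⟨hs h2.1, hs h2.2⟩

lemma med_near {a b c x δ : ℝ} (h1 : |a - x| ≤ δ) (h2 : |b - x| ≤ δ) (h3 : |c - x| ≤ δ) : |med a b c - x| ≤ δ := by
  rw [abs_le] at *
  unfold med
  constructor
  · have : x - δ ≤ min a b := by rw [le_min_iff]; constructor <;> linarith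
    have := le_max_left (min a b) (min (max a b) c)
    linarith
  · have : max (min a b) (min (max a b) c) ≤ x + δ := by
      rw [max_le_iff]
      constructor
      · exact (min_le_left _ _).trans (by linarith)
      · exact (min_le_right _ _).trans (by linarith)
    linarith

def hiB (bad : Edge → Prop) (Q : Site) : Site := fun i => 3 * Q i + (if i = 0 then cc bad Q else 2)

lemma chS_of {lo hi Q a : Site} (h1 : ∀ i, 3 * Q i ≤ lo i) (h2 : ∀ i, hi i ≤ 3 * Q i + 2) (h : inB lo hi a) : a ∈ chS Q := by
  show anc 1 a = Q
  rw [anc1_eq]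
  funext i
  have := h.1 i; have := h.2 i; have := h1 i; have := h2 i
  simp only at *
  omega

lemma CB_B1 {l : Lev} (k : ℕ) {Q : Site} (h : OK l.bad (chS Q)) : CB l k (cellE (k+1) Q) (kap l.bad Q) (hiB l.bad Q) := by
  have hc := cc_lt l.bad Q
  have key : ∀ a, inB (kap l.bad Q) (hiB l.bad Q) a → a ∈ chS Q := fun a => chS_of (fun i => by simp only [kap]; omega) (fun i => by simp only [hiB]; split_ifs <;> omega)
  have key2 : ∀ a, inB (kap l.bad Q) (hiB l.bad Q) a → a ∈ slab 0 (3 * Q 0 + cc l.bad Q) := by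
    intro a ha
    have h1 := ha.1 0; have h2 := ha.2 0
    simp only [kap, hiB, if_true, sidx] at h1 h2
    exact le_antisymm h2 h1
  intro a d h1 h2
  refine ⟨fun hb => cc_spec h (a,d) hb ⟨key _ h1, key _ h2⟩ ⟨key2 _ h1, key2 _ h2⟩, domE_sub_cellE (key _ h1) (key _ h2)⟩

lemma CB.mono {l : Lev} {k : ℕ} {D D' : Finset Edge} {lo hi : Site} (h : CB l k D lo hi) (hD : D ⊆ D') : CB l k D' lo hi :=
  fun a d h1 h2 => ⟨(h a d h1 h2).1, (h a d h1 h2).2.trans hD⟩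

lemma d_B1 (l : Lev) (Q : Site) : dist1 (kap l.bad Q) (hiB l.bad Q) ≤ 20 := by
  simp only [dist1, Fin.sum_univ_three, kap, hiB]
  simp

lemma kap_B1 (l : Lev) (Q : Site) : kap l.bad Q ≤ hiB l.bad Q := by
  intro i; simp only [kap, hiB]; split_ifs <;> omega

section F
variable {l : Lev} {k : ℕ} {t : Fld} {R : ℝ}

/-- T_Q is close to T at every point of its slab -/
lemma TQ_near (hG : GB l k t R) {Q : Site} (h : OK l.bad (chS Q)) {a : Site} (ha : inB (kap l.bad Q) (hiB l.bad Q) a) :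
    |(stepL l).T Q - l.T a| ≤ 1/1000 := by
  have hC := CB_B1 k h
  have key : ∀ o < 3, |l.T (rep (kap l.bad Q) o) - l.T a| ≤ 1/1000 := fun o ho =>
    hC.T hG (d_B1 l Q) ⟨by rw [sidx_rep _ ho], by rw [sidx_rep _ ho]; exact kap_B1 l Q⟩ ha
  exact med_near (key 0 (by norm_num)) (key 1 (by norm_num)) (key 2 (by norm_num))

lemma exp_le_two {x y : ℝ} (h : |x - y| ≤ 1/1000) : Real.exp (2 * x) ≤ 2 * Real.exp (2 * y) := by
  have h6 : Real.exp (1/500) ≤ 2 := by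
    have := Real.exp_bound_div_one_sub_of_interval (x := 1/500) (by norm_num) (by norm_num)
    refine this.trans (by norm_num)
  have := (abs_le.1 h).2
  calc Real.exp (2 * x) ≤ Real.exp (1/500 + 2 * y) := by apply Real.exp_le_exp.2; linarith
    _ ≤ _ := by rw [Real.exp_add]; gcongr

set_option maxHeartbeats 2000000 in
lemma F3 (hR : 0 ≤ R) (hG : GB l k t R) (e : Edge) (h : OK l.bad (dmS e)) :
    |(stepL l).T e.1 - (stepL l).T (e.1 + ev e.2)| ≤ 1/100 ∧
    ∀ v, Real.exp (2 * min ((stepL l).T e.1) ((stepL l).T (e.1 + ev e.2))) * ((stepL l).A v e.1 - (stepL l).A v (e.1 + ev e.2))^2 ≤ (R/64) * En (domE (k+1) e) t v := by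
  obtain ⟨Q, d⟩ := e
  simp only
  set Q' := Q + ev d with hQ'
  obtain ⟨f, hf0, hfd⟩ : ∃ f : Fin 3, f ≠ 0 ∧ f ≠ d := by fin_cases d <;> decide
  obtain ⟨w, hw, hwc⟩ := cleanslab h f (Q f)
  have hO : OK l.bad (chS Q) := h.mono fun a ha => Or.inl ha
  have hO' : OK l.bad (chS Q') := h.mono fun a ha => Or.inr ha
  have hc := cc_lt l.bad Q
  have hc' := cc_lt l.bad Q'
  have hQi : ∀ i, Q' i = Q i + (if i = d then 1 else 0) := fun i => by rw [hQ', Pi.add_apply, ev_apply]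
  set X : Site := fun i => 3 * Q i + (if i = 0 then cc l.bad Q else if i = f then w else 0) with hX
  set X' : Site := fun i => 3 * Q' i + (if i = 0 then cc l.bad Q' else if i = f then w else 0) with hX'
  set lo : Site := fun i => 3 * Q i + (if i = f then w else 0) with hlo
  set hi : Site := fun i => 3 * Q i + (if i = f then w else if i = d then 5 else 2) with hhi
  have hB2 : CB l k (domE (k+1) (Q, d)) lo hi := by
    have key : ∀ a, inB lo hi a → a ∈ dmS (Q, d) ∧ a ∈ slab f (3 * Q f + w) := by
      intro a ha
      have h1 : ∀ i, 3 * Q i + (if i = f then w else 0) ≤ sidx a i := ha.1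
      have h2 : ∀ i, sidx a i ≤ 3 * Q i + (if i = f then w else if i = d then 5 else 2) := ha.2
      constructor
      · show anc 1 a = Q ∨ anc 1 a = Q'
        rw [anc1_eq]
        by_cases hd : sidx a d / 3 = Q d
        · left; funext i
          have h1i := h1 i; have h2i := h2 i
          by_cases hid : i = d
          · rw [hid]; exact hd
          · rw [if_neg hid] at h2i; split_ifs at h1i h2i <;> omega
        · right; funext i
          have h1i := h1 i; have h2i := h2 i
          rw [hQi]
          by_cases hid : i = d
          · rw [if_pos hid] at *; subst hid; split_ifs at h1i h2i <;> omega
          · rw [if_neg hid] at *; split_ifs at h1i h2i <;> omega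
      · have h1i := h1 f; have h2i := h2 f
        simp only [if_true] at h1i h2i
        exact le_antisymm h2i h1i
    intro a d' h1 h2
    exact ⟨fun hb => hwc _ hb ⟨(key _ h1).1, (key _ h2).1⟩ ⟨(key _ h1).2, (key _ h2).2⟩, domE_sub_domE (key _ h1).1 (key _ h2).1⟩
  have hB1 : CB l k (domE (k+1) (Q, d)) (kap l.bad Q) (hiB l.bad Q) := (CB_B1 k hO).mono (cellE_sub_domE (k+1) (Q,d)).1
  have hB3 : CB l k (domE (k+1) (Q, d)) (kap l.bad Q') (hiB l.bad Q') := (CB_B1 k hO').mono (cellE_sub_domE (k+1) (Q,d)).2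
  have d2 : dist1 lo hi ≤ 20 := by
    simp only [dist1, Fin.sum_univ_three, hlo, hhi]
    split_ifs <;> omega
  have xlo : lo ≤ X ∧ X ≤ hi := by
    constructor <;> intro i <;> simp only [hlo, hhi, hX]
    · split_ifs <;> omega
    · by_cases h0 : i = 0
      · subst h0; rw [if_neg (Ne.symm hf0)]; split_ifs <;> omega
      · split_ifs <;> omega
  have xlo' : lo ≤ X' ∧ X' ≤ hi := by
    constructor <;> intro i <;> simp only [hlo, hhi, hX', hQi]
    · by_cases h0 : i = 0
      · subst h0; rw [if_neg (Ne.symm hf0)]; split_ifs <;> omega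
      · split_ifs <;> omega
    · by_cases h0 : i = 0
      · subst h0; rw [if_neg (Ne.symm hf0)]; split_ifs <;> omega
      · by_cases h1 : i = f
        · subst h1; simp [hf0, hfd]
        · split_ifs <;> omega
  have xk : kap l.bad Q ≤ X ∧ X ≤ hiB l.bad Q := by
    constructor <;> intro i <;> simp only [kap, hiB, hX] <;> split_ifs <;> omega
  have xk' : kap l.bad Q' ≤ X' ∧ X' ≤ hiB l.bad Q' := by
    constructor <;> intro i <;> simp only [kap, hiB, hX'] <;> split_ifs <;> omega
  have hr : ∀ (lo hi b : Site), lo ≤ b ∧ b ≤ hi → inB lo hi (rep b 0) := fun lo hi b hb => by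
    unfold inB; rw [sidx_rep _ (by norm_num)]; exact hb
  have t1 := TQ_near hG hO (hr _ _ _ xk)
  have t3 := TQ_near hG hO' (hr _ _ _ xk')
  have t2 := hB2.T hG d2 (hr _ _ _ xlo) (hr _ _ _ xlo')
  constructor
  · rw [abs_le] at *; constructor <;> linarith
  intro v
  have v1 := hB1.avg hR hG (d_B1 l Q) (hr _ _ _ xk) ⟨le_refl _, kap_B1 l Q⟩ xk v
  have v2 := hB2.avg hR hG d2 (hr _ _ _ xlo) xlo xlo' v
  have v3 := hB3.avg hR hG (d_B1 l Q') (hr _ _ _ xk') xk' ⟨le_refl _, kap_B1 l Q'⟩ v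
  have hE := En_nonneg (domE (k+1) (Q,d)) t v
  have hA : (stepL l).A v Q = avg (l.A v) (kap l.bad Q) := rfl
  have hA' : (stepL l).A v Q' = avg (l.A v) (kap l.bad Q') := rfl
  rw [hA, hA']
  have m1 : Real.exp (2 * min ((stepL l).T Q) ((stepL l).T Q')) ≤ 2 * Real.exp (2 * l.T (rep X 0)) :=
    (Real.exp_le_exp.2 (by linarith [min_le_left ((stepL l).T Q) ((stepL l).T Q')])).trans (exp_le_two t1)
  have m2 : Real.exp (2 * min ((stepL l).T Q) ((stepL l).T Q')) ≤ 2 * Real.exp (2 * l.T (rep X' 0)) :=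
    (Real.exp_le_exp.2 (by linarith [min_le_right ((stepL l).T Q) ((stepL l).T Q')])).trans (exp_le_two t3)
  set μ := Real.exp (2 * min ((stepL l).T Q) ((stepL l).T Q')) with hμ
  have hμ0 : 0 < μ := Real.exp_pos _
  set p := avg (l.A v) (kap l.bad Q)
  set q := avg (l.A v) X
  set r := avg (l.A v) X'
  set s := avg (l.A v) (kap l.bad Q')
  have key : (p - s)^2 ≤ 3 * ((p-q)^2 + (q-r)^2 + (r-s)^2) := by nlinarith [sq_nonneg ((p-q)-(q-r)), sq_nonneg ((q-r)-(r-s)), sq_nonneg ((p-q)-(r-s))]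
  set Y := R * En (domE (k+1) (Q,d)) t v with hY
  have hY0 : 0 ≤ Y := by positivity
  have w1 : μ * (p-q)^2 ≤ 2 * ((1600 / (sg:ℝ)) * Y) := by nlinarith [mul_le_mul_of_nonneg_right m1 (sq_nonneg (p-q))]
  have w2 : μ * (q-r)^2 ≤ 2 * ((1600 / (sg:ℝ)) * Y) := by nlinarith [mul_le_mul_of_nonneg_right m1 (sq_nonneg (q-r))]
  have w3 : μ * (r-s)^2 ≤ 2 * ((1600 / (sg:ℝ)) * Y) := by nlinarith [mul_le_mul_of_nonneg_right m2 (sq_nonneg (r-s))]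
  have hs : (sg:ℝ) = 10000000 := by rw [sg_eq]; norm_num
  rw [hs] at w1 w2 w3
  calc μ * (p-s)^2 ≤ μ * (3 * ((p-q)^2 + (q-r)^2 + (r-s)^2)) := by gcongr
    _ ≤ Y / 64 := by nlinarith
    _ = _ := by rw [hY]; ring

lemma GB_step (hR : 0 ≤ R) (hG : GB l k t R) : GB (stepL l) (k+1) t (R/64) := by
  intro e he
  rw [stepL_bad] at he
  push Not at he
  exact ⟨he.2, (F3 hR hG e he.1).2⟩

end F
end

end PartB3

section PartB4
open scoped BigOperators Classical ENNReal
open MeasureTheory Matrix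
noncomputable section

def lev (t : Fld) : ℕ → Lev
  | 0 => ⟨t, fun e => al < |t e.1 - t (e.1 + ev e.2)|, id⟩
  | k+1 => stepL (lev t k)

def TT (t : Fld) (k : ℕ) (Q : Site) : ℝ := (lev t k).T Q
def BB (t : Fld) (k : ℕ) (e : Edge) : Prop := (lev t k).bad e
def AA (t : Fld) (k : ℕ) (v : Fld) (Q : Site) : ℝ := (lev t k).A v Q

lemma TT_zero (t : Fld) (Q : Site) : TT t 0 Q = t Q := rfl
lemma AA_zero (t : Fld) (v : Fld) (Q : Site) : AA t 0 v Q = v Q := rfl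

lemma GB_lev (t : Fld) (k : ℕ) : GB (lev t k) k t ((1/64)^k) := by
  induction k with
  | zero =>
    intro e he
    have he' : ¬ al < |t e.1 - t (e.1 + ev e.2)| := he
    refine ⟨not_lt.1 he', fun v => ?_⟩
    show Real.exp (2 * min (t e.1) (t (e.1 + ev e.2))) * (v e.1 - v (e.1 + ev e.2))^2 ≤ _
    have h1 : En {e} t v ≤ En (domE 0 e) t v := En_mono (by
      intro f hf; rw [Finset.mem_singleton] at hf; subst hf; rw [mem_domE]; simp [anc_zero]) t v
    rw [pow_zero, one_mul]
    refine le_trans ?_ h1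
    rw [En, Finset.sum_singleton]
    have := min_le_left (t e.1) (t (e.1 + ev e.2))
    have := min_le_right (t e.1) (t (e.1 + ev e.2))
    gcongr
    linarith
  | succ k ih =>
    have := GB_step (by positivity) ih
    rw [pow_succ, show ((1:ℝ)/64)^k * (1/64) = (1/64)^k / 64 by ring]
    exact this

def valid (t : Fld) : ℕ → Site → Prop
  | 0, _ => True
  | k+1, Q => OK (BB t k) (chS Q)

lemma BB_succ (t : Fld) (k : ℕ) (e : Edge) : BB t (k+1) e ↔ ¬ OK (BB t k) (dmS e) ∨ al < |TT t (k+1) e.1 - TT t (k+1) (e.1 + ev e.2)| := Iff.rfl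

lemma BB_zero (t : Fld) (e : Edge) : BB t 0 e ↔ al < |t e.1 - t (e.1 + ev e.2)| := Iff.rfl

lemma valid_of_OK {t : Fld} {k : ℕ} {e : Edge} (h : OK (BB t k) (dmS e)) : valid t (k+1) e.1 ∧ valid t (k+1) (e.1 + ev e.2) :=
  ⟨h.mono fun _ ha => Or.inl ha, h.mono fun _ ha => Or.inr ha⟩

lemma valid_of_not_BB {t : Fld} {k : ℕ} {e : Edge} (h : ¬ BB t k e) : valid t k e.1 ∧ valid t k (e.1 + ev e.2) := by
  cases k with
  | zero => exact ⟨trivial, trivial⟩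
  | succ k => rw [BB_succ] at h; push Not at h; exact valid_of_OK h.1

/-- `a` is a level-`k` cell in the core of the valid level-`k+1` cell `Q` -/
def Core (t : Fld) (k : ℕ) (Q a : Site) : Prop := valid t (k+1) Q ∧ anc 1 a = Q ∧
  (sidx a = kap (BB t k) Q ∨ ∀ e, BB t k e → ¬ inS (chS Q) e)

def Cs : ℝ := 4000 * (sg:ℝ)^2
lemma Cs_pos : 0 < Cs := by have := sgR_pos; unfold Cs; positivity

lemma avg_near (f : Site → ℝ) (B : Site) (x c Y : ℝ) (hc : 0 ≤ c) (h : ∀ b ∈ sbc B, c * (x - f b)^2 ≤ Y) : c * (x - avg f B)^2 ≤ Y := by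
  have hs := sgR_pos
  have hcard : ((sbc B).card : ℝ) = (sg:ℝ)^3 := by rw [card_sub]; push_cast; ring
  have h1 : x - avg f B = (∑ b ∈ sbc B, (x - f b)) / (sg:ℝ)^3 := by
    rw [Finset.sum_sub_distrib, Finset.sum_const, nsmul_eq_mul, hcard, avg]; field_simp
  have h2 := sq_sum_le_card_mul_sum_sq (s := sbc B) (f := fun b => x - f b)
  rw [hcard] at h2
  have h3 : ∑ b ∈ sbc B, c * (x - f b)^2 ≤ (sg:ℝ)^3 * Y := by
    calc _ ≤ ∑ b ∈ sbc B, Y := Finset.sum_le_sum h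
      _ = _ := by rw [Finset.sum_const, nsmul_eq_mul, hcard]
  rw [← Finset.mul_sum] at h3
  rw [h1, div_pow, ← mul_div_assoc, div_le_iff₀ (by positivity)]
  calc _ ≤ c * ((sg:ℝ)^3 * ∑ b ∈ sbc B, (x - f b)^2) := by gcongr
    _ = (sg:ℝ)^3 * (c * ∑ b ∈ sbc B, (x - f b)^2) := by ring
    _ ≤ (sg:ℝ)^3 * ((sg:ℝ)^3 * Y) := by gcongr
    _ = _ := by ring

lemma F12 {t : Fld} {k : ℕ} {Q a : Site} (h : Core t k Q a) : |TT t k a - TT t (k+1) Q| ≤ 1/100 ∧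
    ∀ v, Real.exp (2 * TT t (k+1) Q) * (AA t k v a - AA t (k+1) v Q)^2 ≤ Cs * ((1/64)^k * En (cellE (k+1) Q) t v) := by
  have hG := GB_lev t k
  obtain ⟨hO, h1, h2⟩ := h
  obtain ⟨lo, hi, hC, hd, hk, ha⟩ : ∃ lo hi, CB (lev t k) k (cellE (k+1) Q) lo hi ∧ dist1 lo hi ≤ 20 ∧ (lo ≤ kap (BB t k) Q ∧ kap (BB t k) Q ≤ hi) ∧ inB lo hi a := by
    rcases h2 with h2 | h2
    · refine ⟨_, _, CB_B1 k hO, d_B1 _ Q, ⟨le_refl _, kap_B1 _ Q⟩, ?_⟩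
      unfold inB; rw [h2]; exact ⟨le_refl _, kap_B1 _ Q⟩
    · refine ⟨fun i => 3 * Q i, fun i => 3 * Q i + 2, ?_, ?_, ?_, ?_⟩
      · have key : ∀ a, inB (fun i => 3 * Q i) (fun i => 3 * Q i + 2) a → a ∈ chS Q := fun a => chS_of (fun i => le_refl _) (fun i => le_refl _)
        exact fun a d ha ha' => ⟨fun hb => h2 _ hb ⟨key _ ha, key _ ha'⟩, domE_sub_cellE (key _ ha) (key _ ha')⟩
      · simp only [dist1, Fin.sum_univ_three]; omega
      · have := cc_lt (BB t k) Q
        constructor <;> intro i <;> simp only [kap] <;> split_ifs <;> omega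
      · rw [anc1_eq] at h1
        constructor <;> intro i <;> have := congrFun h1 i <;> simp only at * <;> omega
  have hT : |TT t k a - TT t (k+1) Q| ≤ 1/1000 := by
    rw [abs_sub_comm]
    have key : ∀ o < 3, |(lev t k).T (rep (kap (BB t k) Q) o) - (lev t k).T a| ≤ 1/1000 := fun o ho =>
      hC.T hG hd (by unfold inB; rw [sidx_rep _ ho]; exact hk) ha
    exact med_near (key 0 (by norm_num)) (key 1 (by norm_num)) (key 2 (by norm_num))
  refine ⟨hT.trans (by norm_num), fun v => ?_⟩
  rw [abs_sub_comm] at hT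
  have h3 := exp_le_two hT
  have h4 := avg_near ((lev t k).A v) (kap (BB t k) Q) (AA t k v a) (Real.exp (2 * TT t k a)) _ (Real.exp_pos _).le (fun b hb => by
    rw [mem_sbc'] at hb
    exact hC.A (by positivity) hG hd ha ha (by unfold inB; rw [hb]; exact hk) v)
  have h5 : AA t (k+1) v Q = avg ((lev t k).A v) (kap (BB t k) Q) := rfl
  rw [← h5] at h4
  calc _ ≤ (2 * Real.exp (2 * TT t k a)) * (AA t k v a - AA t (k+1) v Q)^2 := by gcongr
    _ ≤ 2 * ((2000 * (sg:ℝ)^2) * ((1/64)^k * En (cellE (k+1) Q) t v)) := by rw [mul_assoc]; gcongr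
    _ = _ := by unfold Cs; ring

def chd (Q : Site) (c o : ℕ) : Site := rep (fun i => 3 * Q i + (if i = 0 then c else 0)) o

lemma chd_kap (bad : Edge → Prop) (Q : Site) (o : ℕ) : chd Q (cc bad Q) o = rep (kap bad Q) o := rfl

lemma sidx_chd (Q : Site) (c : ℕ) {o : ℕ} (ho : o < 3) : sidx (chd Q c o) = fun i => 3 * Q i + (if i = 0 then c else 0) := sidx_rep _ ho

lemma anc_chd (Q : Site) {c o : ℕ} (hc : c < 3) (ho : o < 3) : anc 1 (chd Q c o) = Q := by
  rw [anc1_eq, sidx_chd Q c ho]; funext i; simp only; split_ifs <;> omega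

lemma Core_chd {t : Fld} {k : ℕ} {Q : Site} (h : valid t (k+1) Q) {o : ℕ} (ho : o < 3) : Core t k Q (chd Q (cc (BB t k) Q) o) :=
  ⟨h, anc_chd Q (cc_lt _ _) ho, Or.inl (sidx_rep _ ho)⟩

lemma rep_succ (b : Site) (o : ℕ) : rep b o + ev 0 = rep b (o+1) := by
  funext i; simp only [rep, Pi.add_apply, ev_apply]; split_ifs <;> omega

lemma valid_chd {t : Fld} {k : ℕ} {Q : Site} (h : valid t (k+1) Q) {o : ℕ} (ho : o < 3) : valid t k (chd Q (cc (BB t k) Q) o) := by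
  have hC := CB_B1 k h
  have key : ∀ o < 3, inB (kap (BB t k) Q) (hiB (BB t k) Q) (rep (kap (BB t k) Q) o) := fun o ho => by
    unfold inB; rw [sidx_rep _ ho]; exact ⟨le_refl _, kap_B1 _ Q⟩
  have h2 : ∀ o < 2, valid t k (rep (kap (BB t k) Q) o) ∧ valid t k (rep (kap (BB t k) Q) (o+1)) := by
    intro o ho
    have := valid_of_not_BB (hC (rep (kap (BB t k) Q) o) 0 (key o (by omega)) (by rw [rep_succ]; exact key (o+1) (by omega))).1
    simpa only [rep_succ] using this
  rw [chd_kap]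
  interval_cases o
  · exact (h2 0 (by norm_num)).1
  · exact (h2 0 (by norm_num)).2
  · exact (h2 1 (by norm_num)).2

lemma med_two (f : ℕ → ℝ) (s : ℝ) (hs : s = 1 ∨ s = -1) : ∃ o < 3, ∃ o' < 3, o ≠ o' ∧ s * med (f 0) (f 1) (f 2) ≤ s * f o ∧ s * med (f 0) (f 1) (f 2) ≤ s * f o' := by
  have key : ∃ o < 3, ∃ o' < 3, o ≠ o' ∧ s * med (f 0) (f 1) (f 2) ≤ s * f o ∧ s * med (f 0) (f 1) (f 2) ≤ s * f o' := by
    generalize h0 : f 0 = a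
    generalize h1 : f 1 = b
    generalize h2 : f 2 = c
    have H : (s * med a b c ≤ s * a ∧ s * med a b c ≤ s * b) ∨ (s * med a b c ≤ s * a ∧ s * med a b c ≤ s * c) ∨ (s * med a b c ≤ s * b ∧ s * med a b c ≤ s * c) := by
      unfold med
      rcases hs with rfl | rfl
      · simp only [one_mul]
        rcases le_total a b with h | h <;> rcases le_total a c with h' | h' <;> rcases le_total b c with h'' | h'' <;> simp [h, h', h'']
      · simp only [neg_mul, one_mul, neg_le_neg_iff]
        rcases le_total a b with h | h <;> rcases le_total a c with h' | h' <;> rcases le_total b c with h'' | h'' <;> simp [h, h', h'']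
    rcases H with H | H | H
    · exact ⟨0, by norm_num, 1, by norm_num, by norm_num, by rw [h0, h1]; exact H⟩
    · exact ⟨0, by norm_num, 2, by norm_num, by norm_num, by rw [h0, h2]; exact H⟩
    · exact ⟨1, by norm_num, 2, by norm_num, by norm_num, by rw [h1, h2]; exact H⟩
  exact key

lemma cellE_disj {k : ℕ} {a b : Site} (h : a ≠ b) : Disjoint (cellE k a) (cellE k b) := by
  rw [Finset.disjoint_left]
  intro e h1 h2
  rw [mem_cellE] at h1 h2
  exact h (h1.1.symm.trans h2.1)

lemma cellE_sub {k : ℕ} {a Q : Site} (h : anc 1 a = Q) : cellE k a ⊆ cellE (k+1) Q := by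
  intro e he
  rw [mem_cellE] at he ⊢
  rw [anc_succ k, anc_succ k, he.1, he.2]; exact ⟨h, h⟩

lemma cellE_sub' {k r : ℕ} {a Q : Site} (h : anc r a = Q) : cellE k a ⊆ cellE (k+r) Q := by
  intro e he
  rw [mem_cellE] at he ⊢
  rw [← anc_add r k, ← anc_add r k, he.1, he.2]; exact ⟨h, h⟩

abbrev LP := List (Site × ℤ)
def shft (s : ℤ) (p : LP) : LP := p.map fun q => (q.1, q.2 + s)

def PatSet : ℕ → Site → Finset LP
  | 0, Q => {[(Q, 0)]}
  | k+1, Q => (Finset.range 3 ×ˢ Finset.range 3 ×ˢ Finset.range 3 ×ˢ Finset.Icc (-1:ℤ) 1 ×ˢ Finset.Icc (-1:ℤ) 1).biUnion fun i =>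
      Finset.image₂ (fun p p' => shft i.2.2.2.1 p ++ shft i.2.2.2.2 p') (PatSet k (chd Q i.1 i.2.1)) (PatSet k (chd Q i.1 i.2.2.1))

lemma PatSet_card (k : ℕ) (Q : Site) : (PatSet k Q).card * 243 ≤ 243 ^ (2^k) := by
  induction k generalizing Q with
  | zero => simp [PatSet]
  | succ k ih =>
    have h1 : ∀ i ∈ (Finset.range 3 ×ˢ Finset.range 3 ×ˢ Finset.range 3 ×ˢ Finset.Icc (-1:ℤ) 1 ×ˢ Finset.Icc (-1:ℤ) 1),
      (Finset.image₂ (fun p p' => shft i.2.2.2.1 p ++ shft i.2.2.2.2 p') (PatSet k (chd Q i.1 i.2.1)) (PatSet k (chd Q i.1 i.2.2.1))).card ≤ 243 ^ (2^k - 1) * 243^(2^k - 1) := by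
      intro i _
      refine (Finset.card_image₂_le _ _ _).trans (Nat.mul_le_mul ?_ ?_)
      all_goals
        have h2 : 2^k = (2^k - 1) + 1 := by have := Nat.one_le_two_pow (n := k); omega
        have := ih (chd Q i.1 i.2.1)
        have := ih (chd Q i.1 i.2.2.1)
        have h7 : 243 ^ (2^k) = 243 ^ (2^k - 1) * 243 := by rw [← pow_succ, ← h2]
        omega
    have h3 := Finset.card_biUnion_le_card_mul _ _ _ h1
    have h4 : (Finset.range 3 ×ˢ Finset.range 3 ×ˢ Finset.range 3 ×ˢ Finset.Icc (-1:ℤ) 1 ×ˢ Finset.Icc (-1:ℤ) 1).card = 243 := by simp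
    rw [h4] at h3
    have h5 : (PatSet (k+1) Q).card ≤ 243 * (243 ^ (2^k - 1) * 243^(2^k - 1)) := h3
    have h6 : 243 * (243 ^ (2^k - 1) * 243^(2^k - 1)) * 243 = 243 ^ (2^(k+1)) := by
      rw [← pow_add, ← pow_succ', ← pow_succ]; congr 1
      have := Nat.one_le_two_pow (n := k)
      rw [pow_succ]; omega
    calc _ ≤ _ := Nat.mul_le_mul_right 243 h5
      _ = _ := h6

def Mc : ℝ := 80 * Cs
lemma Mc_pos : 0 < Mc := by have := Cs_pos; unfold Mc; positivity

def Leaf (s : ℝ) (t : Fld) (k : ℕ) (Q : Site) (c : ℝ) (p : LP) : Prop :=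
  p.length = 2^k ∧ (∀ q ∈ p, s * TT t k Q ≤ s * t q.1 ∧ q.2 = ⌊t q.1⌋ - ⌊TT t k Q⌋ ∧ |t q.1 - TT t k Q| ≤ k / 100) ∧
  ∀ v, (p.map fun q => Real.exp (2 * t q.1) * (v q.1 - AA t k v Q)^2).sum ≤ c * En (cellE k Q) t v

lemma Leaf_lift {s : ℝ} {t : Fld} {k : ℕ} {Q a : Site} {c : ℝ} (hc : 0 ≤ c) {p : LP} (h : Leaf s t k a c p) (hC : Core t k Q a) (hs : s * TT t (k+1) Q ≤ s * TT t k a) :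
    ∃ u ∈ Finset.Icc (-1:ℤ) 1, (∀ q ∈ shft u p, s * TT t (k+1) Q ≤ s * t q.1 ∧ q.2 = ⌊t q.1⌋ - ⌊TT t (k+1) Q⌋ ∧ |t q.1 - TT t (k+1) Q| ≤ (k+1 : ℕ) / 100) ∧
    ∀ v, ((shft u p).map fun q => Real.exp (2 * t q.1) * (v q.1 - AA t (k+1) v Q)^2).sum ≤ (1 + (1/4)^(k+1)) * c * En (cellE k a) t v + (10 * Cs * (1/4)^k) * En (cellE (k+1) Q) t v := by
  obtain ⟨hT, hA⟩ := F12 hC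
  obtain ⟨hl, hp, hv⟩ := h
  have hT' := abs_le.1 hT
  refine ⟨⌊TT t k a⌋ - ⌊TT t (k+1) Q⌋, ?_, ?_, ?_⟩
  · have h1 : ⌊TT t k a⌋ < ⌊TT t (k+1) Q⌋ + 2 := by
      rw [Int.floor_lt]; push_cast; linarith [Int.lt_floor_add_one (TT t (k+1) Q)]
    have h2 : ⌊TT t (k+1) Q⌋ < ⌊TT t k a⌋ + 2 := by
      rw [Int.floor_lt]; push_cast; linarith [Int.lt_floor_add_one (TT t k a)]
    rw [Finset.mem_Icc]; omega
  · intro q hq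
    simp only [shft, List.mem_map] at hq
    obtain ⟨q', hq', rfl⟩ := hq
    obtain ⟨h1, h2, h3⟩ := hp q' hq'
    refine ⟨hs.trans h1, ?_, ?_⟩
    · simp only; rw [h2]; ring
    · simp only
      rw [abs_le] at *; push_cast
      constructor <;> linarith [h3.1, h3.2]
  · intro v
    have hE := En_nonneg (cellE (k+1) Q) t v
    have e1 : ((shft (⌊TT t k a⌋ - ⌊TT t (k+1) Q⌋) p).map fun q => Real.exp (2 * t q.1) * (v q.1 - AA t (k+1) v Q)^2) = p.map fun q => Real.exp (2 * t q.1) * (v q.1 - AA t (k+1) v Q)^2 := by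
      simp [shft]
    rw [e1]
    set A := AA t k v a
    set A' := AA t (k+1) v Q
    set η : ℝ := (1/4)^(k+1) with hη
    have hη0 : 0 < η := by positivity
    have hAv := hA v
    have e2 : (p.map fun q => Real.exp (2 * t q.1) * (v q.1 - A')^2).sum ≤ (p.map fun q => (1 + η) * (Real.exp (2 * t q.1) * (v q.1 - A)^2) + (1 + 1/η) * (Real.exp (k/50) * (Real.exp (2 * TT t (k+1) Q) * (A - A')^2)) * 2).sum := by
      apply List.sum_le_sum
      intro q hq
      obtain ⟨h1, h2, h3⟩ := hp q hq
      have hx : Real.exp (2 * t q.1) ≤ Real.exp (k/50) * Real.exp (2 * TT t (k+1) Q) * 2 := by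
        have : Real.exp (1/50) ≤ 2 := by
          refine (Real.exp_bound_div_one_sub_of_interval (x := 1/50) (by norm_num) (by norm_num)).trans (by norm_num)
        rw [abs_le] at h3
        calc Real.exp (2 * t q.1) ≤ Real.exp (k/50 + 2 * TT t (k+1) Q + 1/50) := by
              apply Real.exp_le_exp.2; linarith [h3.2]
          _ = Real.exp (k/50) * Real.exp (2 * TT t (k+1) Q) * Real.exp (1/50) := by rw [Real.exp_add, Real.exp_add]
          _ ≤ _ := by gcongr
      have hy : (v q.1 - A')^2 ≤ (1 + η) * (v q.1 - A)^2 + (1 + 1/η) * (A - A')^2 := by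
        have : 0 ≤ (η * (v q.1 - A) - (A - A'))^2 / η := by positivity
        have e : (1 + η) * (v q.1 - A)^2 + (1 + 1/η) * (A - A')^2 - (v q.1 - A')^2 = (η * (v q.1 - A) - (A - A'))^2 / η := by field_simp; ring
        linarith
      calc _ ≤ Real.exp (2 * t q.1) * ((1 + η) * (v q.1 - A)^2 + (1 + 1/η) * (A - A')^2) := by gcongr
        _ = (1 + η) * (Real.exp (2 * t q.1) * (v q.1 - A)^2) + (1 + 1/η) * (Real.exp (2 * t q.1) * (A - A')^2) := by ring
        _ ≤ (1 + η) * (Real.exp (2 * t q.1) * (v q.1 - A)^2) + (1 + 1/η) * ((Real.exp (k/50) * Real.exp (2 * TT t (k+1) Q) * 2) * (A - A')^2) := by gcongr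
        _ = _ := by ring
    refine e2.trans ?_
    rw [List.sum_map_add, List.sum_map_mul_left, List.map_const', List.sum_replicate, hl, nsmul_eq_mul]
    have h5 := hv v
    have h6 : ((2^k : ℕ):ℝ) * ((1 + 1/η) * (Real.exp (k/50) * (Real.exp (2 * TT t (k+1) Q) * (A - A')^2)) * 2) ≤ (10 * Cs * (1/4)^k) * En (cellE (k+1) Q) t v := by
      have g1 : 1 + 1/η ≤ 5 * 4^k := by
        rw [hη, _root_.one_div_pow, one_div_one_div, pow_succ]
        have : (1:ℝ) ≤ 4^k := one_le_pow₀ (by norm_num)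
        linarith
      have g2 : Real.exp (k/50) ≤ 2^k := by
        rw [show (k:ℝ)/50 = k * (1/50) by ring, Real.exp_nat_mul]
        gcongr
        refine (Real.exp_bound_div_one_sub_of_interval (x := 1/50) (by norm_num) (by norm_num)).trans (by norm_num)
      have hCs := Cs_pos
      push_cast
      calc (2:ℝ)^k * ((1 + 1/η) * (Real.exp (k/50) * (Real.exp (2 * TT t (k+1) Q) * (A - A')^2)) * 2)
          ≤ 2^k * ((5 * 4^k) * (2^k * (Cs * ((1/64)^k * En (cellE (k+1) Q) t v))) * 2) := by gcongr
        _ = 10 * Cs * ((2 * 4 * 2 * (1/64))^k) * En (cellE (k+1) Q) t v := by simp only [mul_pow]; ring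
        _ = _ := by norm_num
    have : (1 + η) * (p.map fun q => Real.exp (2 * t q.1) * (v q.1 - A)^2).sum ≤ (1 + η) * c * En (cellE k a) t v := by
      rw [mul_assoc]; gcongr
    linarith

def ck (k : ℕ) : ℝ := Mc * (3 - 2 * (1/2)^k)
lemma ck_le (k : ℕ) : ck k ≤ 3 * Mc := by
  have := Mc_pos
  have : (0:ℝ) < (1/2)^k := by positivity
  unfold ck; nlinarith
lemma ck_nonneg (k : ℕ) : 0 ≤ ck k := by
  have := Mc_pos
  have : ((1:ℝ)/2)^k ≤ 1 := pow_le_one₀ (by norm_num) (by norm_num)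
  unfold ck; nlinarith

lemma leaf (s : ℝ) (hs : s = 1 ∨ s = -1) (t : Fld) (k : ℕ) : ∀ Q, valid t k Q → ∃ p ∈ PatSet k Q, Leaf s t k Q (ck k) p := by
  induction k with
  | zero =>
    intro Q _
    refine ⟨[(Q,0)], by simp [PatSet], by simp, ?_, ?_⟩
    · intro q hq
      rw [List.mem_singleton] at hq
      subst hq
      simp [TT_zero]
    · intro v
      have := En_nonneg (cellE 0 Q) t v
      have := ck_nonneg 0
      simp only [List.map_cons, List.map_nil, List.sum_cons, List.sum_nil, AA_zero]
      ring_nf; positivity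
  | succ k ih =>
    intro Q hQ
    set c := cc (BB t k) Q with hc
    obtain ⟨o, ho, o', ho', hne, h1, h2⟩ := med_two (fun o => TT t k (chd Q c o)) s hs
    have hmed : TT t (k+1) Q = med (TT t k (chd Q c 0)) (TT t k (chd Q c 1)) (TT t k (chd Q c 2)) := rfl
    simp only [← hmed] at h1 h2
    obtain ⟨p, hp, hl⟩ := ih _ (valid_chd hQ ho)
    obtain ⟨p', hp', hl'⟩ := ih _ (valid_chd hQ ho')
    obtain ⟨u, hu, a1, a2⟩ := Leaf_lift (ck_nonneg k) hl (Core_chd hQ ho) h1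
    obtain ⟨u', hu', a1', a2'⟩ := Leaf_lift (ck_nonneg k) hl' (Core_chd hQ ho') h2
    refine ⟨shft u p ++ shft u' p', ?_, ?_, ?_, ?_⟩
    · rw [PatSet, Finset.mem_biUnion]
      refine ⟨(c, o, o', u, u'), ?_, Finset.mem_image₂_of_mem hp hp'⟩
      simp only [Finset.mem_product, Finset.mem_range]
      exact ⟨cc_lt _ _, ho, ho', hu, hu'⟩
    · simp [shft, hl.1, hl'.1, pow_succ]; ring
    · intro q hq
      rcases List.mem_append.1 hq with h | h
      · exact a1 q h
      · exact a1' q h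
    · intro v
      have b1 := a2 v
      have b2 := a2' v
      rw [List.map_append, List.sum_append]
      have hd : chd Q c o ≠ chd Q c o' := by
        intro h
        have := congrFun h 0
        simp only [chd, rep, if_true] at this
        omega
      have e1 := En_union (cellE_disj (k := k) hd) t v
      have e2 : En (cellE k (chd Q c o) ∪ cellE k (chd Q c o')) t v ≤ En (cellE (k+1) Q) t v := En_mono (Finset.union_subset (cellE_sub (anc_chd Q (cc_lt _ _) ho)) (cellE_sub (anc_chd Q (cc_lt _ _) ho'))) t v
      rw [e1] at e2
      have hE := En_nonneg (cellE (k+1) Q) t v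
      have hck := ck_nonneg k
      have hM := Mc_pos
      have key : (1 + (1/4)^(k+1)) * ck k + 20 * Cs * (1/4)^k ≤ ck (k+1) := by
        have h3 := ck_le k
        have h4 : ((1:ℝ)/4)^k ≤ (1/2)^k := by gcongr; norm_num
        have h5 : (0:ℝ) < (1/4)^k := by positivity
        have h6 : ck (k+1) = ck k + Mc * (1/2)^k := by unfold ck; rw [pow_succ]; ring
        have h7 : Cs = Mc / 80 := by unfold Mc; ring
        have h8 : ((1:ℝ)/4)^k * ck k ≤ (1/4)^k * (3 * Mc) := by gcongr
        have h9 : Mc * (1/4)^k ≤ Mc * (1/2)^k := by gcongr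
        rw [h6, h7, pow_succ]
        linarith
      calc _ ≤ ((1 + (1/4)^(k+1)) * ck k * En (cellE k (chd Q c o)) t v + (10 * Cs * (1/4)^k) * En (cellE (k+1) Q) t v) + ((1 + (1/4)^(k+1)) * ck k * En (cellE k (chd Q c o')) t v + (10 * Cs * (1/4)^k) * En (cellE (k+1) Q) t v) := add_le_add b1 b2
        _ = (1 + (1/4)^(k+1)) * ck k * (En (cellE k (chd Q c o)) t v + En (cellE k (chd Q c o')) t v) + (20 * Cs * (1/4)^k) * En (cellE (k+1) Q) t v := by ring
        _ ≤ (1 + (1/4)^(k+1)) * ck k * En (cellE (k+1) Q) t v + (20 * Cs * (1/4)^k) * En (cellE (k+1) Q) t v := by gcongr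
        _ = ((1 + (1/4)^(k+1)) * ck k + 20 * Cs * (1/4)^k) * En (cellE (k+1) Q) t v := by ring
        _ ≤ _ := by gcongr

end

end PartB4

section PartB5
open scoped BigOperators Classical ENNReal
open MeasureTheory Matrix
noncomputable section

def chaincore (t : Fld) (k : ℕ) (z : Site) : Prop := ∀ m < k, Core t m (anc (m+1) z) (anc m z)

lemma chaincore.mono {t : Fld} {k k' : ℕ} {z : Site} (h : chaincore t k z) (hk : k' ≤ k) : chaincore t k' z := fun m hm => h m (hm.trans_le hk)

lemma chaincore.valid {t : Fld} {k : ℕ} {z : Site} (h : chaincore t k z) {r : ℕ} (hr : r ≤ k) : valid t r (anc r z) := by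
  cases r with
  | zero => trivial
  | succ r => exact (h r hr).1

lemma chain_T {t : Fld} {r n : ℕ} {z : Site} (h : chaincore t (r+n) z) : |TT t r (anc r z) - TT t (r+n) (anc (r+n) z)| ≤ n / 100 := by
  induction n with
  | zero => simp
  | succ n ih =>
    have h1 := ih (h.mono (by omega))
    have h2 := (F12 (h (r+n) (by omega))).1
    rw [← add_assoc]
    rw [abs_le] at *
    push_cast
    constructor <;> linarith [h1.1, h1.2, h2.1, h2.2]

lemma chain_A {t : Fld} {r n : ℕ} {z : Site} (h : chaincore t (r+n) z) (v : Fld) :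
    Real.exp (2 * TT t r (anc r z)) * (AA t r v (anc r z) - AA t (r+n) v (anc (r+n) z))^2 ≤
      40 * (3 - 2 * (1/2)^n) * (Cs * (1/64)^r) * En (cellE (r+n) (anc (r+n) z)) t v := by
  induction n with
  | zero =>
    have := En_nonneg (cellE (r+0) (anc (r+0) z)) t v
    have := Cs_pos
    simp only [add_zero, sub_self, pow_zero]
    norm_num
    positivity
  | succ n ih =>
    have h1 := ih (h.mono (by omega))
    have h2 := (F12 (h (r+n) (by omega))).2 v
    have hT := (abs_le.1 (chain_T h)).2
    rw [← add_assoc] at *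
    have hEE : En (cellE (r+n) (anc (r+n) z)) t v ≤ En (cellE (r+n+1) (anc (r+n+1) z)) t v := En_mono (cellE_sub (anc_succ _ _).symm) t v
    set E := En (cellE (r+n+1) (anc (r+n+1) z)) t v with hE
    have hE0 : 0 ≤ E := En_nonneg _ t v
    set a := AA t r v (anc r z)
    set b := AA t (r+n) v (anc (r+n) z)
    set c := AA t (r+n+1) v (anc (r+n+1) z)
    set x := Real.exp (2 * TT t r (anc r z)) with hx
    have hx0 : 0 < x := Real.exp_pos _
    have hC := Cs_pos
    set η : ℝ := (1/4)^(n+1) with hη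
    have hη0 : 0 < η := by positivity
    have hy : (a - c)^2 ≤ (1 + η) * (a - b)^2 + (1 + 1/η) * (b - c)^2 := by
      have : 0 ≤ (η * (a - b) - (b - c))^2 / η := by positivity
      have e : (1 + η) * (a - b)^2 + (1 + 1/η) * (b - c)^2 - (a - c)^2 = (η * (a - b) - (b - c))^2 / η := by field_simp; ring
      linarith
    have g1 : 1 + 1/η ≤ 5 * 4^n := by
      rw [hη, _root_.one_div_pow, one_div_one_div, pow_succ]
      have : (1:ℝ) ≤ 4^n := one_le_pow₀ (by norm_num)
      linarith
    have g2 : x ≤ 2 * 2^n * Real.exp (2 * TT t (r+n+1) (anc (r+n+1) z)) := by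
      have : Real.exp (1/50) ≤ 2 :=
        (Real.exp_bound_div_one_sub_of_interval (x := 1/50) (by norm_num) (by norm_num)).trans (by norm_num)
      calc x ≤ Real.exp ((n+1 : ℕ) * (1/50) + 2 * TT t (r+n+1) (anc (r+n+1) z)) := by
            rw [hx]; apply Real.exp_le_exp.2; push_cast at hT ⊢; linarith
        _ = Real.exp (1/50)^(n+1) * Real.exp (2 * TT t (r+n+1) (anc (r+n+1) z)) := by rw [Real.exp_add, Real.exp_nat_mul]
        _ ≤ 2^(n+1) * Real.exp (2 * TT t (r+n+1) (anc (r+n+1) z)) := by gcongr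
        _ = _ := by rw [pow_succ]; ring
    have h3 : x * (b - c)^2 ≤ 2 * 2^n * (Cs * ((1/64)^(r+n) * E)) := by
      calc _ ≤ (2 * 2^n * Real.exp (2 * TT t (r+n+1) (anc (r+n+1) z))) * (b-c)^2 := by gcongr
        _ = 2 * 2^n * (Real.exp (2 * TT t (r+n+1) (anc (r+n+1) z)) * (b-c)^2) := by ring
        _ ≤ _ := by gcongr
    have hn1 : ((1:ℝ)/2)^n ≤ 1 := pow_le_one₀ (by norm_num) (by norm_num)
    have hn2 : (0:ℝ) < (1/2)^n := by positivity
    have h4 : (0:ℝ) ≤ 40 * (3 - 2 * (1/2)^n) := by linarith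
    calc x * (a-c)^2 ≤ x * ((1 + η) * (a - b)^2 + (1 + 1/η) * (b - c)^2) := by gcongr
      _ = (1+η) * (x * (a-b)^2) + (1 + 1/η) * (x * (b-c)^2) := by ring
      _ ≤ (1+η) * (40 * (3 - 2 * (1/2)^n) * (Cs * (1/64)^r) * E) + (5 * 4^n) * (2 * 2^n * (Cs * ((1/64)^(r+n) * E))) := by
        have h1' := h1.trans (mul_le_mul_of_nonneg_left hEE (mul_nonneg h4 (by positivity : 0 ≤ Cs * (1/64)^r)))
        exact add_le_add (mul_le_mul_of_nonneg_left h1' (by positivity)) (mul_le_mul g1 h3 (by positivity) (by positivity))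
      _ = ((1+η) * (40 * (3 - 2 * (1/2)^n)) + 10 * (4 * 2 * (1/64))^n) * (Cs * (1/64)^r) * E := by rw [pow_add]; simp only [mul_pow]; ring
      _ ≤ _ := by
        have h5 : (1+η) * (40 * (3 - 2 * (1/2)^n)) + 10 * (4 * 2 * (1/64))^n ≤ 40 * (3 - 2 * (1/2)^(n+1)) := by
          have q1 : ((4:ℝ) * 2 * (1/64))^n ≤ (1/4)^n := by gcongr; norm_num
          have q2 : ((1:ℝ)/4)^n ≤ (1/2)^n := by gcongr; norm_num
          have q3 : (0:ℝ) < (1/4)^n := by positivity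
          rw [hη, pow_succ, pow_succ]
          nlinarith [mul_pos q3 hn2]
        gcongr

lemma chain_A' {t : Fld} {r k : ℕ} (hr : r ≤ k) {z : Site} (h : chaincore t k z) (v : Fld) :
    Real.exp (2 * TT t r (anc r z)) * (AA t r v (anc r z) - AA t k v (anc k z))^2 ≤ 120 * Cs * (1/64)^r * En (cellE k (anc k z)) t v := by
  obtain ⟨n, rfl⟩ := Nat.exists_eq_add_of_le hr
  have h1 := chain_A h v
  have hE := En_nonneg (cellE (r+n) (anc (r+n) z)) t v
  have hC := Cs_pos
  have hn2 : (0:ℝ) < (1/2)^n := by positivity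
  refine h1.trans ?_
  have : 40 * (3 - 2 * ((1:ℝ)/2)^n) ≤ 120 := by linarith
  calc _ ≤ 120 * (Cs * (1/64)^r) * En (cellE (r+n) (anc (r+n) z)) t v := by gcongr
    _ = _ := by ring

def ind (p : Prop) : ℝ≥0∞ := if p then 1 else 0
lemma ind_le_one (p : Prop) : ind p ≤ 1 := by unfold ind; split_ifs <;> simp
lemma ind_true {p : Prop} (h : p) : ind p = 1 := if_pos h
lemma ind_false {p : Prop} (h : ¬ p) : ind p = 0 := if_neg h
lemma ind_ne {p : Prop} (h : ind p ≠ 0) : p := by by_contra h'; exact h (ind_false h')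
lemma ind_mono {p q : Prop} (h : p → q) : ind p ≤ ind q := by
  by_cases hp : p
  · rw [ind_true hp, ind_true (h hp)]
  · rw [ind_false hp]; exact zero_le

def g0 (β : ℝ) : ℝ := β / (200 * Mc)

def prs (β : ℝ) (D0 : ℤ) (p p' : LP) : Pat := List.zipWith (fun a b => (g0 β * Real.exp (-((a.2 - b.2 + D0 : ℤ):ℝ)), a.1, b.1)) p p'

lemma zip_sum_le {α γ : Type*} (p : List α) (p' : List γ) (hl : p.length = p'.length) (h : α → γ → ℝ) (f : α → ℝ) (g : γ → ℝ) (c : ℝ)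
    (H : ∀ a ∈ p, ∀ b ∈ p', h a b ≤ f a + g b + c) : (List.zipWith h p p').sum ≤ (p.map f).sum + (p'.map g).sum + p.length * c := by
  induction p generalizing p' with
  | nil => cases p' with
    | nil => simp
    | cons => simp at hl
  | cons a p ih => cases p' with
    | nil => simp at hl
    | cons b p' =>
      have := ih p' (by simpa using hl) (fun a ha b hb => H a (List.mem_cons_of_mem _ ha) b (List.mem_cons_of_mem _ hb))
      have h2 := H a List.mem_cons_self b List.mem_cons_self
      simp only [List.zipWith_cons_cons, List.sum_cons, List.map_cons, List.length_cons]
      push_cast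
      linarith

lemma zip_neg {α γ : Type*} (p : List α) (p' : List γ) (h : α → γ → ℝ) : (List.zipWith (fun a b => -h a b) p p').sum = -(List.zipWith h p p').sum := by
  induction p generalizing p' with
  | nil => simp
  | cons a p ih => cases p' with
    | nil => simp
    | cons b p' => simp only [List.zipWith_cons_cons, List.sum_cons, ih]; ring

lemma zip_mem {α γ δ : Type*} (p : List α) (p' : List γ) (h : α → γ → δ) {x : δ} (hx : x ∈ List.zipWith h p p') : ∃ a ∈ p, ∃ b ∈ p', x = h a b := by
  induction p generalizing p' with
  | nil => simp at hx
  | cons a p ih => cases p' with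
    | nil => simp at hx
    | cons b p' =>
      rw [List.zipWith_cons_cons, List.mem_cons] at hx
      rcases hx with rfl | hx
      · exact ⟨a, List.mem_cons_self, b, List.mem_cons_self, rfl⟩
      · obtain ⟨a', h1, b', h2, h3⟩ := ih p' hx
        exact ⟨a', List.mem_cons_of_mem _ h1, b', List.mem_cons_of_mem _ h2, h3⟩

lemma cosh_low {x s : ℝ} (hs : 0 < s) (hs1 : s ≤ 1) (hx : s ≤ x) : s^2/8 ≤ Real.exp (-x) * (Real.cosh x - 1) := by
  have e : Real.exp (-x) * (Real.cosh x - 1) = (1 - Real.exp (-x))^2 / 2 := by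
    rw [Real.cosh_eq]
    have : Real.exp (-x) * Real.exp x = 1 := by rw [← Real.exp_add]; simp
    nlinarith
  have h1 : Real.exp (-x) ≤ Real.exp (-s) := Real.exp_le_exp.2 (by linarith)
  have h2 : Real.exp (-s) ≤ 1 - s/2 := by
    have h3 : Real.exp (-s) * Real.exp s = 1 := by rw [← Real.exp_add]; simp
    have h4 := Real.add_one_le_exp s
    have h5 : Real.exp (-s) * (1 + s) ≤ 1 := by
      have := Real.exp_pos (-s); nlinarith
    have : (1 - s/2) * (1 + s) ≥ 1 := by nlinarith
    nlinarith
  rw [e]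
  nlinarith

set_option maxHeartbeats 1000000 in
lemma lemma2 {β : ℝ} (hβ : 0 < β) (r : ℕ) (P P' : Site) (hPP : P ≠ P') (D : Finset Edge) (hP : cellE r P ⊆ D) (hP' : cellE r P' ⊆ D)
    (s : ℝ) (hs : 0 < s) (hs1 : s ≤ 1) (D0 : ℤ) (Ev : Fld → Prop)
    (hEv : ∀ t, Ev t → valid t r P ∧ valid t r P' ∧ TT t r P' + s ≤ TT t r P ∧ ⌊TT t r P⌋ - ⌊TT t r P'⌋ = D0 ∧
      ∀ v, 2^r * (Real.exp (2 * TT t r P') * (AA t r v P - AA t r v P')^2) ≤ 6 * Mc * En D t v) :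
    Dom β D (fun t => ind (Ev t)) (ENNReal.ofReal ((10^5 * Real.exp (-(g0 β * s^2/24)))^(2^r))) := by
  have hM := Mc_pos
  have hg : 0 < g0 β := by unfold g0; positivity
  have hcov := Dom.cover (β := β) (E := D) ((PatSet r P ×ˢ PatSet r P').filter fun i => i.1.length = 2^r ∧ i.2.length = 2^r) (fun t => ind (Ev t))
    (fun i t => ENNReal.ofReal (Real.exp (-(g0 β * s^2/24)))^(2^r) * Phi β D (prs β D0 i.1 i.2) t)
    (ENNReal.ofReal (Real.exp (-(g0 β * s^2/24)))^(2^r) * s2^(2^r)) ?_ ?_ ((243^(2^r) * 243^(2^r) : ℕ) : ℝ≥0∞) ?_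
  · refine hcov.mono (fun _ => le_rfl) ?_
    rw [s2, ENNReal.ofReal_pow (by positivity)]
    push_cast
    simp only [← mul_pow]
    rw [← ENNReal.ofReal_mul (by positivity)]
    refine pow_le_pow_left' ?_ _
    rw [show ((243 * 243 : ℝ≥0∞)) = ENNReal.ofReal (243*243) by rw [ENNReal.ofReal_mul (by norm_num)]; norm_num, ← ENNReal.ofReal_mul (by norm_num)]
    apply ENNReal.ofReal_le_ofReal
    have h2 : Real.sqrt 2 ≤ 1.5 := by rw [Real.sqrt_le_left (by norm_num)]; norm_num
    nlinarith [Real.exp_pos (-(g0 β * s^2/24))]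
  · intro i hi
    rw [Finset.mem_filter] at hi
    have hl : (prs β D0 i.1 i.2).length = 2^r := by rw [prs, List.length_zipWith, hi.2.1, hi.2.2, min_self]
    have := (Dom.pat (β := β) (E := D) (prs β D0 i.1 i.2) (by
      intro p hp
      obtain ⟨a, _, b, _, rfl⟩ := zip_mem _ _ _ hp
      simp only; positivity)).const_mul (ENNReal.ofReal (Real.exp (-(g0 β * s^2/24)))^(2^r))
    rw [hl] at this
    exact this
  · intro t ht
    have ht := ind_ne ht
    rw [ind_true ht]
    obtain ⟨v1, v2, hT, hD, hA⟩ := hEv t ht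
    obtain ⟨p, hp, hpl, hp1, hp2⟩ := leaf 1 (Or.inl rfl) t r P v1
    obtain ⟨p', hp', hpl', hp1', hp2'⟩ := leaf (-1) (Or.inr rfl) t r P' v2
    refine ⟨(p, p'), by rw [Finset.mem_filter, Finset.mem_product]; exact ⟨⟨hp, hp'⟩, hpl, hpl'⟩, ?_⟩
    -- facts on pairs
    have hpair : ∀ a ∈ p, ∀ b ∈ p', t b.1 ≤ TT t r P' ∧ TT t r P ≤ t a.1 ∧ (a.2 - b.2 + D0 : ℤ) = ⌊t a.1⌋ - ⌊t b.1⌋ := by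
      intro a ha b hb
      obtain ⟨x1, x2, _⟩ := hp1 a ha
      obtain ⟨y1, y2, _⟩ := hp1' b hb
      refine ⟨by linarith, by linarith, ?_⟩
      rw [x2, y2, ← hD]; ring
    have hexp1 : Real.exp 1 ≤ 3 := (Real.exp_one_lt_d9.le).trans (by norm_num)
    have hev : t ∈ Evt β (prs β D0 p p') D := by
      intro v
      set X := AA t r v P
      set X' := AA t r v P'
      have hE1 := En_nonneg (cellE r P) t v
      have hE2 := En_nonneg (cellE r P') t v
      have hE3 : En (cellE r P) t v + En (cellE r P') t v ≤ En D t v := by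
        rw [← En_union (cellE_disj hPP)]; exact En_mono (Finset.union_subset hP hP') t v
      have h0 := zip_sum_le p p' (hpl.trans hpl'.symm)
        (fun a b => (g0 β * Real.exp (-((a.2 - b.2 + D0 : ℤ):ℝ))) * (Real.exp (t a.1 + t b.1) * (v a.1 - v b.1)^2))
        (fun a => 9 * g0 β * (Real.exp (2 * t a.1) * (v a.1 - X)^2)) (fun b => 9 * g0 β * (Real.exp (2 * t b.1) * (v b.1 - X')^2))
        (9 * g0 β * (Real.exp (2 * TT t r P') * (X - X')^2)) (by
          intro a ha b hb
          obtain ⟨q1, q2, q3⟩ := hpair a ha b hb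
          have e1 : Real.exp (-((a.2 - b.2 + D0 : ℤ):ℝ)) * Real.exp (t a.1 + t b.1) ≤ 3 * Real.exp (2 * t b.1) := by
            rw [← Real.exp_add, q3]
            push_cast
            calc _ ≤ Real.exp (1 + 2 * t b.1) := by
                  apply Real.exp_le_exp.2
                  linarith [Int.lt_floor_add_one (t a.1), Int.floor_le (t b.1)]
              _ ≤ _ := by rw [Real.exp_add]; gcongr
          have e2 : Real.exp (2 * t b.1) ≤ Real.exp (2 * t a.1) := Real.exp_le_exp.2 (by linarith)
          have e3 : Real.exp (2 * t b.1) ≤ Real.exp (2 * TT t r P') := Real.exp_le_exp.2 (by linarith)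
          have e4 : (v a.1 - v b.1)^2 ≤ 3 * ((v a.1 - X)^2 + (v b.1 - X')^2 + (X - X')^2) := by
            nlinarith [sq_nonneg ((v a.1 - X) - (X - X')), sq_nonneg ((v a.1 - X) + (v b.1 - X')), sq_nonneg ((X - X') + (v b.1 - X'))]
          calc _ = g0 β * (Real.exp (-((a.2 - b.2 + D0 : ℤ):ℝ)) * Real.exp (t a.1 + t b.1)) * (v a.1 - v b.1)^2 := by ring
            _ ≤ g0 β * (3 * Real.exp (2 * t b.1)) * (3 * ((v a.1 - X)^2 + (v b.1 - X')^2 + (X - X')^2)) := by gcongr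
            _ = 9 * g0 β * (Real.exp (2 * t b.1) * (v a.1 - X)^2) + 9 * g0 β * (Real.exp (2 * t b.1) * (v b.1 - X')^2) + 9 * g0 β * (Real.exp (2 * t b.1) * (X - X')^2) := by ring
            _ ≤ _ := by gcongr)
      have h1 : Gam (prs β D0 p p') t v = (List.zipWith (fun a b => (g0 β * Real.exp (-((a.2 - b.2 + D0 : ℤ):ℝ))) * (Real.exp (t a.1 + t b.1) * (v a.1 - v b.1)^2)) p p').sum := by
        rw [Gam, prs, List.map_zipWith]
      rw [h1]
      refine h0.trans ?_
      rw [List.sum_map_mul_left, List.sum_map_mul_left, hpl]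
      have h2 := hp2 v
      have h3 := hp2' v
      have h4 := hA v
      have h5 := ck_le r
      push_cast
      calc _ = 9 * g0 β * ((p.map fun q => Real.exp (2 * t q.1) * (v q.1 - X)^2).sum + (p'.map fun q => Real.exp (2 * t q.1) * (v q.1 - X')^2).sum + 2^r * (Real.exp (2 * TT t r P') * (X - X')^2)) := by ring
        _ ≤ 9 * g0 β * (3 * Mc * En (cellE r P) t v + 3 * Mc * En (cellE r P') t v + 6 * Mc * En D t v) := by
          gcongr
          · exact h2.trans (by gcongr)
          · exact h3.trans (by gcongr)
        _ ≤ 9 * g0 β * (9 * Mc * En D t v) := by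
          have := mul_le_mul_of_nonneg_left hE3 (by positivity : (0:ℝ) ≤ 3 * Mc)
          gcongr
          linarith
        _ ≤ _ := by
          have hE4 := En_nonneg D t v
          rw [show 9 * g0 β * (9 * Mc * En D t v) = (81/200 * β) * En D t v by unfold g0; field_simp; ring]
          gcongr
          linarith
    have hcs : 2^r * (g0 β * s^2/24) ≤ Csum (prs β D0 p p') t := by
      have h0 := zip_sum_le p p' (hpl.trans hpl'.symm)
        (fun a b => -((g0 β * Real.exp (-((a.2 - b.2 + D0 : ℤ):ℝ))) * (Real.cosh (t a.1 - t b.1) - 1))) (fun _ => 0) (fun _ => 0) (-(g0 β * s^2/24)) (by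
          intro a ha b hb
          obtain ⟨q1, q2, q3⟩ := hpair a ha b hb
          have h1 := cosh_low hs hs1 (x := t a.1 - t b.1) (by linarith)
          have h2 : Real.exp (-(t a.1 - t b.1)) ≤ 3 * Real.exp (-((a.2 - b.2 + D0 : ℤ):ℝ)) := by
            rw [q3]; push_cast
            calc _ ≤ Real.exp (1 + -((⌊t a.1⌋:ℝ) - ⌊t b.1⌋)) := by
                  apply Real.exp_le_exp.2
                  linarith [Int.floor_le (t a.1), Int.lt_floor_add_one (t b.1)]
              _ ≤ _ := by rw [Real.exp_add]; gcongr
          have h3 := Real.one_le_cosh (t a.1 - t b.1)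
          have h4 : s^2/8 ≤ 3 * (Real.exp (-((a.2 - b.2 + D0 : ℤ):ℝ)) * (Real.cosh (t a.1 - t b.1) - 1)) := by
            have := mul_le_mul_of_nonneg_right h2 (by linarith : (0:ℝ) ≤ Real.cosh (t a.1 - t b.1) - 1)
            linarith
          have h5 := mul_le_mul_of_nonneg_left h4 hg.le
          simp only [zero_add]
          linarith)
      have h1 : -Csum (prs β D0 p p') t = (List.zipWith (fun a b => -((g0 β * Real.exp (-((a.2 - b.2 + D0 : ℤ):ℝ))) * (Real.cosh (t a.1 - t b.1) - 1))) p p').sum := by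
        rw [Csum, prs, List.map_zipWith, zip_neg]
      rw [← h1, hpl] at h0
      simp at h0
      linarith
    rw [Phi, Set.indicator_of_mem hev, ← ENNReal.ofReal_pow (by positivity), ← ENNReal.ofReal_mul (by positivity), ← Real.exp_nat_mul, ← Real.exp_add,
      ← ENNReal.ofReal_one]
    apply ENNReal.ofReal_le_ofReal
    apply Real.one_le_exp
    push_cast
    linarith
  · norm_cast
    refine (Finset.card_le_card (Finset.filter_subset _ _)).trans ?_
    rw [Finset.card_product]
    have h1 := PatSet_card r P
    have h2 := PatSet_card r P'
    exact Nat.mul_le_mul (by omega) (by omega)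

end

end PartB5

section PartC1
open scoped BigOperators Classical ENNReal
open MeasureTheory Matrix
noncomputable section

lemma Mc_one : 1 ≤ Mc := by
  have : (sg:ℝ) = 10000000 := by rw [sg_eq]; norm_num
  unfold Mc Cs; rw [this]; norm_num
lemma al_le : al ≤ 1 := by
  have : (sg:ℝ) = 10000000 := by rw [sg_eq]; norm_num
  unfold al; rw [this]; norm_num

lemma cosh_lb (x : ℝ) : 1 + x^2/2 ≤ Real.cosh x := by
  have h : ∀ y : ℝ, 0 ≤ y → 1 + y^2/2 ≤ Real.cosh y := by
    intro y hy
    have h1 : y/2 ≤ Real.sinh (y/2) := Real.self_le_sinh_iff.2 (by linarith)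
    have h2 := Real.cosh_two_mul (y/2)
    have h3 := Real.cosh_sq (y/2)
    rw [show 2 * (y/2) = y by ring] at h2
    nlinarith
  have := h |x| (abs_nonneg x)
  rwa [Real.cosh_abs, sq_abs] at this

lemma F3' {t : Fld} {k : ℕ} {e : Edge} (h : OK (BB t k) (dmS e)) :
    |TT t (k+1) e.1 - TT t (k+1) (e.1 + ev e.2)| ≤ 1/100 ∧
    ∀ v, Real.exp (2 * min (TT t (k+1) e.1) (TT t (k+1) (e.1 + ev e.2))) * (AA t (k+1) v e.1 - AA t (k+1) v (e.1 + ev e.2))^2 ≤ ((1/64)^k/64) * En (domE (k+1) e) t v :=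
  F3 (by positivity) (GB_lev t k) e h

def n1 : ℕ := 6 * rh^3
lemma n1_pos : 1 ≤ n1 := by unfold n1; have := Nat.pos_of_ne_zero (pow_ne_zero 3 rh_pos.ne'); omega

def wb (β : ℝ) : ℝ := 10^5 * Real.exp (-(g0 β * al^2/24))
def Wb (β : ℝ) : ℝ := 16 * (n1:ℝ)^2 * wb β
lemma wb_pos (β : ℝ) : 0 < wb β := by unfold wb; positivity
lemma Wb_pos (β : ℝ) : 0 < Wb β := by
  have := wb_pos β; have : (1:ℝ) ≤ n1 := by exact_mod_cast n1_pos
  unfold Wb; positivity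

def qk (β : ℝ) (k : ℕ) : ℝ := (Wb β)^(2^k) / (2 * (n1:ℝ)^2)
lemma qk_pos (β : ℝ) (k : ℕ) : 0 < qk β k := by
  have := Wb_pos β; have : (1:ℝ) ≤ n1 := by exact_mod_cast n1_pos
  unfold qk; positivity
lemma qk_le (β : ℝ) (k : ℕ) : qk β k ≤ (Wb β)^(2^k) := by
  have := Wb_pos β; have h : (1:ℝ) ≤ n1 := by exact_mod_cast n1_pos
  unfold qk
  apply div_le_self (by positivity)
  nlinarith

lemma edgeE {β : ℝ} (hβ : 0 ≤ β) (e : Edge) (γ : ℝ) (hγ : 0 ≤ γ) (hγβ : γ ≤ β/2) (E : Finset Edge) (he : e ∈ E) :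
    Dom β E (fun t => ENNReal.ofReal (Real.exp (γ * (Real.cosh (t e.1 - t (e.1 + ev e.2)) - 1)))) s2 := by
  refine (Dom.pat (β := β) (E := E) [(γ, e.1, e.1 + ev e.2)] (by simpa using hγ)).mono (fun t => ?_) (by simp)
  have : t ∈ Evt β [(γ, e.1, e.1 + ev e.2)] E := by
    intro v
    have h1 : En {e} t v ≤ En E t v := En_mono (by simpa using he) t v
    have h2 := En_nonneg {e} t v
    simp only [Gam, List.map_cons, List.map_nil, List.sum_cons, List.sum_nil, add_zero]
    rw [En, Finset.sum_singleton] at h1 h2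
    calc _ ≤ (β/2) * _ := mul_le_mul_of_nonneg_right hγβ h2
      _ ≤ _ := by gcongr
  rw [Phi, Set.indicator_of_mem this]
  simp [Csum]

lemma bad_zero {β : ℝ} (hβ : 0 < β) (e : Edge) : Dom β (domE 0 e) (fun t => ind (BB t 0 e)) (ENNReal.ofReal (qk β 0)) := by
  have h := (edgeE hβ.le e (β/2) (by positivity) le_rfl (domE 0 e) (by rw [mem_domE]; simp [anc_zero])).const_mul (ENNReal.ofReal (Real.exp (-(β * al^2/4))))
  refine h.mono (fun t => ?_) ?_
  · by_cases hb : BB t 0 e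
    · rw [ind_true hb, ← ENNReal.ofReal_mul (by positivity), ← Real.exp_add, ← ENNReal.ofReal_one]
      apply ENNReal.ofReal_le_ofReal
      apply Real.one_le_exp
      rw [BB_zero] at hb
      have h1 := cosh_lb (t e.1 - t (e.1 + ev e.2))
      have h2 : al^2 ≤ (t e.1 - t (e.1 + ev e.2))^2 := by
        rw [← sq_abs (t e.1 - _)]; have := al_pos; gcongr
      nlinarith
    · rw [ind_false hb]; exact zero_le
  · rw [s2, ← ENNReal.ofReal_mul (by positivity)]
    apply ENNReal.ofReal_le_ofReal
    have hn : (1:ℝ) ≤ n1 := by exact_mod_cast n1_pos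
    have h2 : Real.sqrt 2 ≤ 1.5 := by rw [Real.sqrt_le_left (by norm_num)]; norm_num
    have hM := Mc_one
    have h3 : qk β 0 = 8 * 10^5 * Real.exp (-(g0 β * al^2/24)) := by
      unfold qk Wb wb; field_simp; ring
    have h4 : Real.exp (-(β * al^2/4)) ≤ Real.exp (-(g0 β * al^2/24)) := by
      apply Real.exp_le_exp.2
      have : g0 β ≤ β := by unfold g0; apply div_le_self hβ.le; linarith
      have := mul_le_mul_of_nonneg_right this (sq_nonneg al)
      have : 0 ≤ β * al^2 := by positivity
      linarith
    rw [h3]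
    have := Real.exp_pos (-(β * al^2/4))
    nlinarith

lemma domE_disj {k : ℕ} {f f' : Edge} (h : ¬ touch f f') : Disjoint (domE k f) (domE k f') := by
  rw [Finset.disjoint_left]
  intro e h1 h2
  rw [mem_domE] at h1 h2
  unfold touch at h
  push Not at h
  obtain ⟨a, b, c, d⟩ := h
  rcases h1.1 with x | x <;> rcases h2.1 with y | y <;> rw [x] at y
  · exact a y
  · exact b y
  · exact c y
  · exact d y

lemma cells_card (Q : Site) : (cells 1 Q).card = rh^3 := by
  simp [cells, Fintype.card_piFinset, Nat.card_Ico, ← Nat.mul_sub]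

lemma edgesIn_card (S : Finset Site) : (edgesIn S).card ≤ 3 * S.card := by
  refine (Finset.card_filter_le _ _).trans ?_
  rw [Finset.card_product]; simp [mul_comm]

lemma inS_dm {e f : Edge} : inS (dmS e) f ↔ f ∈ edgesIn (cells 1 e.1 ∪ cells 1 (e.1 + ev e.2)) := by
  rw [mem_edgesIn, Finset.mem_union, Finset.mem_union, mem_cells, mem_cells, mem_cells, mem_cells]; rfl

lemma inS_ch {Q : Site} {f : Edge} : inS (chS Q) f ↔ f ∈ edgesIn (cells 1 Q) := by
  rw [mem_edgesIn, mem_cells, mem_cells]; rfl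

lemma cover_ind {β : ℝ} {E : Finset Edge} {ι : Type*} (s : Finset ι) (A : Fld → Prop) (B : ι → Fld → Prop) (q C : ℝ) (hq : 0 ≤ q)
    (h : ∀ i ∈ s, Dom β E (fun t => ind (B i t)) (ENNReal.ofReal q)) (hc : ∀ t, A t → ∃ i ∈ s, B i t) (hs : (s.card : ℝ) ≤ C) :
    Dom β E (fun t => ind (A t)) (ENNReal.ofReal (C * q)) := by
  rw [ENNReal.ofReal_mul ((Nat.cast_nonneg _).trans hs)]
  refine Dom.cover s _ (fun i t => ind (B i t)) _ h (fun t ht => ?_) _ ?_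
  · obtain ⟨i, hi, hb⟩ := hc t (ind_ne ht)
    exact ⟨i, hi, by rw [ind_true hb]; exact ind_le_one _⟩
  · rw [← ENNReal.ofReal_natCast]; exact ENNReal.ofReal_le_ofReal hs

lemma ind_and (p q : Prop) : ind (p ∧ q) = ind p * ind q := by
  unfold ind; by_cases hp : p <;> by_cases hq : q <;> simp [hp, hq]

lemma floor_diff {a b s : ℝ} {n : ℕ} (h1 : b ≤ a) (h2 : a ≤ b + n) : ⌊a⌋ - ⌊b⌋ ∈ Finset.Icc (0:ℤ) n := by
  rw [Finset.mem_Icc]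
  have := Int.floor_le_floor h1
  have h3 := Int.floor_le_floor h2
  rw [Int.floor_add_natCast] at h3
  omega

set_option maxHeartbeats 1000000 in
lemma bad_succ {β : ℝ} (hβ : 0 < β) (k : ℕ) (ih : ∀ e, Dom β (domE k e) (fun t => ind (BB t k e)) (ENNReal.ofReal (qk β k))) (e : Edge) :
    Dom β (domE (k+1) e) (fun t => ind (BB t (k+1) e)) (ENNReal.ofReal (qk β (k+1))) := by
  have hn : (1:ℝ) ≤ n1 := by exact_mod_cast n1_pos
  have hM := Mc_one
  have hq := qk_pos β k
  set C := edgesIn (cells 1 e.1 ∪ cells 1 (e.1 + ev e.2)) with hC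
  have hCc : (C.card : ℝ) ≤ n1 := by
    have h1 : C.card ≤ _ := edgesIn_card (cells 1 e.1 ∪ cells 1 (e.1 + ev e.2))
    have h2 := Finset.card_union_le (cells 1 e.1) (cells 1 (e.1 + ev e.2))
    rw [cells_card, cells_card] at h2
    have : C.card ≤ n1 := by unfold n1; omega
    exact_mod_cast this
  -- two disjoint bad dominoes
  have hA : Dom β (domE (k+1) e) (fun t => ind (¬ OK (BB t k) (dmS e))) (ENNReal.ofReal ((n1:ℝ)^2 * (qk β k)^2)) := by
    refine cover_ind ((C ×ˢ C).filter fun p => ¬ touch p.1 p.2) _ (fun p t => BB t k p.1 ∧ BB t k p.2) _ _ (by positivity) ?_ ?_ ?_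
    · intro p hp
      rw [Finset.mem_filter, Finset.mem_product] at hp
      have h1 := inS_dm.2 hp.1.1
      have h2 := inS_dm.2 hp.1.2
      have := ((ih p.1).mul (domE_disj hp.2) (ih p.2)).mono_E hβ.le (E' := domE (k+1) e) (Finset.union_subset (domE_sub_domE h1.1 h1.2) (domE_sub_domE h2.1 h2.2))
      refine this.mono (fun t => by rw [ind_and]) ?_
      rw [← ENNReal.ofReal_mul hq.le, sq]
    · intro t ht
      unfold OK at ht
      push Not at ht
      obtain ⟨f, f', b1, b2, i1, i2, h3⟩ := ht
      refine ⟨(f, f'), ?_, b1, b2⟩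
      rw [Finset.mem_filter, Finset.mem_product]
      exact ⟨⟨inS_dm.1 i1, inS_dm.1 i2⟩, h3⟩
    · have := Finset.card_filter_le (C ×ˢ C) (fun p => ¬ touch p.1 p.2)
      rw [Finset.card_product] at this
      calc _ ≤ ((C.card * C.card : ℕ) : ℝ) := by exact_mod_cast this
        _ ≤ _ := by push_cast; rw [sq]; gcongr
  have hB : ∀ P P' : Site, (P = e.1 ∧ P' = e.1 + ev e.2) ∨ (P = e.1 + ev e.2 ∧ P' = e.1) →
      Dom β (domE (k+1) e) (fun t => ind (OK (BB t k) (dmS e) ∧ TT t (k+1) P' + al ≤ TT t (k+1) P)) (ENNReal.ofReal (2 * (wb β)^(2^(k+1)))) := by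
    intro P P' hPP
    refine cover_ind (Finset.Icc (0:ℤ) (1:ℕ)) _ (fun D0 t => (OK (BB t k) (dmS e) ∧ TT t (k+1) P' + al ≤ TT t (k+1) P) ∧ ⌊TT t (k+1) P⌋ - ⌊TT t (k+1) P'⌋ = D0) _ _ (by have := wb_pos β; positivity) ?_ ?_ (by simp)
    · intro D0 _
      have hsub := cellE_sub_domE (k+1) e
      have hne : e.1 ≠ e.1 + ev e.2 := by
        intro h
        have := congrFun h e.2
        simp [ev_apply] at this
      refine lemma2 hβ (k+1) P P' ?_ _ ?_ ?_ al al_pos al_le D0 _ ?_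
      · rcases hPP with ⟨rfl, rfl⟩ | ⟨rfl, rfl⟩
        · exact hne
        · exact hne.symm
      · rcases hPP with ⟨rfl, rfl⟩ | ⟨rfl, rfl⟩
        · exact hsub.1
        · exact hsub.2
      · rcases hPP with ⟨rfl, rfl⟩ | ⟨rfl, rfl⟩
        · exact hsub.2
        · exact hsub.1
      · rintro t ⟨⟨h1, h2⟩, h3⟩
        have hv := valid_of_OK h1
        have hF := F3' h1
        have hap := al_pos
        have hmin : min (TT t (k+1) e.1) (TT t (k+1) (e.1 + ev e.2)) = TT t (k+1) P' := by
          rcases hPP with ⟨rfl, rfl⟩ | ⟨rfl, rfl⟩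
          · exact min_eq_right (by linarith)
          · exact min_eq_left (by linarith)
        refine ⟨?_, ?_, h2, h3, fun v => ?_⟩
        · rcases hPP with ⟨rfl, rfl⟩ | ⟨rfl, rfl⟩
          · exact hv.1
          · exact hv.2
        · rcases hPP with ⟨rfl, rfl⟩ | ⟨rfl, rfl⟩
          · exact hv.2
          · exact hv.1
        · have h4 := hF.2 v
          have h5 : Real.exp (2 * TT t (k+1) P') * (AA t (k+1) v P - AA t (k+1) v P')^2 ≤ (1/64)^k/64 * En (domE (k+1) e) t v := by
            rw [← hmin]
            refine le_trans ?_ h4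
            rcases hPP with ⟨rfl, rfl⟩ | ⟨rfl, rfl⟩
            · exact le_rfl
            · rw [show (AA t (k+1) v (e.1 + ev e.2) - AA t (k+1) v e.1)^2 = (AA t (k+1) v e.1 - AA t (k+1) v (e.1 + ev e.2))^2 by ring]
          have hE := En_nonneg (domE (k+1) e) t v
          calc _ ≤ 2^(k+1) * ((1/64)^k/64 * En (domE (k+1) e) t v) := by gcongr
            _ = ((2 * (1/64))^k * (1/32)) * En (domE (k+1) e) t v := by rw [mul_pow, pow_succ]; ring
            _ ≤ (1 * 1) * En (domE (k+1) e) t v := by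
              gcongr
              · exact pow_le_one₀ (by norm_num) (by norm_num)
              · norm_num
            _ ≤ _ := by gcongr; linarith
    · rintro t ⟨h1, h2⟩
      refine ⟨_, ?_, ⟨h1, h2⟩, rfl⟩
      have hF := abs_le.1 (F3' h1).1
      have hap := al_pos
      have hF1 : -(1/100) ≤ TT t (k+1) e.1 - TT t (k+1) (e.1 + ev e.2) := hF.1
      have hF2 : TT t (k+1) e.1 - TT t (k+1) (e.1 + ev e.2) ≤ 1/100 := hF.2
      refine floor_diff (s := 0) (by linarith) ?_
      push_cast
      rcases hPP with ⟨rfl, rfl⟩ | ⟨rfl, rfl⟩ <;> linarith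
  have hall := (hA.add (hB _ _ (Or.inl ⟨rfl, rfl⟩))).add (hB _ _ (Or.inr ⟨rfl, rfl⟩))
  refine hall.mono (fun t => ?_) ?_
  · by_cases hb : BB t (k+1) e
    · by_cases hO : OK (BB t k) (dmS e)
      · have h1 := (BB_succ t k e).1 hb
        have h2 : al < |TT t (k+1) e.1 - TT t (k+1) (e.1 + ev e.2)| := h1.resolve_left (by simpa using hO)
        rw [lt_abs] at h2
        rcases h2 with h2 | h2
        · have h3 : OK (BB t k) (dmS e) ∧ TT t (k+1) (e.1 + ev e.2) + al ≤ TT t (k+1) e.1 := ⟨hO, by linarith⟩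
          simp only [ind_true hb, ind_true h3]
          exact le_add_right (le_add_left le_rfl)
        · have h3 : OK (BB t k) (dmS e) ∧ TT t (k+1) e.1 + al ≤ TT t (k+1) (e.1 + ev e.2) := ⟨hO, by linarith⟩
          simp only [ind_true hb, ind_true h3]
          exact le_add_left le_rfl
      · simp only [ind_true hb, ind_true hO]
        exact le_add_right (le_add_right le_rfl)
    · rw [ind_false hb]; exact zero_le
  · have hw := wb_pos β
    have hW := Wb_pos β
    rw [← ENNReal.ofReal_add (by positivity) (by positivity), ← ENNReal.ofReal_add (by positivity) (by positivity)]
    apply ENNReal.ofReal_le_ofReal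
    have h1 : (n1:ℝ)^2 * (qk β k)^2 = (Wb β)^(2^(k+1)) / (4 * (n1:ℝ)^2) := by
      unfold qk; rw [pow_succ 2 k, pow_mul]; field_simp; ring
    have h2 : 16 * (n1:ℝ)^2 * (wb β)^(2^(k+1)) ≤ (Wb β)^(2^(k+1)) := by
      unfold Wb
      rw [mul_pow (16 * (n1:ℝ)^2)]
      gcongr
      exact le_self_pow₀ (by nlinarith) (by positivity)
    have h3 : 4 * (wb β)^(2^(k+1)) ≤ (Wb β)^(2^(k+1)) / (4 * (n1:ℝ)^2) := by
      rw [le_div_iff₀ (by positivity)]; linarith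
    have h4 : qk β (k+1) = (Wb β)^(2^(k+1)) / (4 * (n1:ℝ)^2) + (Wb β)^(2^(k+1)) / (4 * (n1:ℝ)^2) := by
      unfold qk; field_simp; ring
    rw [h1, h4]; linarith

lemma bad_all {β : ℝ} (hβ : 0 < β) (k : ℕ) : ∀ e, Dom β (domE k e) (fun t => ind (BB t k e)) (ENNReal.ofReal (qk β k)) := by
  induction k with
  | zero => exact bad_zero hβ
  | succ k ih => exact bad_succ hβ k ih

/-- the (j+1)-level ancestor of x has no bad level j domino -/
def fine (t : Fld) (j : ℕ) (x : Site) : Prop := ∀ e, BB t j e → ¬ inS (chS (anc (j+1) x)) e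

lemma nf_dom {β : ℝ} (hβ : 0 < β) (j : ℕ) (x : Site) : Dom β (cellE (j+1) (anc (j+1) x)) (fun t => ind (¬ fine t j x)) (ENNReal.ofReal (n1 * (Wb β)^(2^j))) := by
  refine cover_ind (edgesIn (cells 1 (anc (j+1) x))) _ (fun e t => BB t j e) _ _ (by have := Wb_pos β; positivity) ?_ ?_ ?_
  · intro e he
    have h1 := inS_ch.2 he
    exact ((bad_all hβ j e).mono_E hβ.le (domE_sub_cellE h1.1 h1.2)).mono (fun _ => le_rfl) (ENNReal.ofReal_le_ofReal (qk_le β j))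
  · intro t ht
    unfold fine at ht
    push Not at ht
    obtain ⟨e, h1, h2⟩ := ht
    exact ⟨e, inS_ch.1 h2, h1⟩
  · have h1 := edgesIn_card (cells 1 (anc (j+1) x))
    rw [cells_card] at h1
    have : (edgesIn (cells 1 (anc (j+1) x))).card ≤ n1 := by unfold n1; omega
    exact_mod_cast this

end

end PartC1

section PartC2
open scoped BigOperators Classical ENNReal
open MeasureTheory Matrix
noncomputable section

lemma g0_pos {β : ℝ} (hβ : 0 < β) : 0 < g0 β := by have := Mc_pos; unfold g0; positivity

def OrdEv (t : Fld) (k r : ℕ) (z z' : Site) (s : ℝ) (N : ℕ) : Prop :=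
  (chaincore t k z ∧ chaincore t k z') ∧ TT t r (anc r z') + s ≤ TT t r (anc r z) ∧ TT t r (anc r z) ≤ TT t r (anc r z') + N

lemma ordEv_dom {β : ℝ} (hβ : 0 < β) {k r : ℕ} (hr : r ≤ k) {z z' : Site} (hzz : anc k z' = anc k z) {s : ℝ} (hs : 0 < s) (hs1 : s ≤ 1) (N : ℕ) :
    Dom β (cellE k (anc k z)) (fun t => ind (OrdEv t k r z z' s N)) (ENNReal.ofReal ((N + 1) * (10^5 * Real.exp (-(g0 β * s^2/24)))^(2^r))) := by
  by_cases hPP : anc r z = anc r z'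
  · refine Dom.zero.mono (fun t => ?_) zero_le
    rw [ind_false]
    rintro ⟨_, h, _⟩
    rw [hPP] at h; linarith
  have hsub : ∀ w, anc k w = anc k z → cellE r (anc r w) ⊆ cellE k (anc k z) := by
    intro w hw
    have := cellE_sub' (k := r) (r := k - r) (a := anc r w) (Q := anc k z) (by rw [anc_add, Nat.add_sub_cancel' hr, hw])
    rwa [Nat.add_sub_cancel' hr] at this
  refine cover_ind (Finset.Icc (0:ℤ) N) _ (fun D0 t => OrdEv t k r z z' s N ∧ ⌊TT t r (anc r z)⌋ - ⌊TT t r (anc r z')⌋ = D0) _ _ (by positivity) ?_ ?_ (by simp)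
  · intro D0 _
    refine lemma2 hβ r _ _ hPP _ (hsub z rfl) (hsub z' hzz) s hs hs1 D0 _ ?_
    rintro t ⟨⟨⟨h1, h1'⟩, h2, h3⟩, h4⟩
    refine ⟨h1.valid hr, h1'.valid hr, h2, h4, fun v => ?_⟩
    have a1 := chain_A' hr h1 v
    have a2 := chain_A' hr h1' v
    rw [hzz] at a2
    have hE := En_nonneg (cellE k (anc k z)) t v
    generalize hGE : En (cellE k (anc k z)) t v = X at *
    generalize AA t k v (anc k z) = c at *
    generalize AA t r v (anc r z) = a at *
    generalize AA t r v (anc r z') = b at *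
    have a3 : Real.exp (2 * TT t r (anc r z')) * (a - c)^2 ≤ 120 * Cs * (1/64)^r * X := by
      refine le_trans ?_ a1
      gcongr
      linarith
    have hC := Cs_pos
    have a4 : Real.exp (2 * TT t r (anc r z')) * (a - b)^2 ≤ 480 * Cs * (1/64)^r * X := by
      have : (a - b)^2 ≤ 2 * (a-c)^2 + 2*(b-c)^2 := by nlinarith [sq_nonneg (a - c + (b - c))]
      have := mul_le_mul_of_nonneg_left this (Real.exp_pos (2 * TT t r (anc r z'))).le
      linarith
    calc _ ≤ 2^r * (480 * Cs * (1/64)^r * X) := by gcongr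
      _ = (2 * (1/64))^r * (480 * Cs * X) := by rw [mul_pow]; ring
      _ ≤ 1 * (480 * Cs * X) := by
        gcongr
        exact pow_le_one₀ (by norm_num) (by norm_num)
      _ = _ := by unfold Mc; ring
  · intro t ht
    refine ⟨_, ?_, ht, rfl⟩
    exact floor_diff (s := 0) (by linarith [ht.2.1]) ht.2.2

def hh (β : ℝ) : ℝ := g0 β / 96 - Real.log (10^5)

lemma exp_hh (β : ℝ) : 10^5 * Real.exp (-(g0 β * (1/2)^2/24)) = Real.exp (-hh β) := by
  unfold hh
  rw [show -(g0 β / 96 - Real.log (10^5)) = Real.log (10^5) + -(g0 β * (1/2)^2/24) by ring, Real.exp_add, Real.exp_log (by norm_num)]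

lemma sq_le_two_pow (r : ℕ) : (r:ℝ)^2 ≤ 2 * 2^r := by
  have : r^2 ≤ 2 * 2^r := by
    rcases lt_or_ge r 4 with h | h
    · interval_cases r <;> norm_num
    · induction r, h using Nat.le_induction with
      | base => norm_num
      | succ n hn ih => rw [pow_succ 2 n]; nlinarith
  exact_mod_cast this

lemma r_le_two_pow (r : ℕ) : (r:ℝ) + 1 ≤ 2^r := by
  have : r + 1 ≤ 2^r := Nat.lt_two_pow_self
  exact_mod_cast this

lemma term_le {h Λ : ℝ} (hh : 8 ≤ h) (r : ℕ) (hr : 1 ≤ r) :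
    Real.exp (Λ * (r + 1)) * (2 * ((2 * r + 1 : ℕ) + 1) * (Real.exp (-h))^(2^r)) ≤ (1/2)^r * Real.exp (Λ + Λ^2/h - h/4) := by
  have h1 := sq_le_two_pow r
  have h2 := r_le_two_pow r
  have h3 : (2:ℝ) ≤ 2^r := by
    calc (2:ℝ) = 2^1 := by norm_num
      _ ≤ 2^r := by gcongr; norm_num
  have h4 : Λ * r ≤ Λ^2/h + h * 2^r/2 := by
    have : 0 ≤ (Λ - h * r/2)^2 / h := by positivity
    have e : (Λ - h * r/2)^2 / h = Λ^2/h - Λ * r + h * r^2/4 := by field_simp; ring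
    rw [e] at this
    nlinarith
  have h5 : (4:ℝ) * (2^r * 2^r) ≤ Real.exp (h * 2^r/2 - h/4) := by
    have e4 : (4:ℝ) ≤ Real.exp 2 := by
      have := Real.add_one_le_exp (1:ℝ)
      rw [show (2:ℝ) = 1 + 1 by norm_num, Real.exp_add]; nlinarith
    calc (4:ℝ) * (2^r * 2^r) = 4^(r+1) := by rw [← mul_pow, pow_succ]; norm_num; ring
      _ ≤ (Real.exp 2)^(r+1) := by gcongr
      _ = Real.exp (((r+1:ℕ):ℝ) * 2) := by rw [Real.exp_nat_mul]
      _ ≤ _ := by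
        apply Real.exp_le_exp.2
        push_cast
        nlinarith
  have h6 : (Real.exp (-h))^(2^r) = Real.exp (-(h * 2^r)) := by
    rw [← Real.exp_nat_mul]; push_cast; congr 1; ring
  rw [h6, one_div, inv_pow, ← div_eq_inv_mul, le_div_iff₀ (by positivity)]
  calc _ ≤ Real.exp (Λ * (r + 1)) * (2 * ((2 * r + 1 : ℕ) + 1) * Real.exp (-(h * 2^r))) * 2^r := le_rfl
    _ = (4 * ((r + 1) * 2^r)) * Real.exp (Λ * (r + 1) + -(h * 2^r)) := by rw [Real.exp_add]; push_cast; ring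
    _ ≤ (4 * (2^r * 2^r)) * Real.exp (Λ + Λ^2/h + -(h * 2^r/2)) := by
      refine mul_le_mul ?_ (Real.exp_le_exp.2 (by linarith)) (by positivity) (by positivity)
      gcongr
    _ ≤ Real.exp (h * 2^r/2 - h/4) * Real.exp (Λ + Λ^2/h + -(h * 2^r/2)) := by gcongr
    _ = _ := by rw [← Real.exp_add]; congr 1; ring

def Abd (β a Λ : ℝ) : ℝ := Real.exp (Λ * a) + 4 * 10^5 * Real.exp (Λ - g0 β * a^2/24) + Real.exp (Λ + Λ^2/hh β - hh β/4)

lemma half_sum (k : ℕ) : ∑ r ∈ Finset.Icc 1 k, ((1:ℝ)/2)^r ≤ 1 := by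
  have : ∀ k : ℕ, ∑ r ∈ Finset.Icc 1 k, ((1:ℝ)/2)^r = 1 - (1/2)^k := by
    intro k
    induction k with
    | zero => simp
    | succ k ih => rw [Finset.sum_Icc_succ_top (by omega), ih, pow_succ]; ring
  rw [this]; have : (0:ℝ) < (1/2)^k := by positivity
  linarith

set_option maxHeartbeats 1000000 in
lemma Alem {β : ℝ} (hβ : 0 < β) (hh8 : 8 ≤ hh β) {k : ℕ} {z z' : Site} (hzz : anc k z' = anc k z) {a Λ : ℝ} (ha : 0 < a) (ha1 : a ≤ 1) (hΛ : 0 ≤ Λ) :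
    Dom β (cellE k (anc k z)) (fun t => ind (chaincore t k z ∧ chaincore t k z') * ENNReal.ofReal (Real.exp (Λ * |t z - t z'|))) (ENNReal.ofReal (Abd β a Λ)) := by
  have both : ∀ (r : ℕ) (hr : r ≤ k) (s : ℝ) (hs : 0 < s) (hs1 : s ≤ 1) (N : ℕ) (c : ℝ), 0 ≤ c →
      Dom β (cellE k (anc k z)) (fun t => ENNReal.ofReal c * (ind (OrdEv t k r z z' s N) + ind (OrdEv t k r z' z s N)))
        (ENNReal.ofReal (c * (2 * (N + 1) * (10^5 * Real.exp (-(g0 β * s^2/24)))^(2^r)))) := by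
    intro r hr s hs hs1 N c hc
    have d1 := ordEv_dom hβ hr hzz hs hs1 N
    have d2 := ordEv_dom hβ hr hzz.symm hs hs1 N
    rw [hzz] at d2
    refine ((d1.add d2).const_mul (ENNReal.ofReal c)).mono (fun t => le_rfl) ?_
    rw [← ENNReal.ofReal_add (by positivity) (by positivity), ← ENNReal.ofReal_mul hc]
    apply ENNReal.ofReal_le_ofReal
    apply le_of_eq; ring
  have D0 := (Dom.one (E := cellE k (anc k z)) hβ.le).const_mul (ENNReal.ofReal (Real.exp (Λ * a)))
  have D1 := both 0 (Nat.zero_le _) a ha ha1 1 (Real.exp Λ) (Real.exp_pos _).le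
  have D2 := Dom.sum (β := β) (E := cellE k (anc k z)) (Finset.Icc 1 k) _ _ (fun r hr => both r (Finset.mem_Icc.1 hr).2 (1/2) (by norm_num) (by norm_num) (2*r+1) (Real.exp (Λ * (r+1))) (Real.exp_pos _).le)
  refine ((D0.add D1).add D2).mono (fun t => ?_) ?_
  · by_cases hcc : chaincore t k z ∧ chaincore t k z'
    swap
    · rw [ind_false hcc, zero_mul]; exact zero_le
    rw [ind_true hcc, one_mul]
    have hor : ∀ (r : ℕ) (s : ℝ) (N : ℕ), s ≤ |TT t r (anc r z) - TT t r (anc r z')| → |TT t r (anc r z) - TT t r (anc r z')| ≤ N →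
        1 ≤ ind (OrdEv t k r z z' s N) + ind (OrdEv t k r z' z s N) := by
      intro r s N h1 h2
      rw [abs_le] at h2
      rcases le_abs.1 h1 with h | h
      · have : OrdEv t k r z z' s N := ⟨hcc, by linarith, by linarith⟩
        rw [ind_true this]; exact le_self_add
      · have : OrdEv t k r z' z s N := ⟨hcc.symm, by linarith, by linarith⟩
        rw [ind_true this]; exact le_add_self
    have hclose : ∀ r ≤ k, |(t z - t z') - (TT t r (anc r z) - TT t r (anc r z'))| ≤ r/50 := by
      intro r hr
      have h1 := chain_T (r := 0) (n := r) (z := z) (by simpa using hcc.1.mono hr)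
      have h2 := chain_T (r := 0) (n := r) (z := z') (by simpa using hcc.2.mono hr)
      simp only [zero_add, TT_zero, anc_zero] at h1 h2
      rw [abs_le] at *
      constructor <;> linarith
    by_cases c0 : |t z - t z'| ≤ a
    · refine le_trans ?_ (le_add_right le_self_add)
      rw [mul_one]
      apply ENNReal.ofReal_le_ofReal
      gcongr
    push Not at c0
    by_cases c1 : |t z - t z'| ≤ 1
    · refine le_trans ?_ (le_add_right le_add_self)
      have h := hor 0 a 1 (by simpa [TT_zero, anc_zero] using c0.le) (by simpa [TT_zero, anc_zero] using c1)
      calc _ ≤ ENNReal.ofReal (Real.exp Λ) * 1 := by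
            rw [mul_one]; apply ENNReal.ofReal_le_ofReal; apply Real.exp_le_exp.2; nlinarith
        _ ≤ _ := by gcongr
    push Not at c1
    set r := ⌊|t z - t z'|⌋₊ with hr
    have r1 : (r:ℝ) ≤ |t z - t z'| := Nat.floor_le (abs_nonneg _)
    have r2 : |t z - t z'| < r + 1 := Nat.lt_floor_add_one _
    have r3 : 1 ≤ r := Nat.le_floor (by exact_mod_cast c1.le)
    have r3' : (1:ℝ) ≤ r := by exact_mod_cast r3
    have r4 : r ≤ k := by
      have := hclose k le_rfl
      rw [hzz, sub_self, sub_zero] at this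
      have : (r:ℝ) ≤ k := by
        have : (0:ℝ) ≤ k := Nat.cast_nonneg k
        linarith
      exact_mod_cast this
    refine le_trans ?_ le_add_self
    refine le_trans ?_ (Finset.single_le_sum (fun i _ => zero_le) (Finset.mem_Icc.2 ⟨r3, r4⟩))
    have hc := hclose r r4
    have t1 := abs_sub_abs_le_abs_sub (t z - t z') (TT t r (anc r z) - TT t r (anc r z'))
    have t2 := abs_sub_abs_le_abs_sub (TT t r (anc r z) - TT t r (anc r z')) (t z - t z')
    rw [abs_sub_comm (TT t r (anc r z) - TT t r (anc r z'))] at t2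
    have h := hor r (1/2) (2*r+1) (by linarith) (by push_cast; linarith)
    calc _ ≤ ENNReal.ofReal (Real.exp (Λ * (r + 1))) * 1 := by
            rw [mul_one]; apply ENNReal.ofReal_le_ofReal; apply Real.exp_le_exp.2; gcongr
      _ ≤ _ := by gcongr
  · rw [mul_one, ← ENNReal.ofReal_sum_of_nonneg (fun i _ => by positivity), ← ENNReal.ofReal_add (by positivity) (by positivity), ← ENNReal.ofReal_add (by positivity) (Finset.sum_nonneg fun i _ => by positivity)]
    apply ENNReal.ofReal_le_ofReal
    unfold Abd
    refine add_le_add (add_le_add le_rfl (le_of_eq ?_)) ?_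
    · rw [sub_eq_add_neg, Real.exp_add]; norm_num; ring
    · calc _ ≤ ∑ r ∈ Finset.Icc 1 k, (1/2)^r * Real.exp (Λ + Λ^2/hh β - hh β/4) := by
            apply Finset.sum_le_sum
            intro r hr
            rw [exp_hh]
            exact term_le hh8 r (Finset.mem_Icc.1 hr).1
        _ ≤ 1 * Real.exp (Λ + Λ^2/hh β - hh β/4) := by
            rw [← Finset.sum_mul]
            gcongr
            exact half_sum k
        _ = _ := one_mul _

end

end PartC2

section PartD1
open scoped BigOperators Classical ENNReal
open MeasureTheory Matrix
noncomputable section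

inductive Atom
  | cell (k : ℕ) (x z : Site)
  | edge (e : Edge)

def Atom.reg : Atom → Finset Edge
  | .cell k x _ => cellE k (anc k x)
  | .edge e => {e}

def Atom.ok : Atom → Prop
  | .cell k x z => anc k z = anc k x
  | .edge _ => True

def Atom.val (lam : ℝ) (j : ℕ) (t : Fld) : Atom → ℝ≥0∞
  | .cell k x z => ind (∀ m, j ≤ m → m < k → fine t m x ∧ fine t m z) * ENNReal.ofReal (Real.exp (lam * |t x - t z|))
  | .edge e => ENNReal.ofReal (Real.exp (lam * |t e.1 - t (e.1 + ev e.2)|))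

def OKL (R : Finset Edge) (G : List Atom) : Prop :=
  (∀ a ∈ G, a.ok ∧ a.reg ⊆ R) ∧ G.Pairwise (fun a b => Disjoint a.reg b.reg)

lemma OKL.mono {R R' : Finset Edge} {G : List Atom} (h : OKL R G) (hR : R ⊆ R') : OKL R' G :=
  ⟨fun a ha => ⟨(h.1 a ha).1, (h.1 a ha).2.trans hR⟩, h.2⟩

lemma OKL.nil (R : Finset Edge) : OKL R [] := ⟨by simp, by simp⟩

lemma OKL.single {a : Atom} (h : a.ok) : OKL a.reg [a] := ⟨by simpa using h, by simp⟩

lemma OKL.append {R R' : Finset Edge} {G G' : List Atom} (h : OKL R G) (h' : OKL R' G') (hd : Disjoint R R') : OKL (R ∪ R') (G ++ G') := by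
  refine ⟨fun a ha => ?_, ?_⟩
  · rcases List.mem_append.1 ha with ha | ha
    · exact (h.mono Finset.subset_union_left).1 a ha
    · exact (h'.mono Finset.subset_union_right).1 a ha
  · rw [List.pairwise_append]
    exact ⟨h.2, h'.2, fun a ha b hb => Finset.disjoint_of_subset_left (h.1 a ha).2 (Finset.disjoint_of_subset_right (h'.1 b hb).2 hd)⟩

lemma OKL.tail {R : Finset Edge} {a : Atom} {G : List Atom} (h : OKL R (a :: G)) : OKL (R \ a.reg) G := by
  have hp := List.pairwise_cons.1 h.2
  refine ⟨fun b hb => ⟨(h.1 b (by simp [hb])).1, ?_⟩, hp.2⟩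
  rw [Finset.subset_sdiff]
  exact ⟨(h.1 b (by simp [hb])).2, (hp.1 b hb).symm⟩

def PV (lam : ℝ) (j : ℕ) (t : Fld) (G : List Atom) : ℝ≥0∞ := (G.map (Atom.val lam j t)).prod

def Claim (μ : Measure Fld) (WE : Set Edge) (lam : ℝ) (j : ℕ) : Prop :=
  ∀ G R, OKL R G → (∀ e ∈ R, e ∈ WE) → UB μ (fun t => PV lam j t G) (3 ^ G.length)

structure Opn (β : ℝ) (R : Finset Edge) where
  G : List Atom
  f1 : Fld → ℝ≥0∞
  f2 : Fld → ℝ≥0∞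
  q1 : ℝ≥0∞
  q2 : ℝ≥0∞
  ok : OKL R G
  d1 : Dom β R f1 q1
  d2 : Dom β R f2 q2

def Opn.v {β : ℝ} {R : Finset Edge} (o : Opn β R) (x y lam : ℝ) (j : ℕ) (t : Fld) : ℝ≥0∞ :=
  PV lam j t o.G ^ x * o.f1 t ^ y * o.f2 t ^ y
def Opn.c {β : ℝ} {R : Finset Edge} (o : Opn β R) (x y : ℝ) : ℝ≥0∞ :=
  ((3:ℝ≥0∞) ^ o.G.length) ^ x * o.q1 ^ y * o.q2 ^ y

def Good (β x y lam : ℝ) (j : ℕ) (R : Finset Edge) (v : Fld → ℝ≥0∞) (c : ℝ≥0∞) : Prop :=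
  ∃ l : List (Opn β R), (∀ t, v t ≤ (l.map fun o => o.v x y lam j t).sum) ∧ (l.map fun o => o.c x y).sum ≤ c

section
variable {β x y lam : ℝ} {j : ℕ} {R : Finset Edge} {v w : Fld → ℝ≥0∞} {c d : ℝ≥0∞}

lemma Good.mono (h : Good β x y lam j R v c) (hv : ∀ t, w t ≤ v t) (hc : c ≤ d) : Good β x y lam j R w d := by
  obtain ⟨l, h1, h2⟩ := h
  exact ⟨l, fun t => (hv t).trans (h1 t), h2.trans hc⟩

lemma Good.add (h : Good β x y lam j R v c) (h' : Good β x y lam j R w d) : Good β x y lam j R (fun t => v t + w t) (c + d) := by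
  obtain ⟨l, h1, h2⟩ := h
  obtain ⟨l', h1', h2'⟩ := h'
  refine ⟨l ++ l', fun t => ?_, ?_⟩
  · rw [List.map_append, List.sum_append]; exact add_le_add (h1 t) (h1' t)
  · rw [List.map_append, List.sum_append]; exact add_le_add h2 h2'

lemma Good.sum {ι : Type*} (s : Finset ι) (v : ι → Fld → ℝ≥0∞) (c : ι → ℝ≥0∞) (h : ∀ i ∈ s, Good β x y lam j R (v i) (c i)) :
    Good β x y lam j R (fun t => ∑ i ∈ s, v i t) (∑ i ∈ s, c i) := by
  induction s using Finset.induction_on with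
  | empty => exact ⟨[], by simp, by simp⟩
  | insert a s ha ih =>
    simp only [Finset.sum_insert ha]
    exact (h a (by simp)).add (ih fun i hi => h i (by simp [hi]))

lemma Opn.good (o : Opn β R) : Good β x y lam j R (o.v x y lam j) (o.c x y) := ⟨[o], by simp, by simp⟩
end

lemma UB.lsum {μ : Measure Fld} {ι : Type*} (l : List ι) (f : ι → Fld → ℝ≥0∞) (q : ι → ℝ≥0∞) (h : ∀ i ∈ l, UB μ (f i) (q i)) :
    UB μ (fun t => (l.map fun i => f i t).sum) (l.map q).sum := by
  induction l with
  | nil => simpa using UB.zero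
  | cons a l ih =>
    simp only [List.map_cons, List.sum_cons]
    exact (h a (by simp)).add (ih fun i hi => h i (by simp [hi]))

lemma PV_append (lam : ℝ) (j : ℕ) (t : Fld) (G G' : List Atom) : PV lam j t (G ++ G') = PV lam j t G * PV lam j t G' := by
  simp [PV]

lemma step_aux {μ : Measure Fld} {β x y lam lam' : ℝ} {j : ℕ} {WE : Set Edge} (hT : HT μ β WE) (hC : Claim μ WE lam j)
    (hx : 0 ≤ x) (hy : 0 ≤ y) (hxy : x + y + y = 1)
    (hG : ∀ a : Atom, a.ok → Good β x y lam j a.reg (fun t => a.val lam' (j+1) t) 3) (F : List Atom) :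
    ∀ (R E0 : Finset Edge) (G : List Atom) (h1 h2 : Fld → ℝ≥0∞) (q1 q2 : ℝ≥0∞), OKL R F → Disjoint R E0 → OKL E0 G →
      Dom β E0 h1 q1 → Dom β E0 h2 q2 → (∀ e ∈ R, e ∈ WE) → (∀ e ∈ E0, e ∈ WE) →
      UB μ (fun t => PV lam' (j+1) t F * (PV lam j t G ^ x * h1 t ^ y * h2 t ^ y))
        (3 ^ F.length * (((3:ℝ≥0∞) ^ G.length) ^ x * q1 ^ y * q2 ^ y)) := by
  induction F with
  | nil =>
    intro R E0 G h1 h2 q1 q2 _ _ oG d1 d2 _ hE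
    refine (UB.holder3 (hC G E0 oG hE) (d1.toUB hT hE) (d2.toUB hT hE) x y y hx hy hy hxy).mono (fun t => ?_) ?_
    · simp [PV]
    · simp
  | cons a F ih =>
    intro R E0 G h1 h2 q1 q2 oF hd oG d1 d2 hR hE
    obtain ⟨l, l1, l2⟩ := hG a (oF.1 a (by simp)).1
    have haR := (oF.1 a (by simp)).2
    have hda : Disjoint E0 a.reg := (Finset.disjoint_of_subset_left haR hd).symm
    have key := UB.lsum (μ := μ) l (fun o t => PV lam' (j+1) t F * (PV lam j t (G ++ o.G) ^ x * (h1 t * o.f1 t) ^ y * (h2 t * o.f2 t) ^ y))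
      (fun o => 3 ^ F.length * (((3:ℝ≥0∞) ^ (G ++ o.G).length) ^ x * (q1 * o.q1) ^ y * (q2 * o.q2) ^ y)) (by
        intro o _
        refine ih (R \ a.reg) (E0 ∪ a.reg) _ _ _ _ _ oF.tail ?_ (oG.append o.ok hda) (Dom.mul hda d1 o.d1) (Dom.mul hda d2 o.d2) ?_ ?_
        · rw [Finset.disjoint_union_right]
          exact ⟨Finset.disjoint_of_subset_left Finset.sdiff_subset hd, Finset.sdiff_disjoint⟩
        · intro e he; exact hR e (Finset.sdiff_subset he)
        · intro e he
          rcases Finset.mem_union.1 he with he | he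
          · exact hE e he
          · exact hR e (haR he))
    refine key.mono (fun t => ?_) ?_
    · have e : ∀ o : Opn β a.reg, PV lam' (j+1) t F * (PV lam j t (G ++ o.G) ^ x * (h1 t * o.f1 t) ^ y * (h2 t * o.f2 t) ^ y)
          = (PV lam' (j+1) t F * (PV lam j t G ^ x * h1 t ^ y * h2 t ^ y)) * o.v x y lam j t := by
        intro o
        rw [PV_append, ENNReal.mul_rpow_of_nonneg _ _ hx, ENNReal.mul_rpow_of_nonneg _ _ hy, ENNReal.mul_rpow_of_nonneg _ _ hy, Opn.v]
        ring
      simp only [e]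
      rw [List.sum_map_mul_left]
      have : PV lam' (j+1) t (a :: F) = PV lam' (j+1) t F * a.val lam' (j+1) t := by simp [PV, mul_comm]
      rw [this]
      calc _ = (PV lam' (j+1) t F * (PV lam j t G ^ x * h1 t ^ y * h2 t ^ y)) * a.val lam' (j+1) t := by ring
        _ ≤ _ := by gcongr; exact l1 t
    · have e : ∀ o : Opn β a.reg, (3:ℝ≥0∞) ^ F.length * (((3:ℝ≥0∞) ^ (G ++ o.G).length) ^ x * (q1 * o.q1) ^ y * (q2 * o.q2) ^ y)
          = (3 ^ F.length * (((3:ℝ≥0∞) ^ G.length) ^ x * q1 ^ y * q2 ^ y)) * o.c x y := by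
        intro o
        rw [List.length_append, pow_add, ENNReal.mul_rpow_of_nonneg _ _ hx, ENNReal.mul_rpow_of_nonneg _ _ hy, ENNReal.mul_rpow_of_nonneg _ _ hy, Opn.c]
        ring
      simp only [e]
      rw [List.sum_map_mul_left]
      calc _ ≤ (3 ^ F.length * (((3:ℝ≥0∞) ^ G.length) ^ x * q1 ^ y * q2 ^ y)) * 3 := by gcongr
        _ = _ := by rw [List.length_cons, pow_succ]; ring

lemma claim_step {μ : Measure Fld} {β x y lam lam' : ℝ} {j : ℕ} {WE : Set Edge} (hβ : 0 ≤ β) (hT : HT μ β WE) (hC : Claim μ WE lam j)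
    (hx : 0 ≤ x) (hy : 0 ≤ y) (hxy : x + y + y = 1)
    (hG : ∀ a : Atom, a.ok → Good β x y lam j a.reg (fun t => a.val lam' (j+1) t) 3) : Claim μ WE lam' (j+1) := by
  intro F R hF hR
  have := step_aux hT hC hx hy hxy hG F R ∅ [] _ _ _ _ hF (by simp) (OKL.nil _) (Dom.one hβ) (Dom.one hβ) hR (by simp)
  refine this.mono (fun t => ?_) ?_
  · simp [PV]
  · simp

lemma claim_zero {μ : Measure Fld} {β lam : ℝ} {WE : Set Edge} (hβ : 0 ≤ β) (hT : HT μ β WE)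
    (h : ∀ a : Atom, a.ok → Dom β a.reg (fun t => a.val lam 0 t) 3) : Claim μ WE lam 0 := by
  have : ∀ (F : List Atom) (R : Finset Edge), OKL R F → Dom β R (fun t => PV lam 0 t F) (3 ^ F.length) := by
    intro F
    induction F with
    | nil => intro R _; simpa [PV] using Dom.one hβ
    | cons a F ih =>
      intro R hF
      have h1 := h a (hF.1 a (by simp)).1
      have h2 := Dom.mul Finset.disjoint_sdiff h1 (ih _ hF.tail)
      refine (h2.mono_E hβ ?_).mono (fun t => by simp [PV]) (by rw [List.length_cons, pow_succ, mul_comm])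
      rw [Finset.union_sdiff_of_subset (hF.1 a (by simp)).2]
  exact fun F R hF hR => (this F R hF).toUB hT hR

end

end PartD1

section PartD2
open scoped BigOperators Classical ENNReal
open MeasureTheory Matrix
noncomputable section

lemma dist1_step' {a b : Site} {i : Fin 3} (h : b i ≤ a i) : dist1 (a + ev i) b = dist1 a b + 1 := by
  unfold dist1
  rw [← Finset.add_sum_erase _ _ (Finset.mem_univ i), ← Finset.add_sum_erase (a := i) (f := fun j => (a j - b j) + (b j - a j)) _ (Finset.mem_univ i)]
  have h1 : ∀ j ∈ Finset.univ.erase i, ((a + ev i) j - b j) + (b j - (a + ev i) j) = (a j - b j) + (b j - a j) := by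
    intro j hj
    have : j ≠ i := Finset.ne_of_mem_erase hj
    simp [ev_apply, this]
  rw [Finset.sum_congr rfl h1]
  simp only [Pi.add_apply, ev_apply, if_true]
  omega

lemma lift_step (j : ℕ) (P : Site) (i : Fin 3) : ∃ u, anc j u = P ∧ anc j (u + ev i) = P + ev i := by
  have hp : 0 < rh^j := Nat.pos_of_ne_zero (pow_ne_zero _ rh_pos.ne')
  refine ⟨fun l => rh^j * P l + (if l = i then rh^j - 1 else 0), ?_, ?_⟩
  · funext l
    simp only [anc]
    rw [div_eq_iff_Ico hp, mul_add]
    split_ifs <;> omega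
  · funext l
    simp only [anc, Pi.add_apply, ev_apply]
    rw [div_eq_iff_Ico hp]
    split_ifs <;> simp only [mul_add, mul_one, mul_zero, add_zero] <;> omega

def Atom.dif (t : Fld) : Atom → ℝ
  | .cell _ x z => |t x - t z|
  | .edge e => |t e.1 - t (e.1 + ev e.2)|

def Atom.lv (j : ℕ) : Atom → Prop
  | .cell k _ _ => k = j
  | .edge _ => True

def Rn (j : ℕ) (Q Z : Site) (n : ℕ) : Finset Edge :=
  (cellE (j+1) Q).filter fun e => dist1 (anc j e.1) Z ≤ n ∧ dist1 (anc j (e.1 + ev e.2)) Z ≤ n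

lemma mem_Rn {j : ℕ} {Q Z : Site} {n : ℕ} {e : Edge} : e ∈ Rn j Q Z n ↔ (anc 1 (anc j e.1) = Q ∧ anc 1 (anc j (e.1 + ev e.2)) = Q) ∧
    dist1 (anc j e.1) Z ≤ n ∧ dist1 (anc j (e.1 + ev e.2)) Z ≤ n := by
  rw [Rn, Finset.mem_filter, mem_cellE, anc_succ j e.1, anc_succ j (e.1 + ev e.2)]

def ChainP (j : ℕ) (Q : Site) (z : Site) (n : ℕ) (x : Site) : Prop :=
  ∃ G, OKL (Rn j Q (anc j z) n) G ∧ G.length ≤ 2 * n + 1 ∧ (∀ g ∈ G, g.lv j) ∧ ∀ t, |t x - t z| ≤ (G.map (Atom.dif t)).sum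

lemma chain_cons {j : ℕ} {Q z x u u' : Site} {n : ℕ} {e : Edge} (hu : anc j u = anc j x) (hd : dist1 (anc j x) (anc j z) = n + 1)
    (hd' : dist1 (anc j u') (anc j z) = n) (hQ : anc 1 (anc j x) = Q) (hQ' : anc 1 (anc j u') = Q)
    (he : (e.1 = u ∧ e.1 + ev e.2 = u') ∨ (e.1 = u' ∧ e.1 + ev e.2 = u)) (h : ChainP j Q z n u') : ChainP j Q z (n+1) x := by
  obtain ⟨G, o, len, lv, hG⟩ := h
  have o1 : OKL (cellE j (anc j x)) [Atom.cell j x u] := OKL.single (a := Atom.cell j x u) hu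
  have o2 : OKL {e} [Atom.edge e] := OKL.single (a := Atom.edge e) trivial
  have hne : anc j u ≠ anc j u' := by
    intro h; rw [← h, hu, hd] at hd'; omega
  have dj1 : Disjoint (cellE j (anc j x)) {e} := by
    rw [Finset.disjoint_singleton_right, mem_cellE]
    rintro ⟨a, b⟩
    rcases he with ⟨h1, h2⟩ | ⟨h1, h2⟩ <;> rw [h1] at a <;> rw [h2] at b
    · exact hne (a.trans b.symm)
    · exact hne (b.trans a.symm)
  have dj2 : Disjoint (cellE j (anc j x) ∪ {e}) (Rn j Q (anc j z) n) := by
    rw [Finset.disjoint_left]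
    intro f hf hf'
    rw [mem_Rn] at hf'
    rcases Finset.mem_union.1 hf with hf | hf
    · rw [mem_cellE] at hf
      rw [hf.1, hd] at hf'; omega
    · rw [Finset.mem_singleton] at hf; subst hf
      rcases he with ⟨h1, h2⟩ | ⟨h1, h2⟩ <;> rw [h2, h1, hu, hd] at hf' <;> omega
  refine ⟨([Atom.cell j x u] ++ [Atom.edge e]) ++ G, ((o1.append o2 dj1).append o dj2).mono ?_, ?_, ?_, ?_⟩
  · intro f hf
    rw [mem_Rn]
    rcases Finset.mem_union.1 hf with hf | hf
    · rcases Finset.mem_union.1 hf with hf | hf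
      · rw [mem_cellE] at hf
        rw [hf.1, hf.2]; exact ⟨⟨hQ, hQ⟩, hd.le, hd.le⟩
      · rw [Finset.mem_singleton] at hf; subst hf
        rcases he with ⟨h1, h2⟩ | ⟨h1, h2⟩ <;> rw [h2, h1, hu]
        · exact ⟨⟨hQ, hQ'⟩, hd.le, by omega⟩
        · exact ⟨⟨hQ', hQ⟩, by omega, hd.le⟩
    · rw [mem_Rn] at hf
      exact ⟨hf.1, by omega, by omega⟩
  · simp; omega
  · intro g hg
    simp only [List.mem_append, List.mem_singleton] at hg
    rcases hg with (rfl | rfl) | hg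
    · rfl
    · trivial
    · exact lv g hg
  · intro t
    have := hG t
    simp only [List.map_append, List.map_cons, List.map_nil, List.sum_append, List.sum_cons, List.sum_nil, add_zero, Atom.dif]
    have h1 : |t e.1 - t (e.1 + ev e.2)| = |t u - t u'| := by
      rcases he with ⟨h1, h2⟩ | ⟨h1, h2⟩ <;> rw [h2, h1]
      rw [abs_sub_comm]
    rw [h1]
    have a1 := abs_sub_le (t x) (t u) (t z)
    have a2 := abs_sub_le (t u) (t u') (t z)
    linarith

lemma chain_ex (j : ℕ) (Q z : Site) (hz : anc 1 (anc j z) = Q) (n : ℕ) : ∀ x, anc 1 (anc j x) = Q → dist1 (anc j x) (anc j z) = n → ChainP j Q z n x := by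
  induction n with
  | zero =>
    intro x hx hd
    have h := dist1_eq_zero hd
    have o1 : OKL (cellE j (anc j x)) [Atom.cell j x z] := OKL.single (a := Atom.cell j x z) h.symm
    refine ⟨[Atom.cell j x z], o1.mono ?_, by simp, by simp [Atom.lv], by simp [Atom.dif]⟩
    intro f hf
    rw [mem_cellE] at hf
    rw [mem_Rn, hf.1, hf.2, hd]
    exact ⟨⟨hx, hx⟩, le_rfl, le_rfl⟩
  | succ n ih =>
    intro x hx hd
    have : ∃ i, anc j x i ≠ anc j z i := by
      by_contra hc
      push Not at hc
      rw [show anc j x = anc j z from funext hc] at hd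
      simp [dist1] at hd
    obtain ⟨i, hi⟩ := this
    have hr : 0 < rh^1 := by rw [pow_one]; exact rh_pos
    have hxi : ∀ l, anc j x l / rh^1 = Q l := fun l => congrFun hx l
    have hzi : ∀ l, anc j z l / rh^1 = Q l := fun l => congrFun hz l
    rcases lt_or_gt_of_ne hi with hi | hi
    · obtain ⟨u, hu, hu'⟩ := lift_step j (anc j x) i
      have h1 := dist1_step hi
      have hd' : dist1 (anc j (u + ev i)) (anc j z) = n := by rw [hu']; omega
      have hQ' : anc 1 (anc j (u + ev i)) = Q := by
        rw [hu']
        funext l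
        have a := hxi l
        have b := hzi l
        show (anc j x l + ev i l) / rh^1 = Q l
        rw [ev_apply]
        rw [div_eq_iff_Ico hr] at *
        split_ifs with hl
        · subst hl; omega
        · omega
      exact chain_cons (e := (u, i)) hu hd hd' hx hQ' (Or.inl ⟨rfl, rfl⟩) (ih _ hQ' hd')
    · set P' : Site := fun l => anc j x l - ev i l with hP'
      have hP : P' + ev i = anc j x := by
        funext l
        simp only [hP', Pi.add_apply, ev_apply]
        split_ifs with hl
        · subst hl; omega
        · rfl
      obtain ⟨u', hu', hu⟩ := lift_step j P' i
      rw [hP] at hu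
      have h1 := dist1_step' (a := P') (b := anc j z) (i := i) (by simp only [hP', ev_apply, if_true]; omega)
      rw [hP] at h1
      have hd' : dist1 (anc j u') (anc j z) = n := by rw [hu']; omega
      have hQ' : anc 1 (anc j u') = Q := by
        rw [hu']
        funext l
        have a := hxi l
        have b := hzi l
        show (anc j x l - ev i l) / rh^1 = Q l
        rw [ev_apply]
        rw [div_eq_iff_Ico hr] at *
        split_ifs with hl
        · subst hl; omega
        · omega
      exact chain_cons (e := (u', i)) hu hd hd' hx hQ' (Or.inr ⟨rfl, rfl⟩) (ih _ hQ' hd')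

def Nc : ℕ := 6 * rh + 1

lemma chain_full (j : ℕ) (x z : Site) (h : anc (j+1) z = anc (j+1) x) :
    ∃ G, OKL (cellE (j+1) (anc (j+1) x)) G ∧ G.length ≤ Nc ∧ (∀ g ∈ G, g.lv j) ∧ ∀ t, |t x - t z| ≤ (G.map (Atom.dif t)).sum := by
  rw [anc_succ j z, anc_succ j x] at h
  obtain ⟨G, o, len, lv, hG⟩ := chain_ex j (anc 1 (anc j x)) z h _ x rfl rfl
  refine ⟨G, o.mono ?_, len.trans ?_, lv, hG⟩
  · rw [anc_succ j x]; exact Finset.filter_subset _ _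
  · have hr : 0 < rh^1 := by rw [pow_one]; exact rh_pos
    have : dist1 (anc j x) (anc j z) ≤ 3 * rh := by
      unfold dist1
      refine (Finset.sum_le_card_nsmul _ _ rh fun l _ => ?_).trans (by simp)
      have a : anc j z l / rh^1 = anc j x l / rh^1 := congrFun h l
      rw [div_eq_iff_Ico hr, pow_one] at a
      have b := Nat.div_mul_le_self (anc j x l) rh
      have c := Nat.lt_div_mul_add (a := anc j x l) rh_pos
      rw [mul_comm] at b c
      rw [mul_add, mul_one] at a
      omega
    unfold Nc; omega

end

end PartD2

section PartD3
open scoped BigOperators Classical ENNReal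
open MeasureTheory Matrix
noncomputable section

lemma core_of_fine {t : Fld} {m : ℕ} {z : Site} (h : fine t m z) : Core t m (anc (m+1) z) (anc m z) :=
  ⟨fun e _ he _ hi _ => absurd hi (h e he), (anc_succ m z).symm, Or.inr h⟩

lemma fine_congr {t : Fld} {m : ℕ} {z z' : Site} (h : anc (m+1) z = anc (m+1) z') : fine t m z ↔ fine t m z' := by
  unfold fine; rw [h]

lemma anc_le {j k : ℕ} (h : j ≤ k) {z z' : Site} (hz : anc j z = anc j z') : anc k z = anc k z' := by
  obtain ⟨n, rfl⟩ := Nat.exists_eq_add_of_le h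
  rw [← anc_add, ← anc_add, hz]

lemma core_ex {t : Fld} (k : ℕ) : ∀ Q, valid t k Q → ∃ z, anc k z = Q ∧ chaincore t k z := by
  induction k with
  | zero => intro Q _; exact ⟨Q, anc_zero Q, fun m hm => by omega⟩
  | succ k ih =>
    intro Q h
    have hc := Core_chd h (o := 0) (by norm_num)
    obtain ⟨z, h1, h2⟩ := ih _ (valid_chd h (o := 0) (by norm_num))
    have h3 : anc (k+1) z = Q := by rw [anc_succ, h1]; exact hc.2.1
    refine ⟨z, h3, fun m hm => ?_⟩
    rcases Nat.lt_succ_iff_lt_or_eq.1 hm with hm | rfl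
    · exact h2 m hm
    · rw [h3, h1]; exact hc

lemma valid_of_fine {t : Fld} {m : ℕ} {x : Site} (h : fine t m x) : valid t m (anc m x) := by
  have hr : 0 < rh^1 := by rw [pow_one]; exact rh_pos
  have hr2 : 2 ≤ rh^1 := by rw [pow_one, rh_eq, sg_eq]; norm_num
  set P := anc m x with hP
  have hQ : anc (m+1) x = anc 1 P := anc_succ m x
  have key : ∀ e : Edge, anc 1 e.1 = anc 1 P → anc 1 (e.1 + ev e.2) = anc 1 P → valid t m e.1 ∧ valid t m (e.1 + ev e.2) := by
    intro e h1 h2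
    apply valid_of_not_BB
    intro hb
    refine h e hb ?_
    rw [hQ]
    exact ⟨h1, h2⟩
  by_cases hc : anc 1 (P + ev 0) = anc 1 P
  · exact (key (P, 0) rfl hc).1
  · have h0 : ¬ (P 0 + 1) / rh^1 = P 0 / rh^1 := by
      intro h0
      apply hc
      funext l
      show (P l + ev 0 l) / rh^1 = P l / rh^1
      rw [ev_apply]
      split_ifs with hl
      · subst hl; exact h0
      · rw [add_zero]
    have h0' := h0
    have a1 := Nat.div_mul_le_self (P 0) (rh^1)
    have a2 := Nat.lt_div_mul_add (a := P 0) hr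
    rw [div_eq_iff_Ico hr, mul_add, mul_comm] at h0
    have hpos : 1 ≤ P 0 := by omega
    set P' : Site := fun l => P l - ev 0 l with hP'
    have hPP : P' + ev 0 = P := by
      funext l
      simp only [hP', Pi.add_apply, ev_apply]
      split_ifs with hl
      · subst hl; omega
      · rfl
    have hP1 : anc 1 P' = anc 1 P := by
      funext l
      show (P l - ev 0 l) / rh^1 = P l / rh^1
      rw [ev_apply]
      split_ifs with hl
      · subst hl
        rw [div_eq_iff_Ico hr, mul_add, mul_comm]
        omega
      · rfl
    have := (key (P', 0) hP1 (by simp only [hPP])).2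
    simpa only [hPP] using this

lemma cc_extend {t : Fld} {j k : ℕ} {x z : Site} (h : chaincore t j z) (hz : anc j z = anc j x) (hf : ∀ m, j ≤ m → m < k → fine t m x) : chaincore t k z := by
  intro m hm
  by_cases hj : m < j
  · exact h m hj
  · push Not at hj
    exact core_of_fine ((fine_congr (anc_le (by omega) hz)).2 (hf m hj hm))

lemma val_lv {lam : ℝ} {j : ℕ} {t : Fld} {g : Atom} (h : g.lv j) : g.val lam j t = ENNReal.ofReal (Real.exp (lam * g.dif t)) := by
  cases g with
  | cell k x z =>
    have h : k = j := h
    subst h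
    simp only [Atom.val, Atom.dif]
    rw [ind_true (fun m h1 h2 => by omega), one_mul]
  | edge e => rfl

lemma PV_lv {lam : ℝ} {j : ℕ} {t : Fld} {G : List Atom} (h : ∀ g ∈ G, g.lv j) : PV lam j t G = ENNReal.ofReal (Real.exp (lam * (G.map (Atom.dif t)).sum)) := by
  induction G with
  | nil => simp [PV]
  | cons a G ih =>
    have := ih fun g hg => h g (by simp [hg])
    rw [PV] at this
    rw [PV, List.map_cons, List.prod_cons, this, val_lv (h a (by simp)), List.map_cons, List.sum_cons, mul_add, Real.exp_add, ENNReal.ofReal_mul (Real.exp_pos _).le]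

lemma oexp_rpow (a x : ℝ) : (ENNReal.ofReal (Real.exp a)) ^ x = ENNReal.ofReal (Real.exp (a * x)) := by
  rw [ENNReal.ofReal_rpow_of_pos (Real.exp_pos a), ← Real.exp_mul]

lemma cells_card' (k : ℕ) (Q : Site) : (cells k Q).card = (rh^k)^3 := by
  simp [cells, Fintype.card_piFinset, Nat.card_Ico, ← Nat.mul_sub]

/-- cost of one bad option -/
def Uc (β y lam' : ℝ) (j : ℕ) : ℝ≥0∞ :=
  3 ^ (2 * Nc) * ENNReal.ofReal (n1 * (Wb β)^(2^j)) ^ y * ENNReal.ofReal (Abd β 1 (lam' / y)) ^ y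

lemma Abd_one {β Λ : ℝ} (hΛ : 0 ≤ Λ) : 1 ≤ Abd β 1 Λ := by
  unfold Abd
  have h1 := Real.one_le_exp (x := Λ * 1) (by linarith)
  have h2 := Real.exp_pos (Λ - g0 β * 1^2/24)
  have h3 := Real.exp_pos (Λ + Λ^2/hh β - hh β/4)
  linarith

lemma three_pow_le {n N : ℕ} {x : ℝ} (hx0 : 0 ≤ x) (hx : x ≤ 1) (h : n ≤ N) : ((3:ℝ≥0∞)^n)^x ≤ 3^N := by
  calc ((3:ℝ≥0∞)^n)^x ≤ ((3:ℝ≥0∞)^n)^(1:ℝ) := ENNReal.rpow_le_rpow_of_exponent_le (one_le_pow₀ (by norm_num)) hx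
    _ = 3^n := ENNReal.rpow_one _
    _ ≤ 3^N := pow_le_pow_right₀ (by norm_num) h

section
variable {β x y lam lam' : ℝ} {j : ℕ}

lemma main_good (hβ : 0 ≤ β) {a : Atom} (ha : a.ok) : Good β x y lam j a.reg (fun t => a.val lam j t ^ x) (3 ^ x) := by
  refine (Opn.good ⟨[a], fun _ => 1, fun _ => 1, 1, 1, OKL.single ha, Dom.one hβ, Dom.one hβ⟩).mono (fun t => ?_) ?_
  · simp [Opn.v, PV]
  · simp [Opn.c]

lemma val_main (hx0 : 0 ≤ x) (hlx : lam * x = lam') {t : Fld} (a : Atom)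
    (h : ∀ k u w, a = Atom.cell k u w → (∀ m, j+1 ≤ m → m < k → fine t m u ∧ fine t m w) → j < k → fine t j u ∧ fine t j w) :
    a.val lam' (j+1) t ≤ a.val lam j t ^ x := by
  cases a with
  | edge e =>
    simp only [Atom.val]
    rw [oexp_rpow, ← hlx]
    apply ENNReal.ofReal_le_ofReal; apply Real.exp_le_exp.2; apply le_of_eq; ring
  | cell k u w =>
    simp only [Atom.val]
    by_cases hf : ∀ m, j+1 ≤ m → m < k → fine t m u ∧ fine t m w
    · have hf' : ∀ m, j ≤ m → m < k → fine t m u ∧ fine t m w := by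
        intro m h1 h2
        rcases Nat.lt_or_ge j m with h3 | h3
        · exact hf m h3 h2
        · obtain rfl : m = j := le_antisymm h3 h1
          exact h k u w rfl hf h2
      rw [ind_true hf, ind_true hf', one_mul, one_mul, oexp_rpow, ← hlx]
      apply ENNReal.ofReal_le_ofReal; apply Real.exp_le_exp.2; apply le_of_eq; ring
    · rw [ind_false hf, zero_mul]; exact zero_le

set_option maxHeartbeats 1000000 in
lemma atom_good (hβ : 0 < β) (hh8 : 8 ≤ hh β) (hl' : 0 ≤ lam') (hlx : lam * x = lam') (hx0 : 0 ≤ x) (hx1 : x ≤ 1) (hy : 0 < y)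
    {a : Atom} (ha : a.ok) :
    Good β x y lam j a.reg (fun t => a.val lam' (j+1) t) (3 ^ x + ((rh^(j+1))^3 * (rh^(j+1))^3 : ℕ) * (2 * Uc β y lam' j)) := by
  have hm := main_good (x := x) (y := y) (lam := lam) (j := j) hβ.le ha
  have hN : (1:ℝ≥0∞) ≤ ((rh^(j+1))^3 * (rh^(j+1))^3 : ℕ) := by
    have : 1 ≤ ((rh^(j+1))^3 * (rh^(j+1))^3 : ℕ) := Nat.pos_of_ne_zero (by have := rh_pos.ne'; positivity)
    exact_mod_cast this
  have hq2 : 1 ≤ ENNReal.ofReal (Abd β 1 (lam' / y)) ^ y := by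
    refine ENNReal.one_le_rpow ?_ hy
    rw [← ENNReal.ofReal_one]
    exact ENNReal.ofReal_le_ofReal (Abd_one (by positivity))
  have hU : Uc β y lam' j ≤ ((rh^(j+1))^3 * (rh^(j+1))^3 : ℕ) * (2 * Uc β y lam' j) := by
    calc Uc β y lam' j = 1 * (1 * Uc β y lam' j) := by ring
      _ ≤ _ := by gcongr; norm_num
  cases a with
  | edge e =>
    exact hm.mono (fun t => val_main hx0 hlx _ (by intro k u w h; cases h)) le_self_add
  | cell k u w =>
    have ha : anc k w = anc k u := ha
    by_cases hjk : j < k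
    swap
    · refine hm.mono (fun t => val_main hx0 hlx _ ?_) le_self_add
      rintro k' u' w' h _ h'
      cases h; exact absurd h' hjk
    have hsub : ∀ b, anc k b = anc k u → cellE (j+1) (anc (j+1) b) ⊆ cellE k (anc k u) := by
      intro b hb
      have := cellE_sub' (k := j+1) (r := k - (j+1)) (a := anc (j+1) b) (Q := anc k u) (by rw [anc_add, Nat.add_sub_cancel' hjk, hb])
      rwa [Nat.add_sub_cancel' hjk] at this
    have hnf : ∀ b, anc k b = anc k u → Dom β (cellE k (anc k u)) (fun t => ind (¬ fine t j b)) (ENNReal.ofReal (n1 * (Wb β)^(2^j))) :=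
      fun b hb => (nf_dom hβ j b).mono_E hβ.le (hsub b hb)
    by_cases hc : anc (j+1) w = anc (j+1) u
    · obtain ⟨G, oG, lG, lvG, hG⟩ := chain_full j u w hc
      let o : Opn β (Atom.cell k u w).reg := ⟨G, fun t => ind (¬ fine t j u), fun _ => 1, _, 1, oG.mono (hsub u rfl), hnf u rfl, Dom.one hβ.le⟩
      refine (hm.add o.good).mono (fun t => ?_) ?_
      · by_cases hf : fine t j u
        · refine (val_main hx0 hlx _ ?_).trans le_self_add
          intro k' u' w' h _ _
          cases h
          exact ⟨hf, (fine_congr hc).2 hf⟩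
        · refine le_trans ?_ le_add_self
          simp only [Opn.v, o]
          rw [ind_true hf, PV_lv lvG, oexp_rpow, ENNReal.one_rpow, mul_one, mul_one]
          calc _ ≤ 1 * ENNReal.ofReal (Real.exp (lam' * |t u - t w|)) := mul_le_mul_left (ind_le_one _) _
            _ ≤ _ := by
              rw [one_mul, mul_right_comm, hlx]
              apply ENNReal.ofReal_le_ofReal; apply Real.exp_le_exp.2
              exact mul_le_mul_of_nonneg_left (hG t) hl'
      · refine add_le_add le_rfl (le_trans ?_ hU)
        simp only [Opn.c, o, Uc]
        rw [ENNReal.one_rpow]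
        gcongr
        exact three_pow_le hx0 hx1 (by omega)
    · -- different cells
      have hch : ∀ b b', ∃ G, anc (j+1) b' = anc (j+1) b → OKL (cellE (j+1) (anc (j+1) b)) G ∧ G.length ≤ Nc ∧ (∀ g ∈ G, g.lv j) ∧ ∀ t, |t b - t b'| ≤ (G.map (Atom.dif t)).sum := by
        intro b b'
        by_cases h : anc (j+1) b' = anc (j+1) b
        · obtain ⟨G, hG⟩ := chain_full j b b' h
          exact ⟨G, fun _ => hG⟩
        · exact ⟨[], fun h' => absurd h' h⟩
      choose ch hch using hch
      let F2 : Site × Site → Fld → ℝ≥0∞ := fun p t => ind (chaincore t k p.1 ∧ chaincore t k p.2) * ENNReal.ofReal (Real.exp (lam' / y * |t p.1 - t p.2|))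
      let V : Site → Site × Site → Fld → ℝ≥0∞ := fun b p t => PV lam j t (ch u p.1 ++ ch w p.2) ^ x * ind (¬ fine t j b) ^ y * F2 p t ^ y
      have hV : ∀ b, anc k b = anc k u → ∀ p ∈ cells (j+1) (anc (j+1) u) ×ˢ cells (j+1) (anc (j+1) w),
          Good β x y lam j (Atom.cell k u w).reg (V b p) (Uc β y lam' j) := by
        intro b hb p hp
        rw [Finset.mem_product, mem_cells, mem_cells] at hp
        obtain ⟨o1, l1, v1, d1⟩ := hch u p.1 hp.1
        obtain ⟨o2, l2, v2, d2⟩ := hch w p.2 hp.2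
        have e1 : anc k p.1 = anc k u := anc_le hjk hp.1
        have e2 : anc k p.2 = anc k u := (anc_le hjk hp.2).trans ha
        have D2 := Alem hβ hh8 (k := k) (z := p.1) (z' := p.2) (e2.trans e1.symm) (a := 1) (Λ := lam' / y) one_pos le_rfl (by positivity)
        rw [e1] at D2
        let o : Opn β (Atom.cell k u w).reg := ⟨ch u p.1 ++ ch w p.2, fun t => ind (¬ fine t j b), F2 p, _, _,
          (o1.append o2 (cellE_disj fun h => hc h.symm)).mono (Finset.union_subset (hsub u rfl) (hsub w ha)), hnf b hb, D2⟩
        refine o.good.mono (fun t => le_rfl) ?_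
        simp only [Opn.c, o, Uc]
        gcongr
        refine three_pow_le hx0 hx1 ?_
        rw [List.length_append]; omega
      have hS := Good.sum (β := β) (x := x) (y := y) (lam := lam) (j := j) (R := (Atom.cell k u w).reg) (cells (j+1) (anc (j+1) u) ×ˢ cells (j+1) (anc (j+1) w))
        (fun p t => V u p t + V w p t) (fun _ => Uc β y lam' j + Uc β y lam' j) (fun p hp => (hV u rfl p hp).add (hV w ha p hp))
      refine (hm.add hS).mono (fun t => ?_) ?_
      · by_cases hf : fine t j u ∧ fine t j w
        · refine (val_main hx0 hlx _ ?_).trans le_self_add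
          intro k' u' w' h _ _
          cases h
          exact hf
        by_cases hF : ∀ m, j+1 ≤ m → m < k → fine t m u ∧ fine t m w
        swap
        · simp only [Atom.val]; rw [ind_false hF, zero_mul]; exact zero_le
        refine le_trans ?_ le_add_self
        have hk2 : j + 1 < k := by
          rcases Nat.lt_or_ge (j+1) k with h | h
          · exact h
          · obtain rfl : k = j+1 := by omega
            exact absurd ha hc
        obtain ⟨z1, a1, c1⟩ := core_ex (j+1) _ (valid_of_fine (hF (j+1) le_rfl hk2).1)
        obtain ⟨z2, a2, c2⟩ := core_ex (j+1) _ (valid_of_fine (hF (j+1) le_rfl hk2).2)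
        have c1' : chaincore t k z1 := cc_extend c1 a1 fun m h1 h2 => (hF m h1 h2).1
        have c2' : chaincore t k z2 := cc_extend c2 a2 fun m h1 h2 => (hF m h1 h2).2
        have hmem : (z1, z2) ∈ cells (j+1) (anc (j+1) u) ×ˢ cells (j+1) (anc (j+1) w) := by
          rw [Finset.mem_product, mem_cells, mem_cells]; exact ⟨a1, a2⟩
        refine le_trans ?_ (Finset.single_le_sum (f := fun p => V u p t + V w p t) (fun i _ => zero_le) hmem)
        obtain ⟨o1, l1, v1, d1⟩ := hch u z1 a1
        obtain ⟨o2, l2, v2, d2⟩ := hch w z2 a2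
        have key : ∀ b, ¬ fine t j b → (Atom.cell k u w).val lam' (j+1) t ≤ V b (z1, z2) t := by
          intro b hb
          simp only [V, F2]
          rw [ind_true hb, ind_true ⟨c1', c2'⟩, PV_lv (by intro g hg; rcases List.mem_append.1 hg with h | h; exacts [v1 g h, v2 g h]),
            one_mul, oexp_rpow, oexp_rpow, ENNReal.one_rpow, mul_one, ← ENNReal.ofReal_mul (Real.exp_pos _).le, ← Real.exp_add]
          calc _ ≤ 1 * ENNReal.ofReal (Real.exp (lam' * |t u - t w|)) := mul_le_mul_left (ind_le_one _) _
            _ ≤ _ := by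
              rw [one_mul, mul_right_comm lam, hlx, mul_right_comm (lam' / y), div_mul_cancel₀ _ hy.ne', ← mul_add]
              apply ENNReal.ofReal_le_ofReal; apply Real.exp_le_exp.2
              refine mul_le_mul_of_nonneg_left ?_ hl'
              rw [List.map_append, List.sum_append]
              have t1 := abs_sub_le (t u) (t z1) (t w)
              have t2 := abs_sub_le (t z1) (t z2) (t w)
              have t3 := d1 t
              have t4 := d2 t
              rw [abs_sub_comm] at t4
              linarith
        by_cases hu : fine t j u
        · exact (key w fun hw => hf ⟨hu, hw⟩).trans le_add_self
        · exact (key u hu).trans le_self_add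
      · refine add_le_add le_rfl (le_of_eq ?_)
        rw [Finset.sum_const, Finset.card_product, cells_card', cells_card', nsmul_eq_mul, two_mul]
end

end

end PartD3

section PartD4
open scoped BigOperators Classical ENNReal
open MeasureTheory Matrix
noncomputable section

def Cst : ℝ := Real.log 8 + 2 + 12 * Real.log rh + 2 * Nc * Real.log 3 + Real.log n1 + Real.log 3

lemma Cst_pos : 0 ≤ Cst := by
  have h1 : (1:ℝ) ≤ rh := by exact_mod_cast rh_pos
  have h2 : (1:ℝ) ≤ n1 := by exact_mod_cast n1_pos
  have := Real.log_nonneg h1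
  have := Real.log_nonneg h2
  have := Real.log_nonneg (show (1:ℝ) ≤ 8 by norm_num)
  have := Real.log_nonneg (show (1:ℝ) ≤ 3 by norm_num)
  unfold Cst; positivity

structure Big (s : ℝ) : Prop where
  hs : 7 ≤ s
  h8 : 8 * s^2 ≤ hh (s^4)
  c1 : 2 * s + Real.log (4*10^5) + 1 ≤ g0 (s^4) * (1/(4*s))^2/24
  c2 : Real.log (4*10^5) ≤ g0 (s^4) / 24
  c4 : Cst + 2 * s + 8 + Real.log (Wb (s^4)) / 16 ≤ 0

lemma ev_poly {A : ℝ} (hA : 0 < A) (B D : ℝ) : ∀ᶠ s : ℝ in Filter.atTop, B * s + D ≤ A * s^2 := by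
  filter_upwards [Filter.eventually_ge_atTop 1, Filter.eventually_ge_atTop ((|B| + |D|)/A)] with s h1 h2
  rw [div_le_iff₀ hA] at h2
  have := le_abs_self B
  have := le_abs_self D
  nlinarith [abs_nonneg D]

lemma log_Wb (β : ℝ) : Real.log (Wb β) = Real.log (16 * (n1:ℝ)^2 * 10^5) - g0 β * al^2/24 := by
  have h2 : (1:ℝ) ≤ n1 := by exact_mod_cast n1_pos
  rw [Wb, wb, ← mul_assoc, Real.log_mul (by positivity) (Real.exp_pos _).ne', Real.log_exp]; ring

lemma ev_big : ∀ᶠ s : ℝ in Filter.atTop, Big s := by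
  have hM := Mc_pos
  have hal := al_pos
  have hsq : Filter.Tendsto (fun s : ℝ => s^2) Filter.atTop Filter.atTop := Filter.tendsto_pow_atTop (by norm_num)
  have e1 := hsq.eventually (ev_poly (A := 1/(200*Mc)/96) (by positivity) 8 (Real.log (10^5)))
  have e2 := ev_poly (A := 1/(200*Mc)/384) (by positivity) 2 (Real.log (4*10^5) + 1)
  have e3 := hsq.eventually (ev_poly (A := 1/(200*Mc)/24) (by positivity) 0 (Real.log (4*10^5)))
  have e4 := hsq.eventually (ev_poly (A := 1/(200*Mc)*al^2/24/16) (by positivity) 2 (Cst + 8 + Real.log (16 * (n1:ℝ)^2 * 10^5)/16))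
  filter_upwards [e1, e2, e3, e4, Filter.eventually_ge_atTop 7] with s h1 h2 h3 h4 hs
  have hs0 : s ≠ 0 := by positivity
  have hg : g0 (s^4) = 1/(200*Mc) * s^4 := by unfold g0; field_simp
  refine ⟨hs, ?_, ?_, ?_, ?_⟩
  · rw [hh, hg]; nlinarith
  · rw [hg]
    calc _ ≤ _ := by linarith
      _ ≤ _ := h2
      _ = _ := by field_simp; ring
  · rw [hg]; nlinarith
  · rw [log_Wb, hg]; nlinarith

section
variable {s : ℝ}

lemma Big.pos (h : Big s) : 0 < s := by have := h.hs; linarith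
lemma Big.hh8 (h : Big s) : 8 ≤ hh (s^4) := by have := h.hs; have := h.h8; nlinarith

lemma exp_log_le {a b : ℝ} (ha : 0 < a) (h : b + Real.log a + 1 ≤ 0) : a * Real.exp b ≤ 0.4 := by
  have h1 : a * Real.exp b = Real.exp (b + Real.log a) := by rw [Real.exp_add, Real.exp_log ha, mul_comm]
  have h2 : Real.exp (b + Real.log a) ≤ Real.exp (-1) := Real.exp_le_exp.2 (by linarith)
  have h3 := Real.exp_one_gt_d9
  have h4 : Real.exp (-1) ≤ 0.4 := by
    rw [Real.exp_neg, inv_le_comm₀ (Real.exp_pos _) (by norm_num)]; norm_num; linarith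
  linarith

lemma exp_half : Real.exp (1/2) ≤ 1.7 := by
  have h3 := Real.exp_one_lt_d9
  have h : Real.exp (1/2) * Real.exp (1/2) = Real.exp 1 := by rw [← Real.exp_add]; norm_num
  nlinarith [Real.exp_pos (1/2)]

lemma Big.abd0 (h : Big s) : Abd (s^4) (1/(4*s)) (2*s) ≤ 3 := by
  have hs := h.pos
  have hs7 := h.hs
  have h8 := h.h8
  have hp : 0 < hh (s^4) := by nlinarith
  unfold Abd
  have a1 : Real.exp (2*s*(1/(4*s))) ≤ 1.7 := by
    rw [show 2*s*(1/(4*s)) = 1/2 by field_simp; norm_num]; exact exp_half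
  have a2 : 4*10^5 * Real.exp (2*s - g0 (s^4) * (1/(4*s))^2/24) ≤ 0.4 := exp_log_le (by norm_num) (by have := h.c1; linarith)
  have a3 : 1 * Real.exp (2*s + (2*s)^2/hh (s^4) - hh (s^4)/4) ≤ 0.4 := by
    apply exp_log_le one_pos
    have : (2*s)^2/hh (s^4) ≤ 1 := by rw [div_le_one hp]; nlinarith
    rw [Real.log_one]; nlinarith
  rw [one_mul] at a3
  linarith

lemma Big.abd1 (h : Big s) {Λ : ℝ} (hΛ : 0 ≤ Λ) : Abd (s^4) 1 Λ ≤ 3 * Real.exp (Λ + Λ^2/hh (s^4)) := by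
  have hp : 0 < hh (s^4) := by have := h.hh8; linarith
  have h0 : 0 ≤ Λ^2/hh (s^4) := by positivity
  unfold Abd
  have a1 : Real.exp (Λ*1) ≤ Real.exp (Λ + Λ^2/hh (s^4)) := Real.exp_le_exp.2 (by linarith)
  have a3 : Real.exp (Λ + Λ^2/hh (s^4) - hh (s^4)/4) ≤ Real.exp (Λ + Λ^2/hh (s^4)) := Real.exp_le_exp.2 (by linarith)
  have a2 : 4*10^5 * Real.exp (Λ - g0 (s^4) * 1^2/24) ≤ Real.exp (Λ + Λ^2/hh (s^4)) := by
    rw [show (4*10^5 : ℝ) * Real.exp (Λ - g0 (s^4) * 1^2/24) = Real.exp (Real.log (4*10^5) + (Λ - g0 (s^4) * 1^2/24)) by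
      rw [Real.exp_add, Real.exp_log (by norm_num)]]
    apply Real.exp_le_exp.2
    have := h.c2; linarith
  linarith

/-- the numeric bound of one inductive step -/
lemma Big.step (h : Big s) (j : ℕ) {y lam' : ℝ} (hy1 : (3/4)^j/16 ≤ y) (hy2 : y ≤ 1) (hl0 : 0 ≤ lam') (hl : lam' ≤ 2*s) :
    ((rh:ℝ)^(j+1))^3 * (rh^(j+1))^3 * (2 * (3^(2*Nc) * (n1 * Wb (s^4)^(2^j))^y * (Abd (s^4) 1 (lam'/y))^y)) ≤ (3/4)^j/4 := by
  have hs := h.pos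
  have hp : 0 < hh (s^4) := by have := h.hh8; linarith
  have hy : 0 < y := lt_of_lt_of_le (by positivity) hy1
  have hW := Wb_pos (s^4)
  have hn : (1:ℝ) ≤ n1 := by exact_mod_cast n1_pos
  have hr : (1:ℝ) ≤ rh := by exact_mod_cast rh_pos
  have hq : (1:ℝ) + j * (1/2) ≤ (3/2)^j := by
    have := one_add_mul_le_pow (a := (1/2:ℝ)) (by norm_num) j
    norm_num at this ⊢; linarith
  set q : ℝ := (3/2)^j with hqd
  have hlr := Real.log_nonneg hr
  have hln := Real.log_nonneg hn
  have hc := Cst_pos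
  have hlW : Real.log (Wb (s^4)) ≤ 0 := by have := h.c4; linarith
  -- exponent forms
  have e1 : (rh:ℝ)^(j+1) = Real.exp ((j+1) * Real.log rh) := by
    rw [← Real.rpow_natCast, Real.rpow_def_of_pos (by linarith)]; push_cast; ring_nf
  have e2 : (3:ℝ)^(2*Nc) = Real.exp (2*Nc * Real.log 3) := by
    rw [← Real.rpow_natCast, Real.rpow_def_of_pos (by norm_num)]; push_cast; ring_nf
  have e3 : (n1 * Wb (s^4)^(2^j))^y ≤ Real.exp (Real.log n1 + q * (Real.log (Wb (s^4))/16)) := by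
    rw [Real.rpow_def_of_pos (by positivity), Real.log_mul (by positivity) (by positivity), Real.log_pow]
    apply Real.exp_le_exp.2
    have h1 : q/16 ≤ 2^j * y := by
      calc q/16 = 2^j * ((3/4)^j/16) := by rw [hqd, show (3/2:ℝ) = 2 * (3/4) by norm_num, mul_pow]; ring
        _ ≤ _ := by gcongr
    push_cast
    nlinarith
  have e4 : (Abd (s^4) 1 (lam'/y))^y ≤ Real.exp (Real.log 3 + q * (2 * s + 8)) := by
    calc _ ≤ (3 * Real.exp (lam'/y + (lam'/y)^2/hh (s^4)))^y := by
          have : 0 ≤ lam'/y := by positivity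
          have h1 := Abd_one (β := s^4) this
          exact Real.rpow_le_rpow (by linarith) (h.abd1 this) hy.le
      _ = Real.exp (y * Real.log 3 + (lam' + lam'^2/y/hh (s^4))) := by
          rw [Real.rpow_def_of_pos (by positivity), Real.log_mul (by norm_num) (Real.exp_pos _).ne', Real.log_exp]
          congr 1; field_simp
      _ ≤ _ := by
          apply Real.exp_le_exp.2
          have h3 := Real.log_nonneg (show (1:ℝ) ≤ 3 by norm_num)
          have hy' : 1/y ≤ 16 * q := by
            rw [div_le_iff₀ hy]
            calc (1:ℝ) ≤ q * (3/4)^j := by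
                  rw [hqd, ← mul_pow]; exact one_le_pow₀ (by norm_num)
              _ = 16 * q * ((3/4)^j/16) := by ring
              _ ≤ _ := by gcongr
          have a : lam'^2/y/hh (s^4) ≤ 8 * q := by
            rw [div_le_iff₀ hp]
            calc lam'^2/y = lam'^2 * (1/y) := by ring
              _ ≤ (2*s)^2 * (16*q) := by gcongr
              _ = 8 * q * (8 * s^2) := by ring
              _ ≤ _ := by have := h.h8; gcongr
          have b : lam' ≤ q * (2*s) := by nlinarith
          nlinarith
  have e5 : (4/3:ℝ)^j ≤ Real.exp j := by
    rw [← Real.exp_one_pow]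
    have := Real.exp_one_gt_d9
    gcongr; linarith
  have e6 : (8:ℝ) * ((rh:ℝ)^(j+1))^3 * (rh^(j+1))^3 * (3^(2*Nc) * (n1 * Wb (s^4)^(2^j))^y * (Abd (s^4) 1 (lam'/y))^y) * (4/3)^j ≤ 1 := by
    have hA0 : 0 ≤ (Abd (s^4) 1 (lam'/y))^y := by
      apply Real.rpow_nonneg
      linarith [Abd_one (β := s^4) (show 0 ≤ lam'/y by positivity)]
    calc _ ≤ Real.exp (Real.log 8) * Real.exp ((j+1) * Real.log rh)^3 * Real.exp ((j+1) * Real.log rh)^3 *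
          (Real.exp (2*Nc * Real.log 3) * Real.exp (Real.log n1 + q * (Real.log (Wb (s^4))/16)) * Real.exp (Real.log 3 + q * (2 * s + 8))) * Real.exp j := by
          rw [e1, e2, Real.exp_log (by norm_num)]
          gcongr
      _ = Real.exp (Real.log 8 + 6*((j+1) * Real.log rh) + (2*Nc * Real.log 3 + (Real.log n1 + q * (Real.log (Wb (s^4))/16)) + (Real.log 3 + q * (2 * s + 8))) + j) := by
          simp only [← Real.exp_nat_mul, ← Real.exp_add]; congr 1; push_cast; ring
      _ ≤ Real.exp (q * (Cst + 2 * s + 8 + Real.log (Wb (s^4)) / 16)) := by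
          apply Real.exp_le_exp.2
          have hj : (0:ℝ) ≤ j := Nat.cast_nonneg j
          have hq1 : 1 ≤ q := by linarith
          have p1 : Real.log 8 ≤ q * Real.log 8 := le_mul_of_one_le_left (Real.log_nonneg (by norm_num)) hq1
          have p2 : 6*((j+1) * Real.log rh) ≤ q * (12 * Real.log rh) := by nlinarith
          have p3 : 2*Nc * Real.log 3 ≤ q * (2*Nc * Real.log 3) := le_mul_of_one_le_left (mul_nonneg (by positivity) (Real.log_nonneg (by norm_num))) hq1
          have p4 : Real.log n1 ≤ q * Real.log n1 := le_mul_of_one_le_left hln hq1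
          have p5 : Real.log 3 ≤ q * Real.log 3 := le_mul_of_one_le_left (Real.log_nonneg (by norm_num)) hq1
          have p6 : (j:ℝ) ≤ q * 2 := by linarith
          unfold Cst
          linarith
      _ ≤ 1 := by
          apply Real.exp_le_one_iff.2
          exact mul_nonpos_of_nonneg_of_nonpos (by positivity) h.c4
  have h34 : (3/4:ℝ)^j * (4/3)^j = 1 := by rw [← mul_pow]; norm_num
  have hpos : (0:ℝ) < (3/4)^j := by positivity
  calc _ = (3/4:ℝ)^j / 4 * ((8:ℝ) * ((rh:ℝ)^(j+1))^3 * (rh^(j+1))^3 * (3^(2*Nc) * (n1 * Wb (s^4)^(2^j))^y * (Abd (s^4) 1 (lam'/y))^y) * (4/3)^j) := by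
        linear_combination (-(2 * ((rh:ℝ)^(j+1))^3 * (rh^(j+1))^3 * (3^(2*Nc) * (n1 * Wb (s^4)^(2^j))^y * (Abd (s^4) 1 (lam'/y))^y))) * h34
    _ ≤ (3/4:ℝ)^j / 4 * 1 := by gcongr
    _ = _ := by ring

lemma three_rpow {w : ℝ} (h0 : 0 ≤ w) (h1 : w ≤ 1) : (3:ℝ)^(1-w) + 2 * w ≤ 3 := by
  have h := convexOn_exp.2 (Set.mem_univ (Real.log 3)) (Set.mem_univ 0) (show 0 ≤ 1-w by linarith) h0 (by ring)
  simp only [smul_eq_mul, mul_zero, add_zero, Real.exp_zero, mul_one] at h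
  rw [Real.exp_log (by norm_num)] at h
  rw [Real.rpow_def_of_pos (by norm_num), mul_comm]
  linarith

def lamj (s : ℝ) (j : ℕ) : ℝ := s * (1 + (3/4)^j)

lemma Big.claim0 (h : Big s) {μ : Measure Fld} {WE : Set Edge} (hT : HT μ (s^4) WE) : Claim μ WE (lamj s 0) 0 := by
  have hs := h.pos
  have hs7 := h.hs
  refine claim_zero (by positivity) hT ?_
  have hl : lamj s 0 = 2 * s := by unfold lamj; norm_num; ring
  rw [hl]
  rintro (⟨k, x, z⟩ | e) ha
  · have hA := Alem (β := s^4) (by positivity) h.hh8 (k := k) (z := x) (z' := z) ha (a := 1/(4*s)) (Λ := 2*s) (by positivity)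
      (by rw [div_le_one (by positivity)]; linarith) (by positivity)
    refine hA.mono (fun t => ?_) ?_
    · simp only [Atom.val]
      gcongr
      apply ind_mono
      intro hf
      have hz : chaincore t 0 x ∧ chaincore t 0 z := by
        constructor <;> intro m hm <;> omega
      exact ⟨cc_extend hz.1 rfl fun m _ h2 => (hf m (Nat.zero_le _) h2).1, cc_extend hz.2 rfl fun m _ h2 => (hf m (Nat.zero_le _) h2).2⟩
    · rw [show (3:ℝ≥0∞) = ENNReal.ofReal 3 by norm_num]
      exact ENNReal.ofReal_le_ofReal h.abd0
  · have hE := (edgeE (β := s^4) (by positivity) e (s^4/2) (by positivity) le_rfl {e} (by simp)).const_mul (ENNReal.ofReal (Real.exp (1/2)))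
    refine hE.mono (fun t => ?_) ?_
    · simp only [Atom.val]
      rw [← ENNReal.ofReal_mul (Real.exp_pos _).le, ← Real.exp_add]
      apply ENNReal.ofReal_le_ofReal; apply Real.exp_le_exp.2
      have h1 := cosh_lb (t e.1 - t (e.1 + ev e.2))
      rw [← sq_abs] at h1
      set d := |t e.1 - t (e.1 + ev e.2)|
      have h2 : s^4/2 * (d^2/2) ≤ s^4/2 * (Real.cosh (t e.1 - t (e.1 + ev e.2)) - 1) := by
        apply mul_le_mul_of_nonneg_left _ (by positivity); linarith
      have h3 : (7*s*d)^2 ≤ (s^2*d)^2 := by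
        have : 0 ≤ d := abs_nonneg _
        gcongr; nlinarith
      nlinarith [sq_nonneg (2*s*d-1)]
    · rw [s2, ← ENNReal.ofReal_mul (Real.exp_pos _).le, show (3:ℝ≥0∞) = ENNReal.ofReal 3 by norm_num]
      apply ENNReal.ofReal_le_ofReal
      have h2 : Real.sqrt 2 ≤ 1.5 := by rw [Real.sqrt_le_left (by norm_num)]; norm_num
      have := exp_half
      calc _ ≤ (1.7:ℝ) * 1.5 := by gcongr
        _ ≤ 3 := by norm_num

lemma Big.claim (h : Big s) {μ : Measure Fld} {WE : Set Edge} (hT : HT μ (s^4) WE) (j : ℕ) : Claim μ WE (lamj s j) j := by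
  have hs := h.pos
  induction j with
  | zero => exact h.claim0 hT
  | succ j ih =>
    set p : ℝ := (3/4)^j with hp
    have hp0 : 0 < p := by positivity
    have hp1 : p ≤ 1 := pow_le_one₀ (by norm_num) (by norm_num)
    have hlj : lamj s j = s * (1+p) := rfl
    have hlj' : lamj s (j+1) = s * (1 + 3/4*p) := by unfold lamj; rw [pow_succ]; ring
    set y : ℝ := p/(8*(1+p)) with hy
    have hyp : 0 < y := by positivity
    have hy1 : p/16 ≤ y := by rw [hy]; gcongr; linarith
    have hy2 : y ≤ 1/8 := by rw [hy, div_le_div_iff₀ (by positivity) (by norm_num)]; linarith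
    have hx : (1+p) * (1-2*y) = 1 + 3/4*p := by rw [hy]; field_simp; ring
    refine claim_step (x := 1-2*y) (y := y) (by positivity) hT ih (by linarith) hyp.le (by ring) fun a ha => ?_
    refine (atom_good (by positivity) h.hh8 (lam' := lamj s (j+1)) (by rw [hlj']; positivity) (by rw [hlj, hlj', ← hx]; ring) (by linarith) (by linarith) hyp ha).mono (fun t => le_rfl) ?_
    have hst := h.step j (y := y) (lam' := lamj s (j+1)) hy1 (by linarith) (by rw [hlj']; positivity) (by rw [hlj']; nlinarith)
    have h3 := three_rpow (w := 2*y) (by linarith) (by linarith)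
    have hW := Wb_pos (s^4)
    have hA := Abd_one (β := s^4) (Λ := lamj s (j+1) / y) (by rw [hlj']; positivity)
    have : Uc (s^4) y (lamj s (j+1)) j = ENNReal.ofReal (3^(2*Nc) * (n1 * Wb (s^4)^(2^j))^y * (Abd (s^4) 1 (lamj s (j+1)/y))^y) := by
      rw [Uc, ENNReal.ofReal_rpow_of_nonneg (by positivity) hyp.le, ENNReal.ofReal_rpow_of_nonneg (by linarith) hyp.le,
        ENNReal.ofReal_mul (p := 3^(2*Nc) * (n1 * Wb (s^4)^(2^j))^y) (by positivity), ENNReal.ofReal_mul (p := 3^(2*Nc)) (by positivity), ENNReal.ofReal_pow (by norm_num)]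
      norm_num
    rw [this, show (3:ℝ≥0∞) = ENNReal.ofReal 3 by norm_num, show (2:ℝ≥0∞) = ENNReal.ofReal 2 by norm_num, ← ENNReal.ofReal_mul (by norm_num),
      ← ENNReal.ofReal_natCast, ← ENNReal.ofReal_mul (by positivity), ENNReal.ofReal_rpow_of_nonneg (by norm_num) (by linarith), ← ENNReal.ofReal_add (by positivity) ?_]
    · apply ENNReal.ofReal_le_ofReal
      push_cast
      linarith
    · have : 0 ≤ (Abd (s^4) 1 (lamj s (j+1)/y))^y := Real.rpow_nonneg (by linarith) _
      positivity
end

end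

end PartD4

section PartE1
open scoped BigOperators Classical ENNReal
open MeasureTheory Matrix
noncomputable section

section fin
variable {n : ℕ} [NeZero n]

lemma dens_meas (β ε : ℝ) (hβ : 0 ≤ β) (hε : 0 < ε) : Measurable (fun t : Torus n → ℝ => ENNReal.ofReal (Real.exp (-(freeEnergy β ε t)) *
    ((Real.sqrt (2 * Real.pi))⁻¹) ^ (Fintype.card (Torus n)))) := by
  apply Measurable.ennreal_ofReal
  apply Measurable.mul_const
  simp only [exp_neg_F β ε hβ hε]
  exact (wtW_cont _ _).measurable.const_mul _

lemma HT_win {β ε : ℝ} (hβ : 0 ≤ β) (hε : 0 < ε) (o : Torus n) (S : Finset Site) (hS : ∀ x ∈ S, ∀ y ∈ S, phi o x = phi o y → x = y) :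
    HT (mu n β ε o) β {e | e.1 ∈ S ∧ e.1 + ev e.2 ∈ S} := by
  intro E hE l hl
  have h := hT β ε hβ hε o S hS E hE l hl
  rw [← lintegral_indicator (Evt_meas β l E)] at h
  refine le_trans h ?_
  rw [s2, ENNReal.ofReal_pow (Real.sqrt_nonneg _)]

lemma mass_le {β ε : ℝ} (hβ : 0 ≤ β) (hε : 0 < ε) : mu0 n β ε Set.univ ≤ 1 := by
  have h := hT (L := n) β ε hβ hε 0 ∅ (by simp) ∅ (by simp) [] (by simp)
  have hE : Evt β [] ∅ = Set.univ := by
    ext t; simp [Evt, Gam, En]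
  rw [hE] at h
  simp only [Csum, List.map_nil, List.sum_nil, Real.exp_zero, ENNReal.ofReal_one, lintegral_const, one_mul, List.length_nil, pow_zero,
    Measure.restrict_univ] at h
  rwa [mu, Measure.map_apply (tau_meas _) MeasurableSet.univ, Set.preimage_univ] at h

def Bd (β ε s : ℝ) (a b : Torus n) : Prop := ∫⁻ t, ENNReal.ofReal (Real.exp (s * |t a - t b|)) ∂(mu0 n β ε) ≤ 3

lemma Bd_meas (s : ℝ) (a b : Torus n) : Measurable fun t : Torus n → ℝ => ENNReal.ofReal (Real.exp (s * |t a - t b|)) := by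
  apply Measurable.ennreal_ofReal
  have h : Continuous fun t : Torus n → ℝ => Real.exp (s * |t a - t b|) := by fun_prop
  exact h.measurable

lemma Bd_of_UB {β ε s lam : ℝ} (hl : s ≤ lam) {o : Torus n} {a b : Site}
    (h : UB (mu n β ε o) (fun t => ENNReal.ofReal (Real.exp (lam * |t a - t b|))) 3) : Bd β ε s (phi o a) (phi o b) := by
  obtain ⟨g, hg, h1, h2⟩ := h
  rw [mu, lintegral_map hg (tau_meas o)] at h2
  refine le_trans (lintegral_mono fun t => ?_) h2
  refine le_trans ?_ (h1 _)
  apply ENNReal.ofReal_le_ofReal; apply Real.exp_le_exp.2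
  simp only [tau]
  gcongr

lemma phi_inj (o : Torus n) {x y : Site} (hx : ∀ i, x i < n) (hy : ∀ i, y i < n) (h : phi o x = phi o y) : x = y := by
  funext i
  have h1 := congrFun h i
  simp only [phi, add_right_inj] at h1
  rw [ZMod.natCast_eq_natCast_iff'] at h1
  rwa [Nat.mod_eq_of_lt (hx i), Nat.mod_eq_of_lt (hy i)] at h1

lemma lamj_ge {s : ℝ} (hs : 0 < s) (j : ℕ) : s ≤ lamj s j := by
  unfold lamj
  have : (0:ℝ) < (3/4)^j := by positivity
  nlinarith

lemma Bd_box {s ε : ℝ} (h : Big s) (hε : 0 < ε) (o : Torus n) {K : ℕ} (hK : rh^K ≤ n) (z : Site) (hz : ∀ i, z i < rh^K) :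
    Bd (s^4) ε s o (phi o z) := by
  have hs := h.pos
  have hmem : ∀ x : Site, x ∈ cells K 0 → ∀ i, x i < n := by
    intro x hx i
    have := Fintype.mem_piFinset.1 hx i
    simp at this; omega
  have hH := HT_win (β := s^4) (by positivity) hε o (cells K 0) fun x hx y hy => phi_inj o (hmem x hx) (hmem y hy)
  have hC := h.claim hH K
  have a0 : anc K 0 = 0 := by funext i; simp [anc]
  have az : anc K z = 0 := by funext i; simp only [anc]; rw [Nat.div_eq_of_lt (hz i)]; rfl
  have hok : (Atom.cell K 0 z).ok := by simp only [Atom.ok]; rw [a0, az]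
  have hU := hC [Atom.cell K 0 z] _ (OKL.single hok) ?_
  · have hp : phi o 0 = o := by funext i; simp [phi]
    have := Bd_of_UB (s := s) (lam := lamj s K) (lamj_ge hs K) (o := o) (a := 0) (b := z) (hU.mono (fun t => ?_) (by simp))
    · rwa [hp] at this
    · simp only [PV, List.map_cons, List.map_nil, List.prod_cons, List.prod_nil, mul_one, Atom.val]
      rw [ind_true (by intro m h1 h2; omega), one_mul]
  · intro e he
    simp only [Atom.reg] at he
    rw [a0] at he
    exact mem_edgesIn.1 he

lemma Bd_edge {s ε : ℝ} (h : Big s) (hε : 0 < ε) (hn : 2 ≤ n) (o : Torus n) (d : Fin 3) : Bd (s^4) ε s o (o + unitVec n d) := by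
  have hs := h.pos
  have hmem : ∀ x : Site, x ∈ ({0, 0 + ev d} : Finset Site) → ∀ i, x i < n := by
    intro x hx i
    simp only [Finset.mem_insert, Finset.mem_singleton] at hx
    rcases hx with rfl | rfl
    · simp; omega
    · simp only [ev, Pi.add_apply, Pi.single_apply]; split_ifs <;> simp <;> omega
  have hH := HT_win (β := s^4) (by positivity) hε o {0, 0 + ev d} fun x hx y hy => phi_inj o (hmem x hx) (hmem y hy)
  have hC := h.claim hH 0
  have hok : (Atom.edge (0, d)).ok := trivial
  have hU := hC [Atom.edge (0, d)] _ (OKL.single hok) ?_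
  · have hp : phi o 0 = o := by funext i; simp [phi]
    have := Bd_of_UB (s := s) (lam := lamj s 0) (lamj_ge hs 0) (o := o) (a := 0) (b := 0 + ev d) (hU.mono (fun t => ?_) (by simp))
    · rwa [phi_add, hp] at this
    · simp only [PV, List.map_cons, List.map_nil, List.prod_cons, List.prod_nil, mul_one, Atom.val, le_refl]
  · intro e he
    simp only [Atom.reg, Finset.mem_singleton] at he
    subst he
    simp

lemma Bd_line {s ε : ℝ} (h : Big s) (hε : 0 < ε) (hn : 2 ≤ n) : ∃ M : ℕ, n ≤ 2 * rh * M ∧ ∀ (o : Torus n) (d : Fin 3) (c : ℕ), c ≤ M →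
    Bd (s^4) ε s o (o + c • unitVec n d) := by
  have hr : 2 ≤ rh := by rw [rh_eq, sg_eq]; norm_num
  set K := Nat.log rh n with hK
  have h1 : rh^K ≤ n := Nat.pow_log_le_self rh (by omega)
  have h2 : n < rh^(K+1) := Nat.lt_pow_succ_log_self (by omega) n
  refine ⟨max 1 (rh^K - 1), ?_, ?_⟩
  · have h3 : rh^K ≤ 2 * max 1 (rh^K-1) := by omega
    rw [pow_succ] at h2
    calc n ≤ rh^K * rh := h2.le
      _ ≤ 2 * max 1 (rh^K-1) * rh := Nat.mul_le_mul_right _ h3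
      _ = _ := by ring
  · intro o d c hc
    by_cases hc1 : c = 1
    · subst hc1; rw [one_smul]; exact Bd_edge h hε hn o d
    · have hp : 0 < rh^K := pow_pos (by omega) K
      have hcK : c < rh^K := by omega
      have := Bd_box h hε o h1 (Pi.single d c) (by
        intro i; rw [Pi.single_apply]; split_ifs <;> omega)
      convert this using 1
      funext i
      simp only [phi, Pi.add_apply, Pi.smul_apply, unitVec, Pi.single_apply]
      split_ifs <;> simp

def Jmp (β ε s : ℝ) (x y : Torus n) (r : ℕ) : Prop :=
  ∃ l : List (Torus n × Torus n), l.length = r ∧ (∀ p ∈ l, Bd β ε s p.1 p.2) ∧ ∀ t : Torus n → ℝ, |t x - t y| ≤ (l.map fun p => |t p.1 - t p.2|).sum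

lemma Jmp.trans {β ε s : ℝ} {x y z : Torus n} {r r' : ℕ} (h : Jmp β ε s x y r) (h' : Jmp β ε s y z r') : Jmp β ε s x z (r + r') := by
  obtain ⟨l, a, b, c⟩ := h
  obtain ⟨l', a', b', c'⟩ := h'
  refine ⟨l ++ l', by simp [a, a'], ?_, ?_⟩
  · intro p hp
    rcases List.mem_append.1 hp with hp | hp
    exacts [b p hp, b' p hp]
  · intro t
    rw [List.map_append, List.sum_append]
    have := abs_sub_le (t x) (t y) (t z)
    linarith [c t, c' t]

lemma Jmp_line {β ε s : ℝ} {M : ℕ} (hM : ∀ (o : Torus n) (d : Fin 3) (c : ℕ), c ≤ M → Bd β ε s o (o + c • unitVec n d)) (d : Fin 3) (q : ℕ) :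
    ∀ (o : Torus n) (c : ℕ), c ≤ q * M → Jmp β ε s o (o + c • unitVec n d) q := by
  induction q with
  | zero =>
    intro o c hc
    obtain rfl : c = 0 := by omega
    exact ⟨[], rfl, by simp, by simp⟩
  | succ q ih =>
    intro o c hc
    have h1 := ih o (c - min c M) (by rw [add_mul] at hc; omega)
    have h2 := hM (o + (c - min c M) • unitVec n d) d (min c M) (min_le_right _ _)
    have e : o + (c - min c M) • unitVec n d + (min c M) • unitVec n d = o + c • unitVec n d := by
      rw [add_assoc, ← add_smul]; congr 2; omega
    rw [e] at h2
    exact h1.trans ⟨[(_, _)], rfl, by simpa using h2, by simp⟩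

lemma Jmp_all {s ε : ℝ} (h : Big s) (hε : 0 < ε) (hn : 2 ≤ n) (x y : Torus n) : Jmp (s^4) ε s x y (6 * rh) := by
  obtain ⟨M, h1, h2⟩ := Bd_line (n := n) h hε hn
  have hv : ∀ i, (y i - x i).val ≤ 2 * rh * M := fun i => (ZMod.val_lt _).le.trans h1
  have j0 := Jmp_line h2 0 (2*rh) x (y 0 - x 0).val (hv 0)
  have j1 := Jmp_line h2 1 (2*rh) (x + (y 0 - x 0).val • unitVec n 0) (y 1 - x 1).val (hv 1)
  have j2 := Jmp_line h2 2 (2*rh) (x + (y 0 - x 0).val • unitVec n 0 + (y 1 - x 1).val • unitVec n 1) (y 2 - x 2).val (hv 2)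
  have := (j0.trans j1).trans j2
  rw [show 2*rh + 2*rh + 2*rh = 6*rh by ring] at this
  convert this using 1
  funext i
  fin_cases i <;> simp [unitVec, -ZMod.natCast_val, ZMod.natCast_zmod_val]

lemma exp_sum_le {w : ℝ} (hw : 0 ≤ w) (l : List ℝ) (hw1 : w * l.length ≤ 1) :
    Real.exp (w * l.sum) ≤ 1 + w * l.length * (l.map Real.exp).sum := by
  set T := (l.map Real.exp).sum with hT
  have hT0 : 0 ≤ T := List.sum_nonneg (by simp only [List.mem_map]; rintro _ ⟨a, _, rfl⟩; exact (Real.exp_pos a).le)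
  rcases l.eq_nil_or_concat with rfl | ⟨l', b, hl⟩
  · simp
  have hle : ∀ a ∈ l, Real.exp a ≤ T := by
    intro a ha
    exact List.single_le_sum (by simp only [List.mem_map]; rintro _ ⟨a, _, rfl⟩; exact (Real.exp_pos a).le) _ (List.mem_map_of_mem ha)
  have hTp : 0 < T := lt_of_lt_of_le (Real.exp_pos b) (hle b (by rw [hl]; simp))
  have h1 : l.sum ≤ l.length * Real.log T := by
    have := List.sum_le_card_nsmul l (Real.log T) (fun a ha => by rw [Real.le_log_iff_exp_le hTp]; exact hle a ha)
    rwa [nsmul_eq_mul] at this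
  calc Real.exp (w * l.sum) ≤ Real.exp (Real.log T * (w * l.length)) := by
        apply Real.exp_le_exp.2
        calc w * l.sum ≤ w * (l.length * Real.log T) := by gcongr
          _ = _ := by ring
    _ = T ^ (w * l.length) := (Real.rpow_def_of_pos hTp _).symm
    _ = (1 + (T - 1)) ^ (w * l.length) := by rw [add_sub_cancel]
    _ ≤ 1 + (w * l.length) * (T - 1) := rpow_one_add_le_one_add_mul_self (by linarith) (by positivity) hw1
    _ ≤ _ := by
        have : 0 ≤ w * l.length := by positivity
        nlinarith

lemma cosh_le_exp_abs' (u : ℝ) : Real.cosh u ≤ Real.exp |u| := by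
  rw [← Real.cosh_abs, Real.cosh_eq]
  have : Real.exp (-|u|) ≤ Real.exp |u| := Real.exp_le_exp.2 (by linarith [abs_nonneg u])
  linarith

lemma lsum_ofReal {α : Type*} (l : List α) (f : α → ℝ) (hf : ∀ a, 0 ≤ f a) : ENNReal.ofReal ((l.map f).sum) = (l.map fun a => ENNReal.ofReal (f a)).sum := by
  induction l with
  | nil => simp
  | cons a l ih =>
    simp only [List.map_cons, List.sum_cons]
    rw [ENNReal.ofReal_add (hf a) (List.sum_nonneg (by simp only [List.mem_map]; rintro _ ⟨a, _, rfl⟩; exact hf a)), ih]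

lemma lint_bound {β ε s : ℝ} (hβ : 0 ≤ β) (hε : 0 < ε) (hs : 0 < s) {x y : Torus n} {r : ℕ} (hJ : Jmp β ε s x y r) {m : ℝ} (hm : 0 ≤ m)
    (hmr : 3 * (m / s) * r * r ≤ 1) :
    ∫⁻ t, ENNReal.ofReal (Real.cosh (t x - t y) ^ m) ∂(mu0 n β ε) ≤ 2 := by
  obtain ⟨l, hlen, hB, hd⟩ := hJ
  have hw : 0 ≤ m/s := by positivity
  have hw1 : m/s * r ≤ 1 := by
    rcases Nat.eq_zero_or_pos r with h | h
    · simp [h]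
    · have : (1:ℝ) ≤ r := by exact_mod_cast h
      have h0 : 0 ≤ m/s * r := by positivity
      nlinarith
  have hpt : ∀ t : Torus n → ℝ, ENNReal.ofReal (Real.cosh (t x - t y) ^ m) ≤
      1 + ENNReal.ofReal (m/s*r) * (l.map fun p => ENNReal.ofReal (Real.exp (s * |t p.1 - t p.2|))).sum := by
    intro t
    rw [← lsum_ofReal _ (fun p : Torus n × Torus n => Real.exp (s * |t p.1 - t p.2|)) (fun _ => (Real.exp_pos _).le), ← ENNReal.ofReal_mul (by positivity), ← ENNReal.ofReal_one,
      ← ENNReal.ofReal_add one_pos.le ?_]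
    · apply ENNReal.ofReal_le_ofReal
      have h := exp_sum_le hw (l.map fun p => s * |t p.1 - t p.2|) (by rw [List.length_map, hlen]; exact hw1)
      rw [List.length_map, hlen, List.map_map] at h
      refine le_trans ?_ h
      calc Real.cosh (t x - t y) ^ m ≤ (Real.exp |t x - t y|) ^ m := Real.rpow_le_rpow (Real.cosh_pos _).le (cosh_le_exp_abs' _) hm
        _ = Real.exp (|t x - t y| * m) := (Real.exp_mul _ _).symm
        _ ≤ _ := by
          apply Real.exp_le_exp.2
          rw [List.sum_map_mul_left, ← mul_assoc, div_mul_cancel₀ _ hs.ne', mul_comm]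
          exact mul_le_mul_of_nonneg_left (hd t) hm
    · apply mul_nonneg (by positivity)
      exact List.sum_nonneg (by simp only [List.mem_map]; rintro _ ⟨a, _, rfl⟩; positivity)
  have hsum : ∀ l' : List (Torus n × Torus n), (∀ p ∈ l', Bd β ε s p.1 p.2) →
      Measurable (fun t : Torus n → ℝ => (l'.map fun p => ENNReal.ofReal (Real.exp (s * |t p.1 - t p.2|))).sum) ∧
      ∫⁻ t, (l'.map fun p => ENNReal.ofReal (Real.exp (s * |t p.1 - t p.2|))).sum ∂(mu0 n β ε) ≤ 3 * l'.length := by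
    intro l'
    induction l' with
    | nil => intro _; simp
    | cons a l' ih =>
      intro h
      obtain ⟨i1, i2⟩ := ih fun p hp => h p (by simp [hp])
      simp only [List.map_cons, List.sum_cons, List.length_cons]
      refine ⟨(Bd_meas s a.1 a.2).add i1, ?_⟩
      rw [lintegral_add_left (Bd_meas s a.1 a.2)]
      push_cast
      rw [mul_add, mul_one, add_comm]
      exact add_le_add i2 (h a (by simp))
  obtain ⟨m1, m2⟩ := hsum l hB
  calc _ ≤ ∫⁻ t, (1 + ENNReal.ofReal (m/s*r) * (l.map fun p => ENNReal.ofReal (Real.exp (s * |t p.1 - t p.2|))).sum) ∂(mu0 n β ε) := lintegral_mono hpt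
    _ = mu0 n β ε Set.univ + ENNReal.ofReal (m/s*r) * ∫⁻ t, (l.map fun p => ENNReal.ofReal (Real.exp (s * |t p.1 - t p.2|))).sum ∂(mu0 n β ε) := by
        rw [lintegral_add_left measurable_const, lintegral_const_mul _ m1]; simp
    _ ≤ 1 + ENNReal.ofReal (m/s*r) * (3 * l.length) := by
        gcongr
        exact mass_le hβ hε
    _ ≤ 1 + 1 := by
        gcongr
        rw [hlen, show (3:ℝ≥0∞) = ENNReal.ofReal 3 by norm_num, ← ENNReal.ofReal_natCast, ← ENNReal.ofReal_mul (by norm_num), ← ENNReal.ofReal_mul (by positivity), ← ENNReal.ofReal_one]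
        apply ENNReal.ofReal_le_ofReal
        linarith
    _ = 2 := by norm_num

lemma expect_le {β ε : ℝ} (hβ : 0 ≤ β) (hε : 0 < ε) (f : (Torus n → ℝ) → ℝ) (hf : Measurable f) (hf0 : ∀ t, 0 ≤ f t)
    (h : ∫⁻ t, ENNReal.ofReal (f t) ∂(mu0 n β ε) ≤ 2) : expect β ε f ≤ 2 := by
  unfold expect
  by_cases hi : Integrable (fun t : Torus n → ℝ => f t * Real.exp (-(freeEnergy β ε t)) * ((Real.sqrt (2 * Real.pi))⁻¹) ^ (Fintype.card (Torus n)))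
  · have h1 := ofReal_integral_eq_lintegral_ofReal hi (Filter.Eventually.of_forall fun t => by have := hf0 t; positivity)
    rw [mu0, lintegral_withDensity_eq_lintegral_mul _ (dens_meas β ε hβ hε) hf.ennreal_ofReal] at h
    rw [← ENNReal.ofReal_le_ofReal_iff (by norm_num), h1]
    refine le_trans (le_of_eq ?_) (h.trans (by norm_num))
    congr 1; funext t
    rw [Pi.mul_apply, mul_comm (ENNReal.ofReal _), ← ENNReal.ofReal_mul (hf0 t), mul_assoc]
  · rw [integral_undef hi]; norm_num

end fin

lemma main_ex : ∃ βbar : ℝ, 1 ≤ βbar ∧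
      ∀ β : ℝ, βbar ≤ β → ∀ ε : ℝ, 0 < ε → ∀ L : ℕ, ∀ x y : Torus (L + 2),
        ∀ m : ℝ, 0 ≤ m → m ≤ β ^ ((1 : ℝ) / 8) →
          expect β ε (fun t => Real.cosh (t x - t y) ^ m) ≤ 2 := by
  obtain ⟨s0, hs0⟩ := Filter.eventually_atTop.1 ev_big
  set T : ℝ := max 1 (max s0 ((108 * (rh:ℝ)^2)^2)) with hT
  have hT1 : 1 ≤ T := le_max_left _ _
  refine ⟨T^4, one_le_pow₀ hT1, fun β hβ ε hε L x y m hm hmb => ?_⟩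
  have hβ1 : 0 ≤ β := le_trans (by positivity) hβ
  set s : ℝ := β^((1:ℝ)/4) with hsd
  have hs4 : s^4 = β := by
    rw [hsd, ← Real.rpow_natCast, ← Real.rpow_mul hβ1]; norm_num
  have hsn : 0 ≤ s := Real.rpow_nonneg hβ1 _
  have hTs : T ≤ s := by
    rw [← hs4] at hβ
    exact le_of_pow_le_pow_left₀ (by norm_num) hsn hβ
  have hB : Big s := hs0 s ((le_max_left _ _).trans ((le_max_right _ _).trans hTs))
  have h108 : (108 * (rh:ℝ)^2)^2 ≤ s := (le_max_right _ _).trans ((le_max_right _ _).trans hTs)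
  have hs := hB.pos
  have hr : β^((1:ℝ)/8) = Real.sqrt s := by
    rw [Real.sqrt_eq_rpow, hsd, ← Real.rpow_mul hβ1]; norm_num
  rw [hr] at hmb
  have h108' : 108 * (rh:ℝ)^2 ≤ Real.sqrt s := Real.le_sqrt_of_sq_le h108
  have hJ := Jmp_all (n := L+2) hB hε (by omega) x y
  rw [hs4] at hJ
  refine expect_le hβ1 hε _ ?_ (fun t => Real.rpow_nonneg (Real.cosh_pos _).le _) (lint_bound hβ1 hε hs hJ hm ?_)
  · have h : Continuous fun t : Torus (L+2) → ℝ => Real.cosh (t x - t y) ^ m := by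
      apply Continuous.rpow_const
      · have := Real.continuous_cosh; fun_prop
      · intro t; left; exact (Real.cosh_pos _).ne'
    exact h.measurable
  · push_cast
    rw [show 3 * (m/s) * (6 * (rh:ℝ)) * (6 * rh) = (108 * (rh:ℝ)^2) * m / s by ring, div_le_one hs]
    calc _ ≤ Real.sqrt s * Real.sqrt s := by gcongr
      _ = s := Real.mul_self_sqrt hsn

end

end PartE1

/-- **Theorem 1.** There is `β̄ ≥ 1` such that for `β ≥ β̄`, any `ε > 0`, any torus side
`L ≥ 2`, any sites `x, y` and any real `0 ≤ m ≤ β^{1/8}`,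
`⟨cosh^m(t_x - t_y)⟩ ≤ 2`. -/
theorem field_fluctuations_bounded :
    ∃ βbar : ℝ, 1 ≤ βbar ∧
      ∀ β : ℝ, βbar ≤ β → ∀ ε : ℝ, 0 < ε → ∀ L : ℕ, ∀ x y : Torus (L + 2),
        ∀ m : ℝ, 0 ≤ m → m ≤ β ^ ((1 : ℝ) / 8) →
          expect β ε (fun t => Real.cosh (t x - t y) ^ m) ≤ 2 := by
  exact main_ex

end
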